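/- Let M be an o-minimal structure and let (X,τ) be a definable topological space in M. The following are equivalent: (1) (X,τ) is definably compact; (2) every definable family C of nonempty τ-closed subsets of X having the (m,n)-property for some m ≥ n > dim(∪C) has a finite transversal contained in X; (3) every definable family C of nonempty τ-closed subsets of X having the (m,n)-property for some m ≥ n with n greater than the VC-codensity vc*(C) has a finite transversal contained in X. -/

import Mathlib

open FirstOrder Set

/-- `M` is an o-minimal `L`-structure: a densely linearly ordered structure without endpoints,
whose order is `∅`-definable, and in which every definable (with parameters) subset of `M`
is a finite union of points and open intervals with endpoints in `M ∪ {±∞}`. -/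
def IsOMinimal (L : FirstOrder.Language) (M : Type*) [L.Structure M] [LinearOrder M] : Prop :=
  Nonempty M ∧ DenselyOrdered M ∧ NoMinOrder M ∧ NoMaxOrder M ∧
  Set.Definable (∅ : Set M) L {v : Fin 2 → M | v 0 < v 1} ∧
  ∀ s : Set M, Set.Definable₁ (Set.univ : Set M) L s →
    ∃ F : Finset (Set M), s = ⋃₀ (F : Set (Set M)) ∧
      ∀ t ∈ F, (∃ a : M, t = {a}) ∨ (∃ a b : M, t = Set.Ioo a b) ∨
        (∃ a : M, t = Set.Ioi a) ∨ (∃ a : M, t = Set.Iio a) ∨ t = Set.univ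

/-- The fiber over `u` of a set `D ⊆ M^{m+n}`, i.e. the set `φ(u, M^n)`. -/
def famFiber {M : Type*} {m n : ℕ} (D : Set (Fin m ⊕ Fin n → M)) (u : Fin m → M) :
    Set (Fin n → M) :=
  {v | Sum.elim u v ∈ D}

/-- An `A`-definable family of subsets of `M^n`: the family of fibers `φ(u, M^n)` for `u`
ranging over an `A`-definable index set `Ω`, where `φ` is `A`-definable. -/
def IsDefFamily (L : FirstOrder.Language) {M : Type*} [L.Structure M] (A : Set M) (n : ℕ)
    (S : Set (Set (Fin n → M))) : Prop :=
  ∃ (m : ℕ) (Ω : Set (Fin m → M)) (D : Set (Fin m ⊕ Fin n → M)),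
    Set.Definable A L Ω ∧ Set.Definable A L D ∧ S = famFiber D '' Ω

/-- A family of sets is downward directed: it does not contain `∅` and any two members
contain a common member. -/
def DirectedFam {α : Type*} (S : Set (Set α)) : Prop :=
  ∅ ∉ S ∧ ∀ X ∈ S, ∀ Y ∈ S, ∃ Z ∈ S, Z ⊆ X ∩ Y

/-- `S` is finer than `F`: every member of `F` contains a member of `S`. -/
def FinerThan {α : Type*} (S F : Set (Set α)) : Prop :=
  ∀ X ∈ F, ∃ Y ∈ S, Y ⊆ X

/-- A (complete) `n`-type over `M`: an ultrafilter on the Boolean algebra of definable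
subsets of `M^n`. -/
def IsTypeOn (L : FirstOrder.Language) {M : Type*} [L.Structure M] (n : ℕ)
    (p : Set (Set (Fin n → M))) : Prop :=
  (∀ X ∈ p, Set.Definable (Set.univ : Set M) L X) ∧
  ∅ ∉ p ∧
  (∀ X ∈ p, ∀ Y ∈ p, X ∩ Y ∈ p) ∧
  (∀ X ∈ p, ∀ Y : Set (Fin n → M), Set.Definable (Set.univ : Set M) L Y → X ⊆ Y → Y ∈ p) ∧
  (∀ X : Set (Fin n → M), Set.Definable (Set.univ : Set M) L X → X ∈ p ∨ Xᶜ ∈ p)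

/-- A type `p` is `A`-definable if for every `∅`-definable `D ⊆ M^{m+n}` the set of
parameters `u` with `φ(u, M^n) ∈ p` is `A`-definable. -/
def IsDefTypeOver (L : FirstOrder.Language) {M : Type*} [L.Structure M] (A : Set M) (n : ℕ)
    (p : Set (Set (Fin n → M))) : Prop :=
  ∀ (m : ℕ) (D : Set (Fin m ⊕ Fin n → M)), Set.Definable (∅ : Set M) L D →
    Set.Definable A L {u : Fin m → M | famFiber D u ∈ p}

/-- A family `F` is complete for a family `X` if each member of `X` either contains a member
of `F` or is disjoint from one. -/
def CompleteFor {α : Type*} (F X : Set (Set α)) : Prop :=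
  ∀ Y ∈ X, ∃ Z ∈ F, Z ⊆ Y ∨ Z ∩ Y = ∅

/-- A family of subsets of `M^n` is complete if it decides every definable set. -/
def IsCompleteFam (L : FirstOrder.Language) {M : Type*} [L.Structure M] (n : ℕ)
    (S : Set (Set (Fin n → M))) : Prop :=
  ∀ X : Set (Fin n → M), Set.Definable (Set.univ : Set M) L X → ∃ Z ∈ S, Z ⊆ X ∨ Z ∩ X = ∅

/-- `B` is a basis for the type `p`: a downward directed subfamily generating `p`. -/
def IsBasisOfType {α : Type*} (B p : Set (Set α)) : Prop :=
  B ⊆ p ∧ DirectedFam B ∧ ∀ Y ∈ p, ∃ Z ∈ B, Z ⊆ Y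

/-- `p` has an `A`-definable basis. -/
def HasDefBasis (L : FirstOrder.Language) {M : Type*} [L.Structure M] (A : Set M) (n : ℕ)
    (p : Set (Set (Fin n → M))) : Prop :=
  ∃ B, IsDefFamily L A n B ∧ IsBasisOfType B p

/-- `S` has a finite tame transversal: it is covered by finitely many subfamilies, each of
which extends to a definable type. -/
def HasFTT (L : FirstOrder.Language) {M : Type*} [L.Structure M] (n : ℕ)
    (S : Set (Set (Fin n → M))) : Prop :=
  ∃ (N : ℕ) (p : Fin N → Set (Set (Fin n → M))),
    (∀ i, IsTypeOn L n (p i) ∧ IsDefTypeOver L (Set.univ : Set M) n (p i)) ∧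
    ∀ X ∈ S, ∃ i, X ∈ p i

/-- The `(m,n)`-property: among any `m` members of the family, some `n` have nonempty
intersection. -/
def HasMNProperty {α : Type*} (S : Set (Set α)) (m n : ℕ) : Prop :=
  ∀ F : Finset (Set α), ↑F ⊆ S → F.card = m →
    ∃ G ⊆ F, G.card = n ∧ (⋂₀ (G : Set (Set α))).Nonempty

/-- The o-minimal dimension of `X ⊆ M^k`: the largest `d` such that the image of `X` under some
coordinate projection `M^k → M^d` has nonempty interior in the product of the order topology. -/
noncomputable def oDim {M : Type*} [LinearOrder M] {k : ℕ} (X : Set (Fin k → M)) : ℕ :=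
  letI : TopologicalSpace M := Preorder.topology M
  sSup {d : ℕ | ∃ ι : Fin d → Fin k, Function.Injective ι ∧
    (interior ((fun v : Fin k → M => v ∘ ι) '' X)).Nonempty}

/-- The atom of the sets `f i`, `i ∈ I`, in the Venn diagram of `f`. -/
def vennAtom {α : Type*} {N : ℕ} (f : Fin N → Set α) (I : Finset (Fin N)) : Set α :=
  {x | ∀ i, x ∈ f i ↔ i ∈ I}

/-- The dual shatter function of a family of sets: the maximal number of nonempty Venn-diagram
atoms determined by `N` members of the family. -/
noncomputable def dualShatter {α : Type*} (S : Set (Set α)) (N : ℕ) : ℕ :=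
  sSup {c : ℕ | ∃ f : Fin N → Set α, (∀ i, f i ∈ S) ∧
    c = Nat.card {I : Finset (Fin N) // (vennAtom f I).Nonempty}}

/-- The VC-codensity of a family of sets: the infimum of all real `r ≥ 0` such that the dual
shatter function is `O(N ^ r)`. -/
noncomputable def vcCodensity {α : Type*} (S : Set (Set α)) : ℝ :=
  sInf {r : ℝ | 0 ≤ r ∧ ∃ C : ℝ, ∀ N : ℕ, 1 ≤ N →
    (dualShatter S N : ℝ) ≤ C * (N : ℝ) ^ r}

/-- `C` is a `τ`-closed subset of `X`. -/
def TauClosed {M : Type*} {k : ℕ} (X : Set (Fin k → M)) [TopologicalSpace ↥X]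
    (C : Set (Fin k → M)) : Prop :=
  C ⊆ X ∧ IsClosed (Subtype.val ⁻¹' C : Set ↥X)

/-- `(X,τ)` is a definable topological space with an `A`-definable basis:
`X` is `A`-definable and the topology on `X` has a basis given by an `A`-definable family. -/
def IsDefTopSpaceOver (L : FirstOrder.Language) {M : Type*} [L.Structure M] (A : Set M) {k : ℕ}
    (X : Set (Fin k → M)) [TopologicalSpace ↥X] : Prop :=
  Set.Definable A L X ∧
  ∃ B : Set (Set (Fin k → M)), IsDefFamily L A k B ∧ (∀ U ∈ B, U ⊆ X) ∧
    TopologicalSpace.IsTopologicalBasis ((fun U => (Subtype.val ⁻¹' U : Set ↥X)) '' B)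

/-- `(X,τ)` is a definable topological space. -/
def IsDefTopSpace (L : FirstOrder.Language) {M : Type*} [L.Structure M] {k : ℕ}
    (X : Set (Fin k → M)) [TopologicalSpace ↥X] : Prop :=
  IsDefTopSpaceOver L (Set.univ : Set M) X

/-- `(X,τ)` is definably compact: every definable downward directed family of nonempty
`τ`-closed subsets of `X` has nonempty intersection. -/
def DefinablyCompact (L : FirstOrder.Language) {M : Type*} [L.Structure M] {k : ℕ}
    (X : Set (Fin k → M)) [TopologicalSpace ↥X] : Prop :=
  ∀ C : Set (Set (Fin k → M)), IsDefFamily L (Set.univ : Set M) k C → DirectedFam C →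
    (∀ Y ∈ C, Y.Nonempty ∧ TauClosed X Y) → (⋂₀ C).Nonempty

/-- `x` is a limit of the type `p` in `(X,τ)`: `x` belongs to every `τ`-closed member of `p`. -/
def IsLimitOf {M : Type*} {k : ℕ} (X : Set (Fin k → M)) [TopologicalSpace ↥X]
    (p : Set (Set (Fin k → M))) (x : Fin k → M) : Prop :=
  x ∈ X ∧ ∀ C ∈ p, TauClosed X C → x ∈ C

/-- `(X,τ)` is type-compact: every definable type containing `X` has a limit in `X`. -/
def TypeCompact (L : FirstOrder.Language) {M : Type*} [L.Structure M] {k : ℕ}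
    (X : Set (Fin k → M)) [TopologicalSpace ↥X] : Prop :=
  ∀ p : Set (Set (Fin k → M)), IsTypeOn L k p → IsDefTypeOver L (Set.univ : Set M) k p →
    X ∈ p → ∃ x, IsLimitOf X p x

universe u v w

/-- abstract o-minimal structures -/
class OM (M : Type u) extends LinearOrder M where
  dense : DenselyOrdered M
  nomin : NoMinOrder M
  nomax : NoMaxOrder M
  nonemp : Nonempty M
  Def : ∀ {ι : Type}, Set (ι → M) → Prop
  def_univ : ∀ {ι : Type}, Def (Set.univ : Set (ι → M))
  def_inter : ∀ {ι : Type} {A B : Set (ι → M)}, Def A → Def B → Def (A ∩ B)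
  def_compl : ∀ {ι : Type} {A : Set (ι → M)}, Def A → Def Aᶜ
  def_pre : ∀ {ι κ : Type} (f : ι → κ) {A : Set (ι → M)}, Def A →
    Def ((fun g : κ → M => g ∘ f) ⁻¹' A)
  def_img : ∀ {ι κ : Type} [Finite ι] [Finite κ] (f : ι → κ) {A : Set (κ → M)}, Def A →
    Def ((fun g : κ → M => g ∘ f) '' A)
  def_lt : Def {v : Fin 2 → M | v 0 < v 1}
  def_sing : ∀ a : M, Def {v : Unit → M | v () = a}
  omin : ∀ s : Set M, Def {v : Unit → M | v () ∈ s} →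
    ∃ F : Finset (Set M), s = ⋃₀ (F : Set (Set M)) ∧
      ∀ t ∈ F, (∃ a : M, t = {a}) ∨ (∃ a b : M, t = Set.Ioo a b) ∨
        (∃ a : M, t = Set.Ioi a) ∨ (∃ a : M, t = Set.Iio a) ∨ t = Set.univ

attribute [instance] OM.dense OM.nomin OM.nomax OM.nonemp

/-- types in finite definable bijection with a power of M -/
class Enc (M : outParam (Type u)) (T : Type u) where
  Idx : Type
  fin : Finite Idx
  e : T ≃ (Idx → M)

attribute [instance] Enc.fin

open Enc in
instance (priority := low) encBase {M : Type u} [OM M] : Enc M M where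
  Idx := Unit
  fin := inferInstance
  e := ⟨fun a _ => a, fun f => f (), fun _ => rfl, fun _ => rfl⟩

instance encProd {M T S : Type u} [Enc M T] [Enc M S] : Enc M (T × S) where
  Idx := Enc.Idx T ⊕ Enc.Idx S
  fin := inferInstance
  e := ⟨fun p => Sum.elim (Enc.e p.1) (Enc.e p.2),
    fun f => (Enc.e.symm (f ∘ Sum.inl), Enc.e.symm (f ∘ Sum.inr)),
    fun p => by simp, fun f => by simp⟩

instance encPi {M T : Type u} {ι : Type} [Finite ι] [Enc M T] : Enc M (ι → T) where
  Idx := ι × Enc.Idx T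
  fin := inferInstance
  e := ⟨fun f p => Enc.e (f p.1) p.2, fun g i => Enc.e.symm (fun j => g (i, j)),
    fun f => by ext i; simp, fun g => by ext p; simp⟩

section
variable {M : Type u} [OM M] {T : Type u} [Enc M T] {S : Type u} [Enc M S]
  {R' : Type u} [Enc M R'] {R : Type u} [Enc M R]

/-- definable predicates -/
def Dfn (P : T → Prop) : Prop := OM.Def {v : Enc.Idx T → M | P (Enc.e.symm v)}

/-- definable maps -/
def DM (f : T → S) : Prop := Dfn (fun p : T × S => f p.1 = p.2)

namespace Dfn

theorem and {P Q : T → Prop} (hP : Dfn P) (hQ : Dfn Q) : Dfn fun t => P t ∧ Q t :=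
  OM.def_inter hP hQ

theorem not {P : T → Prop} (hP : Dfn P) : Dfn fun t => ¬ P t := OM.def_compl hP

theorem congr {P Q : T → Prop} (hP : Dfn P) (h : ∀ t, P t ↔ Q t) : Dfn Q := by
  have : P = Q := funext fun t => propext (h t)
  exact this ▸ hP

theorem or {P Q : T → Prop} (hP : Dfn P) (hQ : Dfn Q) : Dfn fun t => P t ∨ Q t :=
  (not (and (not hP) (not hQ))).congr fun t => by tauto

theorem imp {P Q : T → Prop} (hP : Dfn P) (hQ : Dfn Q) : Dfn fun t => P t → Q t :=
  (or (not hP) hQ).congr fun t => by tauto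

theorem iff {P Q : T → Prop} (hP : Dfn P) (hQ : Dfn Q) : Dfn fun t => P t ↔ Q t :=
  (and (imp hP hQ) (imp hQ hP)).congr fun t => by tauto

/-- reindexing -/
theorem reidx (g : Enc.Idx S → Enc.Idx T) {Q : S → Prop} (hQ : Dfn Q) :
    Dfn fun t : T => Q (Enc.e.symm (Enc.e t ∘ g)) := by
  have := OM.def_pre g hQ
  unfold Dfn
  convert this using 1
  ext v
  simp

theorem pre_fst {Q : T → Prop} (hQ : Dfn Q) : Dfn fun p : T × S => Q p.1 :=
  (reidx (T := T × S) Sum.inl hQ).congr fun p => by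
    have : (Enc.e p ∘ Sum.inl : Enc.Idx T → M) = Enc.e p.1 := by
      ext i; rfl
    rw [this]; simp

theorem pre_snd {Q : S → Prop} (hQ : Dfn Q) : Dfn fun p : T × S => Q p.2 :=
  (reidx (T := T × S) Sum.inr hQ).congr fun p => by
    have : (Enc.e p ∘ Sum.inr : Enc.Idx S → M) = Enc.e p.2 := by
      ext i; rfl
    rw [this]; simp

theorem ex {P : T → S → Prop} (hP : Dfn fun p : T × S => P p.1 p.2) :
    Dfn fun t => ∃ s, P t s := by
  have := OM.def_img (Sum.inl : Enc.Idx T → Enc.Idx T ⊕ Enc.Idx S) hP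
  unfold Dfn
  convert this using 1
  ext v
  simp only [mem_ofPred_eq, mem_image]
  constructor
  · rintro ⟨s, hs⟩
    refine ⟨Enc.e (T := T × S) (Enc.e.symm v, s), ?_, ?_⟩
    · change P (Enc.e.symm (Enc.e (T := T × S) (Enc.e.symm v, s))).1
        (Enc.e.symm (Enc.e (T := T × S) (Enc.e.symm v, s))).2
      rw [Equiv.symm_apply_apply]; exact hs
    · ext i
      change Enc.e (Enc.e.symm v) i = v i
      simp
  · rintro ⟨g, hg, rfl⟩
    exact ⟨_, hg⟩

theorem all {P : T → S → Prop} (hP : Dfn fun p : T × S => P p.1 p.2) :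
    Dfn fun t => ∀ s, P t s :=
  (not (ex (P := fun t s => ¬ P t s) (not hP))).congr fun t => by push Not; rfl

theorem tru : Dfn fun _ : T => True := OM.def_univ

theorem const (p : Prop) : Dfn fun _ : T => p := by
  by_cases h : p
  · simpa [h] using tru
  · simpa [h] using not tru

theorem allFin {ι : Type} [Finite ι] {P : T → ι → Prop} (hP : ∀ i, Dfn fun t => P t i) :
    Dfn fun t => ∀ i, P t i := by
  classical
  have := Fintype.ofFinite ι
  have : ∀ F : Finset ι, Dfn fun t => ∀ i ∈ F, P t i := by
    intro F
    induction F using Finset.induction_on with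
    | empty => simpa using tru
    | insert a s ha ih => exact (and (hP a) ih).congr fun t => by simp
  exact (this Finset.univ).congr fun t => by simp

theorem exFin {ι : Type} [Finite ι] {P : T → ι → Prop} (hP : ∀ i, Dfn fun t => P t i) :
    Dfn fun t => ∃ i, P t i :=
  (not (allFin (P := fun t i => ¬ P t i) fun i => not (hP i))).congr fun t => by push Not; rfl

theorem lt0 : Dfn fun p : M × M => p.1 < p.2 := by
  have := OM.def_pre (M := M) (![Sum.inl (), Sum.inr ()] : Fin 2 → Unit ⊕ Unit) OM.def_lt
  exact this

theorem swap {P : T × S → Prop} (h : Dfn P) : Dfn fun p : S × T => P (p.2, p.1) :=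
  (reidx (T := S × T) (Sum.swap : Enc.Idx T ⊕ Enc.Idx S → Enc.Idx S ⊕ Enc.Idx T) h).congr
    fun p => by
      have : (Enc.e p ∘ Sum.swap : Enc.Idx T ⊕ Enc.Idx S → M) = Enc.e (p.2, p.1) := by
        ext (i | i) <;> rfl
      have h2 : Enc.e.symm (Enc.e p ∘ Sum.swap : Enc.Idx T ⊕ Enc.Idx S → M) = (p.2, p.1) := by
        rw [this, Equiv.symm_apply_apply]
      exact iff_of_eq (congrArg P h2)

theorem eq0 : Dfn fun p : M × M => p.1 = p.2 :=
  (and (not lt0) (not (swap lt0))).congr fun p => by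
    simp only [not_lt]
    exact ⟨fun h => le_antisymm h.2 h.1, fun h => ⟨h.ge, h.le⟩⟩

theorem cs (a : M) : Dfn fun x : M => x = a := OM.def_sing a

end Dfn

namespace DM

theorem coord (i : Enc.Idx T) : DM fun t : T => Enc.e t i :=
  Dfn.reidx (T := T × M) (S := M × M)
    (Sum.map (fun _ => i) (fun x => x) : Unit ⊕ Unit → Enc.Idx T ⊕ Unit) Dfn.eq0

theorem of_coord {f : T → S} (h : ∀ i, DM fun t => Enc.e (f t) i) : DM f := by
  have : ∀ i, Dfn fun p : T × S => Enc.e (f p.1) i = Enc.e p.2 i := fun i =>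
    Dfn.reidx (T := T × S) (S := T × M)
      (Sum.map (fun x => x) (fun _ => i) : Enc.Idx T ⊕ Unit → Enc.Idx T ⊕ Enc.Idx S) (h i) |>.congr
      fun p => by
        change Enc.e (f (Enc.e.symm (Enc.e p.1))) i = Enc.e p.2 i ↔ _
        rw [Equiv.symm_apply_apply]
  refine (Dfn.allFin this).congr fun p => ?_
  rw [← funext_iff, Enc.e.injective.eq_iff]

theorem id : DM fun t : T => t := of_coord coord

end DM

theorem Dfn.comp {Q : S → Prop} {f : T → S} (hQ : Dfn Q) (hf : DM f) : Dfn fun t => Q (f t) :=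
  (Dfn.ex (P := fun t s => f t = s ∧ Q s) (Dfn.and hf (Dfn.pre_snd hQ))).congr fun t => by simp

namespace DM

theorem fst0 : DM fun p : T × S => p.1 := of_coord fun i => coord (T := T × S) (Sum.inl i)

theorem snd0 : DM fun p : T × S => p.2 := of_coord fun i => coord (T := T × S) (Sum.inr i)

theorem apply0 {ι : Type} [Finite ι] (i : ι) : DM fun f : ι → T => f i :=
  of_coord fun j => coord (T := ι → T) (i, j)

/-- auxiliary: graph with a fixed parameter -/
theorem prodmap {f : T → S} (hf : DM f) : DM fun p : T × R => (f p.1, p.2) := by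
  have h1 : Dfn fun q : (T × R) × (S × R) => f q.1.1 = q.2.1 :=
    (Dfn.reidx (T := (T × R) × (S × R)) (S := T × S)
      (Sum.map Sum.inl Sum.inl : Enc.Idx T ⊕ Enc.Idx S →
        (Enc.Idx T ⊕ Enc.Idx R) ⊕ (Enc.Idx S ⊕ Enc.Idx R)) hf).congr fun q => by
        change f (Enc.e.symm (Enc.e q.1.1)) = Enc.e.symm (Enc.e q.2.1) ↔ _
        simp
  have h2 : Dfn fun q : (T × R) × (S × R) => q.1.2 = q.2.2 :=
    (Dfn.reidx (T := (T × R) × (S × R)) (S := R × R)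
      (Sum.map Sum.inr Sum.inr : Enc.Idx R ⊕ Enc.Idx R →
        (Enc.Idx T ⊕ Enc.Idx R) ⊕ (Enc.Idx S ⊕ Enc.Idx R)) DM.id).congr fun q => by
        change Enc.e.symm (Enc.e q.1.2) = Enc.e.symm (Enc.e q.2.2) ↔ _
        simp
  exact (Dfn.and h1 h2).congr fun q => by rw [Prod.ext_iff]

theorem comp {g : S → R} {f : T → S} (hg : DM g) (hf : DM f) : DM fun t => g (f t) :=
  Dfn.comp (T := T × R) (f := fun p : T × R => (f p.1, p.2)) hg (prodmap hf)

theorem fst {f : T → S × R} (hf : DM f) : DM fun t => (f t).1 := comp fst0 hf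

theorem snd {f : T → S × R} (hf : DM f) : DM fun t => (f t).2 := comp snd0 hf

theorem pi {ι : Type} [Finite ι] {f : T → ι → S} (h : ∀ i, DM fun t => f t i) :
    DM fun t => f t :=
  of_coord fun i => comp (coord i.2) (h i.1)

theorem lam {ι : Type} [Finite ι] {f : T → ι → S} (h : ∀ i, DM fun t => f t i) :
    DM fun t i => f t i := pi h

theorem app {ι : Type} [Finite ι] {f : T → ι → S} (i : ι) (h : DM fun t => f t) :
    DM fun t => f t i := comp (apply0 i) h

theorem pair {f : T → S} {g : T → R} (hf : DM f) (hg : DM g) : DM fun t => (f t, g t) :=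
  of_coord fun
    | Sum.inl i => comp (coord i) hf
    | Sum.inr i => comp (coord i) hg

theorem const (s : S) : DM fun _ : T => s := of_coord fun i =>
  (Dfn.pre_snd (Dfn.cs (Enc.e s i))).congr fun _ => eq_comm

end DM

namespace Dfn

theorem eq {f g : T → S} (hf : DM f) (hg : DM g) : Dfn fun t => f t = g t :=
  comp (S := S × S) (Q := fun p : S × S => p.1 = p.2) DM.id (DM.pair hf hg)

theorem ne {f g : T → S} (hf : DM f) (hg : DM g) : Dfn fun t => f t ≠ g t := not (eq hf hg)

theorem lt {f g : T → M} (hf : DM f) (hg : DM g) : Dfn fun t => f t < g t :=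
  comp lt0 (DM.pair hf hg)

theorem le {f g : T → M} (hf : DM f) (hg : DM g) : Dfn fun t => f t ≤ g t :=
  (not (lt hg hf)).congr fun _ => not_lt

theorem comp1 {Q : S → Prop} {f : T → S} (hQ : Dfn Q) (hf : DM f) : Dfn fun t => Q (f t) :=
  comp hQ hf

theorem comp1' {Q : S → Prop} {f : T → S} (hQ : Dfn fun t => Q t) (hf : DM f) :
    Dfn fun t => Q (f t) := comp hQ hf

theorem comp2 {Q : S → R → Prop} {f : T → S} {g : T → R} (hQ : Dfn fun p : S × R => Q p.1 p.2)
    (hf : DM f) (hg : DM g) : Dfn fun t => Q (f t) (g t) := comp hQ (DM.pair hf hg)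

theorem comp3 {Q : S → R → R' → Prop} {f : T → S} {g : T → R} {h : T → R'}
    (hQ : Dfn fun p : S × R × R' => Q p.1 p.2.1 p.2.2)
    (hf : DM f) (hg : DM g) (hh : DM h) : Dfn fun t => Q (f t) (g t) (h t) :=
  comp hQ (DM.pair hf (DM.pair hg hh))

end Dfn

theorem DM.comp2 {Q : S → R → R'} {f : T → S} {g : T → R} (hQ : DM fun p : S × R => Q p.1 p.2)
    (hf : DM f) (hg : DM g) : DM fun t => Q (f t) (g t) := DM.comp hQ (DM.pair hf hg)

end

/-- automation for definability goals -/
theorem dfn {P : Prop} (h : P := by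
  repeat' (intros; first
    | assumption
    | with_reducible exact DM.id
    | with_reducible apply DM.const
    | with_reducible apply Dfn.const
    | with_reducible apply DM.fst
    | with_reducible apply DM.snd
    | with_reducible apply DM.pair
    | with_reducible apply Dfn.and
    | with_reducible apply Dfn.or
    | with_reducible apply Dfn.not
    | with_reducible apply Dfn.imp
    | with_reducible apply Dfn.iff
    | with_reducible apply Dfn.ex
    | with_reducible apply Dfn.all
    | with_reducible apply Dfn.exFin
    | with_reducible apply Dfn.allFin
    | with_reducible apply Dfn.lt
    | with_reducible apply Dfn.le
    | with_reducible apply Dfn.eq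
    | with_reducible apply Dfn.ne
    | with_reducible refine Dfn.comp3 (by assumption) ?_ ?_ ?_
    | with_reducible refine Dfn.comp2 (by assumption) ?_ ?_
    | with_reducible refine Dfn.comp1 (by assumption) ?_
    | with_reducible refine Dfn.comp1' (by assumption) ?_
    | with_reducible refine DM.comp2 (by assumption) ?_ ?_
    | with_reducible refine DM.comp (by assumption) ?_
    | with_reducible apply DM.lam
    | with_reducible apply DM.app)) : P := h

section
variable {M : Type u} [OM M]

/-- the set contains a closed interval -/
abbrev Big (P : M → Prop) : Prop := ∃ p q : M, p < q ∧ ∀ x, p ≤ x → x ≤ q → P x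

theorem omin' {P : M → Prop} (hP : Dfn P) : ∃ F : Finset (Set M), (∀ x, P x ↔ ∃ t ∈ F, x ∈ t) ∧
      ∀ t ∈ F, (∃ a : M, t = {a}) ∨ (∃ a b : M, t = Set.Ioo a b) ∨
        (∃ a : M, t = Set.Ioi a) ∨ (∃ a : M, t = Set.Iio a) ∨ t = Set.univ := by
  obtain ⟨F, h1, h2⟩ := OM.omin {x | P x} hP
  refine ⟨F, fun x => ?_, h2⟩
  have : x ∈ {x | P x} ↔ x ∈ ⋃₀ (F : Set (Set M)) := by rw [h1]
  simpa using this

theorem btw {a b : M} (h : a < b) : ∃ p q, a < p ∧ p < q ∧ q < b := by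
  obtain ⟨p, hp, hp'⟩ := exists_between h
  obtain ⟨q, hq, hq'⟩ := exists_between hp'
  exact ⟨p, q, hp, hq, hq'⟩

theorem inf_Icc {a b : M} (h : a < b) : {x : M | a ≤ x ∧ x ≤ b}.Infinite := Set.Icc_infinite h

theorem inf_Ioo {a b : M} (h : a < b) : {x : M | a < x ∧ x < b}.Infinite := Set.Ioo_infinite h

theorem big_of_inf {P : M → Prop} (hP : Dfn P) (h : {x | P x}.Infinite) : Big P := by
  obtain ⟨F, h1, h2⟩ := omin' hP
  have : ∃ t ∈ F, t.Infinite := by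
    by_contra hc
    push Not at hc
    refine h ((Set.Finite.biUnion F.finite_toSet (fun t ht => hc t ht)).subset ?_)
    intro x hx
    simpa using (h1 x).1 hx
  obtain ⟨t, htF, ht⟩ := this
  have key : ∀ a b : M, a < b → Set.Ioo a b ⊆ t → Big P := by
    intro a b hab hs
    obtain ⟨p, q, h3, h4, h5⟩ := btw hab
    exact ⟨p, q, h4, fun x hx hx' => (h1 x).2 ⟨t, htF, hs ⟨h3.trans_le hx, hx'.trans_lt h5⟩⟩⟩
  obtain ⟨z⟩ := (inferInstance : Nonempty M)
  rcases h2 t htF with ⟨a, rfl⟩ | ⟨a, b, rfl⟩ | ⟨a, rfl⟩ | ⟨a, rfl⟩ | rfl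
  · exact absurd (Set.finite_singleton a) ht
  · obtain ⟨x, hx⟩ := ht.nonempty
    exact key a b (hx.1.trans hx.2) (fun x hx => hx)
  · obtain ⟨b, hb⟩ := exists_gt a
    exact key a b hb fun x hx => hx.1
  · obtain ⟨b, hb⟩ := exists_lt a
    exact key b a hb fun x hx => hx.2
  · obtain ⟨b, hb⟩ := exists_lt z
    exact key b z hb fun x hx => trivial

theorem Big.inf {P : M → Prop} (h : Big P) : {x | P x}.Infinite := by
  obtain ⟨p, q, h1, h2⟩ := h
  exact (inf_Icc h1).mono fun x hx => h2 x hx.1 hx.2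

theorem big_iff {P : M → Prop} (hP : Dfn P) : {x | P x}.Infinite ↔ Big P :=
  ⟨big_of_inf hP, Big.inf⟩

/-- the germ of `P` at the start of the upset `H` -/
abbrev Start (H P : M → Prop) : Prop := ∃ c, H c ∧ ∀ x, H x → x ≤ c → P x

/-- upsets -/
abbrev Ups (H : M → Prop) : Prop := ∀ x y, x ≤ y → H x → H y

theorem Start.and {H P Q : M → Prop} (h1 : Start H P) (h2 : Start H Q) :
    Start H (fun x => P x ∧ Q x) := by
  obtain ⟨c, hc, h1⟩ := h1
  obtain ⟨d, hd, h2⟩ := h2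
  rcases le_total c d with h | h
  · exact ⟨c, hc, fun x hx hx' => ⟨h1 x hx hx', h2 x hx (hx'.trans h)⟩⟩
  · exact ⟨d, hd, fun x hx hx' => ⟨h1 x hx (hx'.trans h), h2 x hx hx'⟩⟩

theorem Start.mono {H P Q : M → Prop} (h1 : Start H P) (h : ∀ x, H x → P x → Q x) : Start H Q := by
  obtain ⟨c, hc, h1⟩ := h1
  exact ⟨c, hc, fun x hx hx' => h x hx (h1 x hx hx')⟩

theorem Start.exists {H P : M → Prop} (h1 : Start H P) : ∃ x, H x ∧ P x := by
  obtain ⟨c, hc, h1⟩ := h1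
  exact ⟨c, hc, h1 c hc le_rfl⟩

theorem start_dec {H P : M → Prop} (hH : Ups H) (hne : ∃ x, H x) (hP : Dfn P) :
    Start H P ∨ Start H (fun x => ¬ P x) := by
  classical
  obtain ⟨F, h1, h2⟩ := omin' hP
  have hdec : ∀ t ∈ F, Start H (fun x => x ∈ t) ∨ Start H (fun x => x ∉ t) := by
    intro t ht
    obtain ⟨z, hz⟩ := hne
    have low : ∀ a, H a → Start H (fun x => x ≤ a) := fun a ha => ⟨a, ha, fun x _ hx => hx⟩
    have hmin : ∀ a, H a → Start H (fun x => x < a) ∨ Start H (fun x => x = a) := by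
      intro a ha
      by_cases h : ∃ b, H b ∧ b < a
      · obtain ⟨b, hb, hb'⟩ := h
        exact Or.inl ⟨b, hb, fun x _ hx => hx.trans_lt hb'⟩
      · push Not at h
        exact Or.inr ⟨a, ha, fun x hx hx' => le_antisymm hx' (h x hx)⟩
    have hi : ∀ a, ¬ H a → Start H (fun x => a < x) := by
      intro a ha
      refine ⟨z, hz, fun x hx _ => ?_⟩
      by_contra hc
      exact ha (hH x a (not_lt.1 hc) hx)
    have cmp : ∀ a, Start H (fun x => x < a) ∨ Start H (fun x => x = a) ∨
        Start H (fun x => a < x) := by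
      intro a
      by_cases ha : H a
      · rcases hmin a ha with h | h
        exacts [Or.inl h, Or.inr (Or.inl h)]
      · exact Or.inr (Or.inr (hi a ha))
    rcases h2 t ht with ⟨a, rfl⟩ | ⟨a, b, rfl⟩ | ⟨a, rfl⟩ | ⟨a, rfl⟩ | rfl
    · rcases cmp a with h | h | h
      · exact Or.inr (h.mono fun x _ hx => by simpa using hx.ne)
      · exact Or.inl (h.mono fun x _ hx => by simpa using hx)
      · exact Or.inr (h.mono fun x _ hx => by simpa using hx.ne')
    · rcases cmp a with h | h | h
      · exact Or.inr (h.mono fun x _ hx => by simp [hx.le])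
      · exact Or.inr (h.mono fun x _ hx => by simp [hx])
      · rcases cmp b with h' | h' | h'
        · exact Or.inl ((h.and h').mono fun x _ hx => hx)
        · exact Or.inr (h'.mono fun x _ hx => by simp [hx])
        · exact Or.inr (h'.mono fun x _ hx => by simp [hx.le])
    · rcases cmp a with h | h | h
      · exact Or.inr (h.mono fun x _ hx => by simp [hx.le])
      · exact Or.inr (h.mono fun x _ hx => by simp [hx])
      · exact Or.inl (h.mono fun x _ hx => hx)
    · rcases cmp a with h | h | h
      · exact Or.inl (h.mono fun x _ hx => hx)
      · exact Or.inr (h.mono fun x _ hx => by simp [hx])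
      · exact Or.inr (h.mono fun x _ hx => by simp [hx.le])
    · exact Or.inl ⟨z, hz, fun x _ _ => trivial⟩
  by_cases hex : ∃ t ∈ F, Start H (fun x => x ∈ t)
  · obtain ⟨t, ht, h⟩ := hex
    exact Or.inl (h.mono fun x _ hx => (h1 x).2 ⟨t, ht, hx⟩)
  · push Not at hex
    right
    have : ∀ G : Finset (Set M), G ⊆ F → Start H (fun x => ∀ t ∈ G, x ∉ t) := by
      intro G
      induction G using Finset.induction_on with
      | empty => intro _; obtain ⟨z, hz⟩ := hne; exact ⟨z, hz, fun x _ _ => by simp⟩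
      | insert a s ha ih =>
        intro hs
        have h3 := ih ((Finset.subset_insert a s).trans hs)
        have ha' : a ∈ F := hs (Finset.mem_insert_self a s)
        have h4 : Start H (fun x => x ∉ a) := by
          rcases hdec a ha' with h | h
          · obtain ⟨c, hc, hc'⟩ := h
            obtain ⟨y, hy, hy', hy''⟩ := hex a ha' c hc
            exact absurd (hc' y hy hy') hy''
          · exact h
        exact (h4.and h3).mono fun x _ hx => by simpa using hx
    exact (this F (Finset.Subset.refl F)).mono fun x _ hx hPx => by
      obtain ⟨t, ht, hxt⟩ := (h1 x).1 hPx
      exact hx t ht hxt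

/-- right germ -/
abbrev RG (s : M) (P : M → Prop) : Prop := ∃ c, s < c ∧ ∀ t, s < t → t ≤ c → P t

theorem rg_dec {P : M → Prop} (hP : Dfn P) (s : M) : RG s P ∨ RG s (fun t => ¬ P t) :=
  start_dec (H := fun x => s < x) (fun _ _ h h' => lt_of_lt_of_le h' h) (exists_gt s) hP

theorem ups_gt (s : M) : Ups (fun x => s < x) := fun _ _ h h' => lt_of_lt_of_le h' h

theorem exists_min_of_finite {P : M → Prop} (h : {x | P x}.Finite) (hne : ∃ x, P x) :
    ∃ x, P x ∧ ∀ y, P y → x ≤ y := by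
  obtain ⟨x, hx, hx'⟩ := Set.exists_min_image {x | P x} (fun x => x) h hne
  exact ⟨x, hx, hx'⟩

theorem inf_of_no_min {P : M → Prop} (hne : ∃ x, P x) (h : ∀ x, P x → ∃ y, P y ∧ y < x) :
    {x | P x}.Infinite := by
  intro hf
  obtain ⟨x, hx, hx'⟩ := exists_min_of_finite hf hne
  obtain ⟨y, hy, hy'⟩ := h x hx
  exact absurd (hx' y hy) (not_le.2 hy')

theorem keyR {φ : M → M → Prop} (hφ : Dfn fun p : M × M => φ p.1 p.2) {a b : M} (hab : a < b)
    (h : ∀ s, a < s → s < b → RG s (φ s)) :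
    ∃ p q, a < p ∧ p < q ∧ q < b ∧ ∀ s t, p ≤ s → s < t → t ≤ q → φ s t := by
  let E : M → M → Prop := fun s c => s < c ∧ c < b ∧ ∀ t, s < t → t ≤ c → φ s t
  have hE : Dfn fun p : M × M => E p.1 p.2 := dfn
  have Eex : ∀ s, a < s → s < b → ∃ c, E s c := by
    intro s h1 h2
    obtain ⟨c, hc, hc'⟩ := h s h1 h2
    obtain ⟨d, hd, hd'⟩ := exists_between (lt_min hc h2)
    exact ⟨d, hd, hd'.trans_le (min_le_right _ _), fun t ht ht' =>
      hc' t ht (ht'.trans (hd'.le.trans (min_le_left _ _)))⟩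
  have Edn : ∀ s c c', E s c → s < c' → c' ≤ c → E s c' := fun s c c' h1 h2 h3 =>
    ⟨h2, h3.trans_lt h1.2.1, fun t ht ht' => h1.2.2 t ht (ht'.trans h3)⟩
  by_cases hc : ∃ c, {s | a < s ∧ E s c}.Infinite
  · obtain ⟨c, hc⟩ := hc
    obtain ⟨p, q, hpq, h1⟩ := big_of_inf dfn hc
    refine ⟨p, q, (h1 p le_rfl hpq.le).1, hpq, ?_, ?_⟩
    · have := (h1 q hpq.le le_rfl).2
      exact this.1.trans this.2.1
    · intro s t hs hst ht
      exact (h1 s hs (hst.le.trans ht)).2.2.2 t hst (h1 t (hs.trans hst.le) ht).2.1.le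
  push Not at hc
  exfalso
  let Rec : M → Prop := fun s => a < s ∧ s < b ∧ ∃ c, E s c ∧ ∀ s', a < s' → s' < s → ¬ E s' c
  have hRec : Dfn Rec := dfn
  have rec_ex : ∀ t, a < t → t < b → ∃ s, Rec s ∧ s ≤ t := by
    intro t h1 h2
    obtain ⟨c, hc'⟩ := Eex t h1 h2
    obtain ⟨s, hs, hs'⟩ := exists_min_of_finite (P := fun s => a < s ∧ E s c)
      (hc c) ⟨t, h1, hc'⟩
    have hst := hs' t ⟨h1, hc'⟩
    refine ⟨s, ⟨hs.1, hst.trans_lt h2, c, hs.2, fun s' h3 h4 h5 => ?_⟩, hst⟩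
    exact absurd (hs' s' ⟨h3, h5⟩) (not_le.2 h4)
  have hinf : {s | Rec s}.Infinite := by
    obtain ⟨m, hm, hm'⟩ := exists_between hab
    apply inf_of_no_min
    · obtain ⟨s, hs, _⟩ := rec_ex m hm hm'
      exact ⟨s, hs⟩
    · intro x hx
      obtain ⟨m, hm, hm'⟩ := exists_between hx.1
      obtain ⟨s, hs, hs'⟩ := rec_ex m hm (hm'.trans hx.2.1)
      exact ⟨s, hs, hs'.trans_lt hm'⟩
  obtain ⟨p, q, hpq, hR⟩ := big_of_inf hRec hinf
  have hp := hR p le_rfl hpq.le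
  obtain ⟨c0, hc0⟩ := Eex p hp.1 hp.2.1
  obtain ⟨c, h1, h2⟩ := exists_between (lt_min hc0.1 hpq)
  have hEpc := Edn p c0 c hc0 h1 (h2.le.trans (min_le_left _ _))
  have hcq : c < q := h2.trans_le (min_le_right _ _)
  refine (inf_Ioo h1).mono (fun s hs => ?_) (hc c)
  obtain ⟨h3, h4⟩ := hs
  obtain ⟨_, _, cs, hcs, hcs'⟩ := hR s h3.le (h4.le.trans hcq.le)
  have h5 := hcs' p hp.1 h3
  have h6 : c < cs := by
    by_contra hcon
    exact h5 (Edn p c cs hEpc (h3.trans hcs.1) (not_lt.1 hcon))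
  exact ⟨hp.1.trans h3, Edn s cs c hcs h4 h6.le⟩

/-- the order dual -/
@[reducible] def OM.dual (M : Type u) [OM M] : OM Mᵒᵈ where
  dense := inferInstance
  nomin := inferInstance
  nomax := inferInstance
  nonemp := inferInstance
  Def := fun {ι} A => OM.Def (M := M) (ι := ι) A
  def_univ := OM.def_univ (M := M)
  def_inter := OM.def_inter (M := M)
  def_compl := OM.def_compl (M := M)
  def_pre := OM.def_pre (M := M)
  def_img := OM.def_img (M := M)
  def_lt := OM.def_pre (M := M) (![1, 0] : Fin 2 → Fin 2) OM.def_lt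
  def_sing := OM.def_sing (M := M)
  omin := fun s hs => by
    obtain ⟨F, h1, h2⟩ := OM.omin (M := M) s hs
    refine ⟨F, h1, fun t ht => ?_⟩
    rcases h2 t ht with h | ⟨a, b, h⟩ | ⟨a, h⟩ | ⟨a, h⟩ | h
    · exact Or.inl h
    · refine Or.inr (Or.inl ⟨OrderDual.toDual b, OrderDual.toDual a, ?_⟩)
      rw [h]; ext x; exact and_comm
    · exact Or.inr (Or.inr (Or.inr (Or.inl ⟨a, h⟩)))
    · exact Or.inr (Or.inr (Or.inl ⟨a, h⟩))
    · exact Or.inr (Or.inr (Or.inr (Or.inr h)))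

/-- left germ -/
abbrev LG (s : M) (P : M → Prop) : Prop := ∃ c, c < s ∧ ∀ t, c ≤ t → t < s → P t

theorem keyL {φ : M → M → Prop} (hφ : Dfn fun p : M × M => φ p.1 p.2) {a b : M} (hab : a < b)
    (h : ∀ s, a < s → s < b → LG s (φ s)) :
    ∃ p q, a < p ∧ p < q ∧ q < b ∧ ∀ s t, p ≤ t → t < s → s ≤ q → φ s t := by
  obtain ⟨p, q, h1, h2, h3, h4⟩ := @keyR Mᵒᵈ (OM.dual M) φ hφ b a hab
    (fun s h1 h2 => by
      obtain ⟨c, hc, h'⟩ := h s h2 h1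
      exact ⟨c, hc, fun t ht ht' => h' t ht' ht⟩)
  exact ⟨q, p, h3, h2, h1, fun s t hs hst ht => h4 s t ht hst hs⟩

theorem lg_dec {P : M → Prop} (hP : Dfn P) (s : M) : LG s P ∨ LG s (fun t => ¬ P t) := by
  rcases @rg_dec Mᵒᵈ (OM.dual M) P hP s with ⟨c, hc, h⟩ | ⟨c, hc, h⟩
  · exact Or.inl ⟨c, hc, fun t h1 h2 => h t h2 h1⟩
  · exact Or.inr ⟨c, hc, fun t h1 h2 => h t h2 h1⟩

theorem chainU {B : M → M → Prop} (hB : Dfn fun p : M × M => B p.1 p.2)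
    (hch : ∀ x y, (∀ s, B x s → B y s) ∨ (∀ s, B y s → B x s)) {a b : M} (hab : a < b)
    (hcov : ∀ s, a < s → s < b → ∃ x, B x s) :
    ∃ x p q, a < p ∧ p < q ∧ q < b ∧ ∀ s, p ≤ s → s ≤ q → B x s := by
  by_contra hcon
  have hfin : ∀ x, {s | (a < s ∧ s < b) ∧ B x s}.Finite := by
    intro x
    by_contra hc
    obtain ⟨p, q, hpq, h1⟩ := big_of_inf dfn hc
    exact hcon ⟨x, p, q, (h1 p le_rfl hpq.le).1.1, hpq, (h1 q hpq.le le_rfl).1.2,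
      fun s h2 h3 => (h1 s h2 h3).2⟩
  let Rec : M → Prop := fun s => (a < s ∧ s < b) ∧ ∃ x, B x s ∧ ∀ s', a < s' → s' < s → ¬ B x s'
  have hRec : Dfn Rec := dfn
  have rec_ex : ∀ t, a < t → t < b → ∃ s, Rec s ∧ s ≤ t := by
    intro t h1 h2
    obtain ⟨x, hx⟩ := hcov t h1 h2
    obtain ⟨s, hs, hs'⟩ := exists_min_of_finite (hfin x) ⟨t, ⟨h1, h2⟩, hx⟩
    refine ⟨s, ⟨hs.1, x, hs.2, fun s' h3 h4 h5 => ?_⟩, hs' t ⟨⟨h1, h2⟩, hx⟩⟩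
    exact absurd (hs' s' ⟨⟨h3, h4.trans hs.1.2⟩, h5⟩) (not_le.2 h4)
  have hinf : {s | Rec s}.Infinite := by
    obtain ⟨m, hm, hm'⟩ := exists_between hab
    apply inf_of_no_min
    · obtain ⟨s, hs, _⟩ := rec_ex m hm hm'
      exact ⟨s, hs⟩
    · intro x hx
      obtain ⟨m, hm, hm'⟩ := exists_between hx.1.1
      obtain ⟨s, hs, hs'⟩ := rec_ex m hm (hm'.trans hx.1.2)
      exact ⟨s, hs, hs'.trans_lt hm'⟩
  obtain ⟨p, q, hpq, hR⟩ := big_of_inf hRec hinf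
  obtain ⟨hp, x0, h1, h2⟩ := hR p le_rfl hpq.le
  refine (inf_Ioo hpq).mono (fun t ht => ?_) (hfin x0)
  obtain ⟨ht', x, h3, h4⟩ := hR t ht.1.le ht.2.le
  refine ⟨ht', ?_⟩
  rcases hch x0 x with h | h
  · exact absurd (h p h1) (h4 p hp.1 ht.1)
  · exact h t h3

end

section
variable {M : Type u} [OM M]

theorem exists_lub {P : M → Prop} (hP : Dfn P) (hne : ∃ x, P x) (hb : ∃ b, ∀ x, P x → x ≤ b) :
    ∃ v, (∀ x, P x → x ≤ v) ∧ ∀ y, y < v → ∃ x, P x ∧ y < x := by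
  classical
  obtain ⟨F, h1, h2⟩ := omin' hP
  obtain ⟨b, hb⟩ := hb
  have key : ∀ G : Finset (Set M), G ⊆ F → (∀ t ∈ G, t = ∅) ∨ ∃ v, IsLUB (⋃₀ (G : Set (Set M))) v := by
    intro G
    induction G using Finset.induction_on with
    | empty => intro _; left; simp
    | insert t s ht ih =>
      intro hs
      have ih := ih ((Finset.subset_insert t s).trans hs)
      have htF : t ∈ F := hs (Finset.mem_insert_self t s)
      have hbt : ∀ x ∈ t, x ≤ b := fun x hx => hb x ((h1 x).2 ⟨t, htF, hx⟩)
      have hd : t = ∅ ∨ ∃ v, IsLUB t v := by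
        rcases h2 t htF with ⟨a, rfl⟩ | ⟨a, b, rfl⟩ | ⟨a, rfl⟩ | ⟨a, rfl⟩ | rfl
        · exact Or.inr ⟨a, isLUB_singleton⟩
        · by_cases h : a < b
          · exact Or.inr ⟨b, isLUB_Ioo h⟩
          · exact Or.inl (Set.Ioo_eq_empty h)
        · obtain ⟨c, hc⟩ := exists_gt (max a b)
          exact absurd (hbt c ((le_max_left _ _).trans_lt hc))
            (not_le.2 ((le_max_right _ _).trans_lt hc))
        · exact Or.inr ⟨a, isLUB_Iio⟩
        · obtain ⟨c, hc⟩ := exists_gt b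
          exact absurd (hbt c trivial) (not_le.2 hc)
      rw [Finset.coe_insert, Set.sUnion_insert]
      rcases hd with rfl | ⟨v, hv⟩
      · rcases ih with h | ⟨v, hv⟩
        · left; intro t ht; rcases Finset.mem_insert.1 ht with h' | h'
          exacts [h', h t h']
        · right; exact ⟨v, by simpa using hv⟩
      · right
        rcases ih with h | ⟨w, hw⟩
        · have : ⋃₀ (s : Set (Set M)) = ∅ := by
            rw [Set.sUnion_eq_empty]; exact fun t ht => h t (by simpa using ht)
          rw [this, Set.union_empty]; exact ⟨v, hv⟩
        · exact ⟨_, hv.union hw⟩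
  obtain ⟨x0, hx0⟩ := hne
  obtain ⟨t, ht, hxt⟩ := (h1 x0).1 hx0
  rcases key F (Finset.Subset.refl F) with h | ⟨v, hv⟩
  · rw [h t ht] at hxt; exact absurd hxt (Set.notMem_empty _)
  · have hmem : ∀ x, x ∈ ⋃₀ (F : Set (Set M)) ↔ P x := fun x => by rw [h1 x]; simp
    refine ⟨v, fun x hx => hv.1 ((hmem x).2 hx), fun y hy => ?_⟩
    obtain ⟨x, hx, hx'⟩ := (lt_isLUB_iff hv).1 hy
    exact ⟨x, (hmem x).1 hx, hx'⟩

theorem keyRel {r : M → M → Prop} (hr : r = (· < ·) ∨ r = (· > ·)) {φ : M → M → Prop}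
    (hφ : Dfn fun p : M × M => φ p.1 p.2) {a b : M} (hab : a < b)
    (h : ∀ s, a < s → s < b → ∃ c, r s c ∧ ∀ t, r s t → (r t c ∨ t = c) → φ s t) :
    ∃ p q, a < p ∧ p < q ∧ q < b ∧
      ∀ s t, p ≤ s → s ≤ q → p ≤ t → t ≤ q → r s t → φ s t := by
  rcases hr with rfl | rfl
  · obtain ⟨p, q, h1, h2, h3, h4⟩ := keyR hφ hab (fun s hs hs' => by
      obtain ⟨c, hc, h⟩ := h s hs hs'
      exact ⟨c, hc, fun t ht ht' => h t ht (lt_or_eq_of_le ht')⟩)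
    exact ⟨p, q, h1, h2, h3, fun s t a1 _ _ a4 a5 => h4 s t a1 a5 a4⟩
  · obtain ⟨p, q, h1, h2, h3, h4⟩ := keyL hφ hab (fun s hs hs' => by
      obtain ⟨c, hc, h⟩ := h s hs hs'
      exact ⟨c, hc, fun t ht ht' => h t ht' ((lt_or_eq_of_le ht).imp id Eq.symm)⟩)
    exact ⟨p, q, h1, h2, h3, fun s t _ a2 a3 _ a5 => h4 s t a3 a5 a2⟩

theorem box_mono {r : M → M → Prop} (hr : r = (· < ·) ∨ r = (· > ·))
    {G H : M → M → Prop} (hG : Dfn fun p : M × M => G p.1 p.2)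
    (hH : Dfn fun p : M × M => H p.1 p.2) (hup : ∀ s, Ups (H s))
    (hnm : ∀ s x, H s x → ∃ y, y < x ∧ H s y) (hne : ∀ s, ∃ x, H s x)
    {a b : M} (hab : a < b) (hst : ∀ s, a < s → s < b → Start (H s) (G s))
    (hmono : ∀ s t, a < s → s < b → a < t → t < b → r s t → ∃ x, H s x ∧ ¬ H t x) :
    ∃ p q c d, a < p ∧ p < q ∧ q < b ∧ c < d ∧
      ∀ s x, p ≤ s → s ≤ q → c ≤ x → x ≤ d → G s x := by
  have hsub : ∀ s t, a < s → s < b → a < t → t < b → r s t → ∀ x, H t x → H s x := by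
    intro s t h1 h2 h3 h4 h5 x hx
    obtain ⟨y, hy, hy'⟩ := hmono s t h1 h2 h3 h4 h5
    rcases le_total x y with h | h
    · exact absurd (hup t x y h hx) hy'
    · exact hup s y x h hy
  have htri : ∀ s t : M, r s t ∨ s = t ∨ r t s := by
    rcases hr with rfl | rfl
    · exact fun s t => lt_trichotomy s t
    · exact fun s t => (lt_trichotomy s t).elim (fun h => Or.inr (Or.inr h))
        fun h => h.elim (fun h => Or.inr (Or.inl h)) Or.inl
  have htrans : ∀ s t w : M, r s t → r t w → r s w := by
    rcases hr with rfl | rfl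
    · exact fun s t w h h' => h.trans h'
    · exact fun s t w h h' => lt_trans h' h
  let A : M → M → Prop := fun s v => ¬ H s v ∧ ∀ y, v < y → H s y
  have hA : Dfn fun p : M × M => A p.1 p.2 := dfn
  have Aex : ∀ s, a < s → s < b → ∃ v, A s v := by
    intro s h1 h2
    have hpr : ∃ x, ¬ H s x := by
      have : ∃ s', (a < s' ∧ s' < b) ∧ r s' s := by
        rcases hr with rfl | rfl
        · obtain ⟨s', h3, h4⟩ := exists_between h1
          exact ⟨s', ⟨h3, h4.trans h2⟩, h4⟩
        · obtain ⟨s', h3, h4⟩ := exists_between h2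
          exact ⟨s', ⟨h1.trans h3, h4⟩, h3⟩
      obtain ⟨s', h3, h4⟩ := this
      obtain ⟨x, _, hx⟩ := hmono s' s h3.1 h3.2 h1 h2 h4
      exact ⟨x, hx⟩
    obtain ⟨z, hz⟩ := hne s
    obtain ⟨v, h3, h4⟩ := exists_lub (P := fun x => ¬ H s x) dfn hpr ⟨z, fun x hx => by
      by_contra hc
      exact hx (hup s z x (not_le.1 hc).le hz)⟩
    refine ⟨v, fun hv => ?_, fun y hy => ?_⟩
    · obtain ⟨y, hy, hy'⟩ := hnm s v hv
      obtain ⟨x, hx, hx'⟩ := h4 y hy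
      exact hx (hup s y x hx'.le hy')
    · by_contra hc
      exact absurd (h3 y hc) (not_le.2 hy)
  have Alt : ∀ s t v w, a < s → s < b → a < t → t < b → r s t → A s v → A t w → v < w := by
    intro s t v w h1 h2 h3 h4 h5 h6 h7
    obtain ⟨x, hx, hx'⟩ := hmono s t h1 h2 h3 h4 h5
    have e1 : v < x := by
      by_contra hc
      exact h6.1 (hup s x v (not_lt.1 hc) hx)
    have e2 : x ≤ w := by
      by_contra hc
      exact hx' (h7.2 x (not_le.1 hc))
    exact e1.trans_le e2
  have Auniq : ∀ s v w, A s v → A s w → v = w := by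
    intro s v w h1 h2
    rcases lt_trichotomy v w with h | h | h
    · exact absurd (h1.2 w h) h2.1
    · exact h
    · exact absurd (h2.2 v h) h1.1
  have Ar : ∀ s t v w, a < s → s < b → a < t → t < b → A s v → A t w → v < w → r s t := by
    intro s t v w h1 h2 h3 h4 h5 h6 h7
    rcases htri s t with h | rfl | h
    · exact h
    · exact absurd (Auniq s v w h5 h6) h7.ne
    · exact absurd (Alt t s w v h3 h4 h1 h2 h h6 h5) (not_lt.2 h7.le)
  let V : M → Prop := fun v => ∃ s, (a < s ∧ s < b) ∧ A s v
  have hV : Dfn V := dfn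
  have hVinf : {v | V v}.Infinite := by
    choose! f hf using Aex
    refine Set.infinite_of_injOn_mapsTo (f := f) (s := {x : M | a < x ∧ x < b}) ?_ ?_ (inf_Ioo hab)
    · intro s hs t ht hst
      rcases htri s t with h | h | h
      · exact absurd hst (Alt s t _ _ hs.1 hs.2 ht.1 ht.2 h (hf s hs.1 hs.2) (hf t ht.1 ht.2)).ne
      · exact h
      · exact absurd hst (Alt t s _ _ ht.1 ht.2 hs.1 hs.2 h (hf t ht.1 ht.2) (hf s hs.1 hs.2)).ne'
    · intro s hs
      exact ⟨s, ⟨hs.1, hs.2⟩, hf s hs.1 hs.2⟩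
  obtain ⟨v, w, hvw, hVv⟩ := big_of_inf hV hVinf
  obtain ⟨sv, hsv, hsv'⟩ := hVv v le_rfl hvw.le
  obtain ⟨sw, hsw, hsw'⟩ := hVv w hvw.le le_rfl
  have hrs := Ar sv sw v w hsv.1 hsv.2 hsw.1 hsw.2 hsv' hsw' hvw
  obtain ⟨p, q, hpq, hp, hq, hbt⟩ : ∃ p q, p < q ∧ a < p ∧ q < b ∧ ∀ s, p < s → s < q →
      r sv s ∧ r s sw := by
    rcases hr with rfl | rfl
    · exact ⟨sv, sw, hrs, hsv.1, hsw.2, fun s h1 h2 => ⟨h1, h2⟩⟩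
    · exact ⟨sw, sv, hrs, hsw.1, hsv.2, fun s h1 h2 => ⟨h2, h1⟩⟩
  let φ : M → M → Prop := fun s t => ∀ y, H s y → ¬ H t y → G s y
  have hφ : Dfn fun p : M × M => φ p.1 p.2 := dfn
  obtain ⟨p', q', h1, h2, h3, h4⟩ := keyRel hr hφ hpq (by
    intro s hs hs'
    have has := hp.trans hs
    have hsb := hs'.trans hq
    obtain ⟨x, hx, hx'⟩ := hst s has hsb
    obtain ⟨as, has'⟩ := Aex s has hsb
    have e1 : as < x := by
      by_contra hc
      exact has'.1 (hup s x as (not_lt.1 hc) hx)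
    have e2 : as < w := Alt s sw as w has hsb hsw.1 hsw.2 (hbt s hs hs').2 has' hsw'
    have e2' : v < as := Alt sv s v as hsv.1 hsv.2 has hsb (hbt s hs hs').1 hsv' has'
    obtain ⟨x', e3, e4⟩ := exists_between (lt_min e1 e2)
    obtain ⟨s', hs1, hs2⟩ := hVv x' (e2'.trans e3).le (e4.le.trans (min_le_right _ _))
    have hrss' := Ar s s' as x' has hsb hs1.1 hs1.2 has' hs2 e3
    refine ⟨s', hrss', fun t ht ht' y hy hy' => hx' y hy ?_⟩
    have htb : a < t ∧ t < b := by
      rcases ht' with ht' | rfl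
      · rcases hr with rfl | rfl
        · exact ⟨has.trans ht, lt_trans ht' hs1.2⟩
        · exact ⟨lt_trans hs1.1 ht', lt_trans ht hsb⟩
      · exact hs1
    have hHt : H t x := by
      have : H s' x := hs2.2 x (e4.trans_le (min_le_left _ _))
      rcases ht' with ht' | rfl
      · exact hsub t s' htb.1 htb.2 hs1.1 hs1.2 ht' x this
      · exact this
    by_contra hc
    exact hy' (hup t x y (not_le.1 hc).le hHt))
  obtain ⟨m, hm1, hm2⟩ := exists_between h2
  have hap' : a < p' := hp.trans h1
  have hqb' : q' < b := h3.trans hq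
  obtain ⟨P, Q, t, hPQ, hP, hQ, ht1, ht2, hmt, hall⟩ : ∃ P Q t, P < Q ∧ p' ≤ P ∧ Q ≤ q' ∧
      p' ≤ t ∧ t ≤ q' ∧ r m t ∧ ∀ s, P ≤ s → s ≤ Q → (r s m ∨ s = m) := by
    rcases hr with rfl | rfl
    · exact ⟨p', m, q', hm1, le_rfl, hm2.le, h2.le, le_rfl, hm2, fun s _ h => lt_or_eq_of_le h⟩
    · exact ⟨m, q', p', hm2, hm1.le, le_rfl, le_rfl, h2.le, hm1, fun s h _ =>
        (lt_or_eq_of_le h).imp id Eq.symm⟩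
  have ham := hap'.trans hm1
  have hmb := hm2.trans hqb'
  have hat := hap'.trans_le ht1
  have htb := ht2.trans_lt hqb'
  obtain ⟨d, hd, hd'⟩ := hmono m t ham hmb hat htb hmt
  obtain ⟨c, hc, hc'⟩ := hnm m d hd
  refine ⟨P, Q, c, d, hap'.trans_le hP, hPQ, hQ.trans_lt hqb', hc, fun s x hs hs' hx hx' => ?_⟩
  have hps := hP.trans hs
  have hsq := hs'.trans hQ
  have hHm : H m x := hup m c x hx hc'
  have hrst : r s t := by
    rcases hall s hs hs' with h | rfl
    · exact htrans _ _ _ h hmt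
    · exact hmt
  refine h4 s t hps hsq ht1 ht2 hrst x ?_ (fun h => hd' (hup t x d hx' h))
  rcases hall s hs hs' with h | rfl
  · exact hsub s m (hap'.trans_le hps) (hsq.trans_lt hqb') ham hmb h x hHm
  · exact hHm

theorem box_const {G : M → M → Prop} {H : M → Prop} (hG : Dfn fun p : M × M => G p.1 p.2)
    (hH : Dfn H)
    (hnm : ∀ x, H x → ∃ y, y < x ∧ H y) (hup : Ups H)
    {a b : M} (hab : a < b) (hst : ∀ s, a < s → s < b → Start H (G s)) :
    ∃ p q c d, a < p ∧ p < q ∧ q < b ∧ c < d ∧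
      ∀ s x, p ≤ s → s ≤ q → c ≤ x → x ≤ d → G s x := by
  let B : M → M → Prop := fun x s => (a < s ∧ s < b) ∧ H x ∧ ∀ y, H y → y ≤ x → G s y
  have hB : Dfn fun p : M × M => B p.1 p.2 := dfn
  obtain ⟨x, p, q, h1, h2, h3, h4⟩ := chainU hB (fun x y => by
    have : ∀ x y, x ≤ y → (∀ s, B x s → B y s) ∨ (∀ s, B y s → B x s) := by
      intro x y hxy
      by_cases hx : H x
      · exact Or.inr fun s hs => ⟨hs.1, hx, fun z hz hz' => hs.2.2 z hz (hz'.trans hxy)⟩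
      · exact Or.inl fun s hs => absurd hs.2.1 hx
    rcases le_total x y with h | h
    · exact this x y h
    · exact (this y x h).symm) hab (fun s h1 h2 => by
      obtain ⟨x, hx, hx'⟩ := hst s h1 h2
      exact ⟨x, ⟨h1, h2⟩, hx, hx'⟩)
  have hx := (h4 p le_rfl h2.le).2.1
  obtain ⟨c, hc, hc'⟩ := hnm x hx
  exact ⟨p, q, c, x, h1, h2, h3, hc, fun s z hs hs' hz hz' =>
    (h4 s hs hs').2.2 z (hup c z hz hc') hz'⟩

theorem box1 {G : M → M → Prop} (hG : Dfn fun p : M × M => G p.1 p.2) {a b : M} (hab : a < b)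
    (h : ∀ s, a < s → s < b → {x | G s x}.Infinite) :
    ∃ p q c d, a < p ∧ p < q ∧ q < b ∧ c < d ∧
      ∀ s x, p ≤ s → s ≤ q → c ≤ x → x ≤ d → G s x := by
  -- extend `G` outside of `(a,b)` so that the fibers are always infinite
  let G' : M → M → Prop := fun s x => (a < s ∧ s < b) → G s x
  have hG' : Dfn fun p : M × M => G' p.1 p.2 := dfn
  let H : M → M → Prop := fun s x => ∃ c d, c < d ∧ d ≤ x ∧ ∀ y, c < y → y < d → G' s y
  have hH : Dfn fun p : M × M => H p.1 p.2 := dfn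
  have hup : ∀ s, Ups (H s) := fun s x y hxy ⟨c, d, h1, h2, h3⟩ => ⟨c, d, h1, h2.trans hxy, h3⟩
  have hnm' : ∀ s x, H s x → ∃ y, y < x ∧ H s y ∧ G' s y := by
    rintro s x ⟨c, d, h1, h2, h3⟩
    obtain ⟨y, h4, h5⟩ := exists_between h1
    exact ⟨y, h5.trans_le h2, ⟨c, y, h4, le_rfl, fun z hz hz' => h3 z hz (hz'.trans h5)⟩, h3 y h4 h5⟩
  have hnm : ∀ s x, H s x → ∃ y, y < x ∧ H s y := fun s x hx => by
    obtain ⟨y, h1, h2, _⟩ := hnm' s x hx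
    exact ⟨y, h1, h2⟩
  have hne : ∀ s, ∃ x, H s x := by
    intro s
    by_cases hs : a < s ∧ s < b
    · obtain ⟨p, q, hpq, h1⟩ := big_of_inf dfn (h s hs.1 hs.2)
      exact ⟨q, p, q, hpq, le_rfl, fun y hy hy' _ => h1 y hy.le hy'.le⟩
    · exact ⟨b, a, b, hab, le_rfl, fun y _ _ h => absurd h hs⟩
  have hstart : ∀ s, Start (H s) (G' s) := by
    intro s
    rcases start_dec (hup s) (hne s) (P := G' s) dfn with h | ⟨c, hc, hc'⟩
    · exact h
    · obtain ⟨y, h1, h2, h3⟩ := hnm' s c hc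
      exact absurd h3 (hc' y h2 h1.le)
  have fin : ∀ a' b', a ≤ a' → b' ≤ b → (∃ p q c d, a' < p ∧ p < q ∧ q < b' ∧ c < d ∧
      ∀ s x, p ≤ s → s ≤ q → c ≤ x → x ≤ d → G' s x) →
      ∃ p q c d, a < p ∧ p < q ∧ q < b ∧ c < d ∧
      ∀ s x, p ≤ s → s ≤ q → c ≤ x → x ≤ d → G s x := by
    rintro a' b' ha hb ⟨p, q, c, d, h1, h2, h3, h4, h5⟩
    exact ⟨p, q, c, d, ha.trans_lt h1, h2, h3.trans_le hb, h4, fun s x e1 e2 e3 e4 =>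
      h5 s x e1 e2 e3 e4 ⟨ha.trans_lt (h1.trans_le e1), e2.trans_lt (h3.trans_le hb)⟩⟩
  -- trichotomy
  let E1 : M → M → Prop := fun s t => ∃ x, H s x ∧ ¬ H t x
  let E2 : M → M → Prop := fun s t => ∃ x, H t x ∧ ¬ H s x
  let E3 : M → M → Prop := fun s t => ∀ x, H s x ↔ H t x
  have hE1 : Dfn fun p : M × M => E1 p.1 p.2 := dfn
  have hE2 : Dfn fun p : M × M => E2 p.1 p.2 := dfn
  have hE3 : Dfn fun p : M × M => E3 p.1 p.2 := dfn
  have tri : ∀ s, RG s (E1 s) ∨ RG s (E2 s) ∨ RG s (E3 s) := by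
    intro s
    rcases rg_dec (P := E1 s) dfn s with h | h1
    · exact Or.inl h
    rcases rg_dec (P := E2 s) dfn s with h | h2
    · exact Or.inr (Or.inl h)
    refine Or.inr (Or.inr ?_)
    exact (Start.and (H := fun x => s < x) h1 h2).mono fun t _ ht x => by
      by_contra hc
      rw [not_iff, iff_iff_and_or_not_and_not] at hc
      rcases hc with ⟨h1, h2⟩ | ⟨h1, h2⟩
      · exact ht.2 ⟨x, h2, h1⟩
      · exact ht.1 ⟨x, not_not.1 h1, h2⟩
  have hcov : {s | a < s ∧ s < b} ⊆ {s | (a < s ∧ s < b) ∧ RG s (E1 s)} ∪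
      ({s | (a < s ∧ s < b) ∧ RG s (E2 s)} ∪ {s | (a < s ∧ s < b) ∧ RG s (E3 s)}) := by
    intro s hs
    rcases tri s with h | h | h
    · exact Or.inl ⟨hs, h⟩
    · exact Or.inr (Or.inl ⟨hs, h⟩)
    · exact Or.inr (Or.inr ⟨hs, h⟩)
  have hinf := (inf_Ioo hab).mono hcov
  rw [Set.infinite_union, Set.infinite_union] at hinf
  have next : ∀ E : M → M → Prop, (Dfn fun p : M × M => E p.1 p.2) →
      {s | (a < s ∧ s < b) ∧ RG s (E s)}.Infinite →
      ∃ p q, a < p ∧ p < q ∧ q < b ∧ ∀ s t, p ≤ s → s < t → t ≤ q → E s t := by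
    intro E hE hi
    obtain ⟨p, q, hpq, h1⟩ := big_of_inf dfn hi
    obtain ⟨p', q', h2, h3, h4, h5⟩ := keyR hE hpq fun s hs hs' => (h1 s hs.le hs'.le).2
    exact ⟨p', q', (h1 p le_rfl hpq.le).1.1.trans h2, h3, h4.trans (h1 q hpq.le le_rfl).1.2, h5⟩
  rcases hinf with hi | hi | hi
  · obtain ⟨p, q, h1, h2, h3, h4⟩ := next E1 hE1 hi
    exact fin p q h1.le h3.le (box_mono (Or.inl rfl) hG' hH hup hnm hne h2 (fun s _ _ => hstart s)
      fun s t e1 e2 e3 e4 e5 => h4 s t e1.le e5 e4.le)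
  · obtain ⟨p, q, h1, h2, h3, h4⟩ := next E2 hE2 hi
    exact fin p q h1.le h3.le (box_mono (Or.inr rfl) hG' hH hup hnm hne h2 (fun s _ _ => hstart s)
      fun s t e1 e2 e3 e4 e5 => h4 t s e3.le e5 e2.le)
  · obtain ⟨p, q, h1, h2, h3, h4⟩ := next E3 hE3 hi
    refine fin p q h1.le h3.le (box_const hG' (H := H q) dfn (hnm q) (hup q) h2 (fun s e1 e2 => ?_))
    have : H s = H q := funext fun x => propext (h4 s q e1.le e2 le_rfl x)
    rw [← this]; exact hstart s

end

section
variable {M : Type u} [OM M]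

/-- eventually near `s` -/
abbrev Ev (s : M) (Q : M → Prop) : Prop := ∃ a b, a < s ∧ s < b ∧ ∀ t, a < t → t < b → Q t

theorem Ev.and {s : M} {P Q : M → Prop} (h1 : Ev s P) (h2 : Ev s Q) :
    Ev s (fun t => P t ∧ Q t) := by
  obtain ⟨a, b, h3, h4, h5⟩ := h1
  obtain ⟨c, d, h6, h7, h8⟩ := h2
  exact ⟨max a c, min b d, max_lt h3 h6, lt_min h4 h7, fun t ht ht' =>
    ⟨h5 t ((le_max_left _ _).trans_lt ht) (ht'.trans_le (min_le_left _ _)),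
     h8 t ((le_max_right _ _).trans_lt ht) (ht'.trans_le (min_le_right _ _))⟩⟩

theorem Ev.mono {s : M} {P Q : M → Prop} (h1 : Ev s P) (h : ∀ t, P t → Q t) : Ev s Q := by
  obtain ⟨a, b, h3, h4, h5⟩ := h1
  exact ⟨a, b, h3, h4, fun t ht ht' => h t (h5 t ht ht')⟩

theorem Ev.self {s : M} {P : M → Prop} (h1 : Ev s P) : P s := by
  obtain ⟨a, b, h3, h4, h5⟩ := h1
  exact h5 s h3 h4

theorem Ev.of {P : M → Prop} (h : ∀ t, P t) (s : M) : Ev s P := by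
  obtain ⟨a, ha⟩ := exists_lt s
  obtain ⟨b, hb⟩ := exists_gt s
  exact ⟨a, b, ha, hb, fun t _ _ => h t⟩

theorem sandwich {K : M → M → Prop} (hK : Dfn fun p : M × M => K p.1 p.2)
    {R : M → M → M × M → Prop} (hR : Dfn fun p : M × M × M × M => R p.1 p.2.1 p.2.2)
    {a b : M} (hab : a < b)
    (h : ∀ s, a < s → s < b → ∃ c, K s c ∧ ∃ v w, v < c ∧ c < w ∧ R s c (v, w))
    (hmon : ∀ s c v w v' w', R s c (v, w) → v ≤ v' → v' < c → c < w' → w' ≤ w → R s c (v', w')) :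
    ∃ p q v w, a < p ∧ p < q ∧ q < b ∧
      ∀ s, p ≤ s → s ≤ q → ∃ c, K s c ∧ v < c ∧ c < w ∧ R s c (v, w) := by
  obtain ⟨p, q, w, d, h1, h2, h3, h4, h5⟩ := box1
    (G := fun s x => ∃ c, K s c ∧ c < x ∧ ∃ v, v < c ∧ R s c (v, x)) dfn hab (fun s h1 h2 => by
      obtain ⟨c, hc, v, w, hv, hw, hr⟩ := h s h1 h2
      exact (inf_Ioo hw).mono fun x hx => ⟨c, hc, hx.1, v, hv, hmon s c v w v x hr le_rfl hv hx.1 hx.2.le⟩)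
  obtain ⟨p', q', v, d', h1', h2', h3', hdv, h5'⟩ := box1
    (G := fun s x => ∃ c, K s c ∧ x < c ∧ c < w ∧ R s c (x, w)) dfn h2 (fun s e1 e2 => by
      obtain ⟨c, hc, hcw, v, hv, hr⟩ := h5 s w e1.le e2.le le_rfl h4.le
      exact (inf_Ioo hv).mono fun x hx => ⟨c, hc, hx.2, hcw, hmon s c v w x w hr hx.1.le hx.2 hcw le_rfl⟩)
  refine ⟨p', q', v, w, h1.trans h1', h2', h3'.trans h3, fun s e1 e2 => ?_⟩
  exact h5' s v e1 e2 le_rfl hdv.le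

/-- a point avoiding a finite set nearby -/
theorem finite_gap {P : M → Prop} (hf : {x | P x}.Finite) (c : M) :
    ∃ v w, v < c ∧ c < w ∧ ∀ x, v ≤ x → x ≤ w → P x → x = c := by
  have h1 : ∃ v, v < c ∧ ∀ x, v ≤ x → x < c → ¬ P x := by
    by_cases hne : ∃ x, P x ∧ x < c
    · obtain ⟨m, hm, hm'⟩ := Set.exists_max_image {x | P x ∧ x < c} (fun x => x)
        (hf.subset fun x hx => hx.1) hne
      obtain ⟨v, hv, hv'⟩ := exists_between hm.2
      exact ⟨v, hv', fun x hx hx' hP => absurd (hm' x ⟨hP, hx'⟩) (not_le.2 (hv.trans_le hx))⟩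
    · push Not at hne
      obtain ⟨v, hv⟩ := exists_lt c
      exact ⟨v, hv, fun x _ hx hP => absurd (hne x hP) (not_le.2 hx)⟩
  have h2 : ∃ v, c < v ∧ ∀ x, c < x → x ≤ v → ¬ P x := by
    by_cases hne : ∃ x, P x ∧ c < x
    · obtain ⟨m, hm, hm'⟩ := Set.exists_min_image {x | P x ∧ c < x} (fun x => x)
        (hf.subset fun x hx => hx.1) hne
      obtain ⟨v, hv, hv'⟩ := exists_between hm.2
      exact ⟨v, hv, fun x hx hx' hP => absurd (hm' x ⟨hP, hx⟩) (not_le.2 (hx'.trans_lt hv'))⟩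
    · push Not at hne
      obtain ⟨v, hv⟩ := exists_gt c
      exact ⟨v, hv, fun x hx _ hP => absurd (hne x hP) (not_le.2 hx)⟩
  obtain ⟨v, hv, h3⟩ := h1
  obtain ⟨w, hw, h4⟩ := h2
  refine ⟨v, w, hv, hw, fun x e1 e2 hP => ?_⟩
  rcases lt_trichotomy x c with h | h | h
  · exact absurd hP (h3 x e1 h)
  · exact h
  · exact absurd hP (h4 x h e2)

/-- no points of `Y t` in `[v,w]` -/
abbrev Emp (Y : M → M → Prop) (v w t : M) : Prop := ∀ x, v ≤ x → x ≤ w → ¬ Y t x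

/-- four kinds of bad points -/
abbrev Bad1 (Y : M → M → Prop) (s : M) : Prop :=
  ∃ l, ¬ Y s l ∧ ∀ v w, v < l → l < w → ¬ Ev s (Emp Y v w)
abbrev Bad2 (Y : M → M → Prop) (s : M) : Prop :=
  ∀ v, ¬ Ev s (fun t => ∀ x, v ≤ x → ¬ Y t x)
abbrev Bad2' (Y : M → M → Prop) (s : M) : Prop :=
  ∀ v, ¬ Ev s (fun t => ∀ x, x ≤ v → ¬ Y t x)
abbrev Bad3 (Y : M → M → Prop) (s : M) : Prop :=
  ∃ c, Y s c ∧ ∃ v w, v < c ∧ c < w ∧ ¬ Ev s (fun t => ¬ Emp Y v w t)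
abbrev Bad4 (Y : M → M → Prop) (s : M) : Prop :=
  ∃ c, Y s c ∧ ∀ v w, v < c → c < w →
    ¬ Ev s (fun t => ∀ x y, v ≤ x → x ≤ w → v ≤ y → y ≤ w → Y t x → Y t y → x = y)
abbrev BadP (Y : M → M → Prop) (s : M) : Prop :=
  Bad1 Y s ∨ Bad2 Y s ∨ Bad2' Y s ∨ Bad3 Y s ∨ Bad4 Y s

theorem not_big_ev {p q : M} (hpq : p < q) {P : M → Prop}
    (h : ∀ t, p ≤ t → t ≤ q → P t) : ∃ s, p < s ∧ s < q ∧ Ev s P := by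
  obtain ⟨s, h1, h2⟩ := exists_between hpq
  exact ⟨s, h1, h2, p, q, h1, h2, fun t e1 e2 => h t e1.le e2.le⟩

theorem bad_finite {Y : M → M → Prop} (hY : Dfn fun p : M × M => Y p.1 p.2)
    (hf : ∀ s, {x | Y s x}.Finite) : {s | BadP Y s}.Finite := by
  have f1 : {s | Bad1 Y s}.Finite := by
    by_contra hc
    obtain ⟨a, b, hab, h⟩ := big_of_inf dfn hc
    obtain ⟨p, q, v, w, h1, h2, h3, h4⟩ := sandwich
      (K := fun s l => ¬ Y s l ∧ ∀ v w, v < l → l < w → ¬ Ev s (Emp Y v w)) dfn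
      (R := fun s l vw => Emp Y vw.1 vw.2 s) dfn hab (fun s e1 e2 => by
        obtain ⟨l, hl, hl'⟩ := h s e1.le e2.le
        obtain ⟨v, w, hv, hw, h3⟩ := finite_gap (hf s) l
        refine ⟨l, ⟨hl, hl'⟩, v, w, hv, hw, fun x hx hx' hP => ?_⟩
        have := h3 x hx hx' hP
        exact hl (this ▸ hP))
      (fun s c v w v' w' hr e1 e2 e3 e4 x hx hx' => hr x (e1.trans hx) (hx'.trans e4))
    obtain ⟨s, e1, e2, e3⟩ := not_big_ev h2 (P := Emp Y v w) fun s e1 e2 => by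
      obtain ⟨c, _, _, _, h⟩ := h4 s e1 e2
      exact h
    obtain ⟨c, hc, hv, hw, _⟩ := h4 s e1.le e2.le
    exact hc.2 v w hv hw e3
  have f2 : {s | Bad2 Y s}.Finite := by
    by_contra hc
    obtain ⟨a, b, hab, h⟩ := big_of_inf dfn hc
    obtain ⟨p, q, v, d, h1, h2, h3, h4, h5⟩ := box1 (G := fun s x => ∀ y, x ≤ y → ¬ Y s y) dfn hab
      (fun s _ _ => by
        obtain ⟨z, hz⟩ := (hf s).bddAbove
        obtain ⟨w, hw⟩ := exists_gt z
        obtain ⟨w', hw'⟩ := exists_gt w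
        exact (inf_Icc hw').mono fun x hx y hy hY =>
          absurd (hz hY) (not_le.2 (hw.trans_le (hx.1.trans hy))))
    obtain ⟨s, e1, e2, e3⟩ := not_big_ev h2 fun s e1 e2 => h5 s v e1 e2 le_rfl h4.le
    exact h s (h1.trans e1).le (e2.trans h3).le v e3
  have f2' : {s | Bad2' Y s}.Finite := by
    by_contra hc
    obtain ⟨a, b, hab, h⟩ := big_of_inf dfn hc
    obtain ⟨p, q, v, d, h1, h2, h3, h4, h5⟩ := box1 (G := fun s x => ∀ y, y ≤ x → ¬ Y s y) dfn hab
      (fun s _ _ => by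
        obtain ⟨z, hz⟩ := (hf s).bddBelow
        obtain ⟨w, hw⟩ := exists_lt z
        obtain ⟨w', hw'⟩ := exists_lt w
        exact (inf_Icc hw').mono fun x hx y hy hY =>
          absurd (hz hY) (not_le.2 ((hy.trans hx.2).trans_lt hw)))
    obtain ⟨s, e1, e2, e3⟩ := not_big_ev h2 fun s e1 e2 => h5 s v e1 e2 le_rfl h4.le
    exact h s (h1.trans e1).le (e2.trans h3).le v e3
  have f3 : {s | Bad3 Y s}.Finite := by
    by_contra hc
    obtain ⟨a, b, hab, h⟩ := big_of_inf dfn hc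
    obtain ⟨p, q, v, w, h1, h2, h3, h4⟩ := sandwich
      (K := fun s c => Y s c) dfn
      (R := fun s c vw => ¬ Ev s (fun t => ¬ Emp Y vw.1 vw.2 t)) dfn hab (fun s e1 e2 => by
        obtain ⟨l, hl, hl'⟩ := h s e1.le e2.le
        exact ⟨l, hl, hl'⟩)
      (fun s c v w v' w' hr e1 e2 e3 e4 he => hr (he.mono fun t ht ht' =>
        ht fun x hx hx' => ht' x (e1.trans hx) (hx'.trans e4)))
    obtain ⟨s, e1, e2, e3⟩ := not_big_ev h2 (P := fun t => ¬ Emp Y v w t) fun s e1 e2 he => by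
      obtain ⟨c, h, h', h'', _⟩ := h4 s e1 e2
      exact he c h'.le h''.le h
    obtain ⟨c, hc, hv, hw, h⟩ := h4 s e1.le e2.le
    exact h e3
  have f4 : {s | Bad4 Y s}.Finite := by
    by_contra hc
    obtain ⟨a, b, hab, h⟩ := big_of_inf dfn hc
    obtain ⟨p, q, v, w, h1, h2, h3, h4⟩ := sandwich
      (K := fun s c => ∀ v w, v < c → c < w →
        ¬ Ev s (fun t => ∀ x y, v ≤ x → x ≤ w → v ≤ y → y ≤ w → Y t x → Y t y → x = y)) dfn
      (R := fun s c vw => ∀ x, vw.1 ≤ x → x ≤ vw.2 → Y s x → x = c) dfn hab (fun s e1 e2 => by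
        obtain ⟨l, hl, hl'⟩ := h s e1.le e2.le
        exact ⟨l, hl', finite_gap (hf s) l⟩)
      (fun s c v w v' w' hr e1 e2 e3 e4 x hx hx' => hr x (e1.trans hx) (hx'.trans e4))
    obtain ⟨s, e1, e2, e3⟩ := not_big_ev h2
      (P := fun t => ∀ x y, v ≤ x → x ≤ w → v ≤ y → y ≤ w → Y t x → Y t y → x = y)
      fun s e1 e2 x y g1 g2 g3 g4 g5 g6 => by
      obtain ⟨c, h, h', h'', hh⟩ := h4 s e1 e2
      rw [hh x g1 g2 g5, hh y g3 g4 g6]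
    obtain ⟨c, hc, hv, hw, h⟩ := h4 s e1.le e2.le
    exact hc v w hv hw e3
  refine (f1.union (f2.union (f2'.union (f3.union f4)))).subset fun s hs => ?_
  exact hs

theorem gap_ev {Y : M → M → Prop} (hY : Dfn fun p : M × M => Y p.1 p.2) {s : M}
    (hs : ¬ BadP Y s) {v w : M} (hvw : v ≤ w) (h : Emp Y v w s) : Ev s (Emp Y v w) := by
  have nb : ∀ l, ¬ Y s l → ∃ v w, v < l ∧ l < w ∧ Ev s (Emp Y v w) := by
    intro l hl
    by_contra hc
    exact hs (Or.inl ⟨l, hl, fun v w hv hw he => hc ⟨v, w, hv, hw, he⟩⟩)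
  by_contra hcon
  obtain ⟨l, h1, h2⟩ := exists_lub (P := fun x => x ≤ w ∧ ∃ y, v ≤ y ∧ x ≤ y ∧ Ev s (Emp Y v y)) dfn
    (by
      obtain ⟨v', w', e1, e2, e3⟩ := nb v (h v le_rfl hvw)
      exact ⟨v, hvw, v, le_rfl, le_rfl, e3.mono fun t ht x hx hx' =>
        ht x (e1.le.trans hx) (hx'.trans e2.le)⟩) ⟨w, fun x hx => hx.1⟩
  have hlw : l ≤ w := by
    by_contra hc
    obtain ⟨x, hx, hx'⟩ := h2 w (not_le.1 hc)
    exact absurd hx.1 (not_le.2 hx')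
  have hvl : v ≤ l := by
    obtain ⟨v', w', e1, e2, e3⟩ := nb v (h v le_rfl hvw)
    exact h1 v ⟨hvw, v, le_rfl, le_rfl, e3.mono fun t ht x hx hx' =>
        ht x (e1.le.trans hx) (hx'.trans e2.le)⟩
  obtain ⟨v', w', e1, e2, e3⟩ := nb l (h l hvl hlw)
  obtain ⟨x, hx, hx'⟩ := h2 v' e1
  obtain ⟨_, y, hvy, hxy, hy⟩ := hx
  have key : Ev s (Emp Y v w') := (e3.and hy).mono fun t ht z hz hz' => by
    rcases le_total z y with h | h
    · exact ht.2 z hz h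
    · exact ht.1 z (hx'.le.trans (hxy.trans h)) hz'
  rcases le_total w w' with hww | hww
  · exact hcon (key.mono fun t ht z hz hz' => ht z hz (hz'.trans hww))
  · exact absurd (h1 w' ⟨hww, w', hvl.trans e2.le, le_rfl, key⟩) (not_le.2 e2)

theorem card_ev_lt {Y : M → M → Prop} (hY : Dfn fun p : M × M => Y p.1 p.2)
    (hf : ∀ s, {x | Y s x}.Finite) {s : M} (hs : ¬ BadP Y s) :
    ∀ k : ℕ, ∀ w, ¬ Y s w → {x | Y s x ∧ x < w}.ncard = k →
      Ev s (fun t => {x | Y t x ∧ x < w}.ncard = k) := by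
  intro k
  have hfl : ∀ t w, {x | Y t x ∧ x < w}.Finite := fun t w => (hf t).subset fun x hx => hx.1
  induction k with
  | zero =>
    intro w hw hk
    rw [Set.ncard_eq_zero (hfl s w)] at hk
    have hk' : ∀ x, x < w → ¬ Y s x := fun x hx hx' => by
      have : x ∈ {x | Y s x ∧ x < w} := ⟨hx', hx⟩
      rw [hk] at this; exact this
    have h2 : ∃ v, Ev s (fun t => ∀ x, x ≤ v → ¬ Y t x) := by
      by_contra hc
      exact hs (Or.inr (Or.inr (Or.inl fun v hv => hc ⟨v, hv⟩)))
    obtain ⟨v, hv⟩ := h2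
    have h3 : Ev s (fun t => ∀ x, x < w → ¬ Y t x) := by
      rcases le_total w v with h | h
      · exact hv.mono fun t ht x hx => ht x (hx.le.trans h)
      · have := gap_ev hY hs h (fun x _ hx => by
          rcases lt_or_eq_of_le hx with h | rfl
          exacts [hk' x h, hw])
        refine (hv.and this).mono fun t ht x hx => ?_
        rcases le_total x v with h | h
        · exact ht.1 x h
        · exact ht.2 x h hx.le
    refine h3.mono fun t ht => ?_
    rw [Set.ncard_eq_zero (hfl t w)]
    ext x
    simp only [Set.mem_ofPred_eq, Set.mem_empty_iff_false, iff_false]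
    exact fun hx => ht x hx.2 hx.1
  | succ k ih =>
    intro w hw hk
    have hne : {x | Y s x ∧ x < w}.Nonempty := by
      rw [← Set.ncard_pos (hfl s w)]; omega
    obtain ⟨c, hc, hmax⟩ := Set.exists_max_image {x | Y s x ∧ x < w} (fun x => x) (hfl s w) hne
    obtain ⟨v1, w1, hv1, hw1, h1⟩ : ∃ v w, v < c ∧ c < w ∧
        Ev s (fun t => ∀ x y, v ≤ x → x ≤ w → v ≤ y → y ≤ w → Y t x → Y t y → x = y) := by
      by_contra hcon
      exact hs (Or.inr (Or.inr (Or.inr (Or.inr ⟨c, hc.1, fun v w hv hw h => hcon ⟨v, w, hv, hw, h⟩⟩))))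
    have hEv := h1
    have h2 := hEv.self
    -- shrink
    have hvY : ¬ Y s v1 := fun h => hv1.ne (h2 v1 c le_rfl (hv1.le.trans hw1.le) hv1.le hw1.le h hc.1)
    obtain ⟨w2, hw2, hw2'⟩ := exists_between (lt_min hw1 hc.2)
    have e1 := hw2'.trans_le (min_le_left _ _)
    have e2 := hw2'.trans_le (min_le_right _ _)
    have hsplit : {x | Y s x ∧ x < w} = insert c {x | Y s x ∧ x < v1} := by
      ext x
      simp only [Set.mem_ofPred_eq, Set.mem_insert_iff]
      constructor
      · intro hx
        rcases lt_or_ge x v1 with h | h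
        · exact Or.inr ⟨hx.1, h⟩
        · exact Or.inl (h2 x c h ((hmax x hx).trans hw1.le) hv1.le hw1.le hx.1 hc.1)
      · rintro (rfl | hx)
        · exact hc
        · exact ⟨hx.1, hx.2.trans (hv1.trans hc.2)⟩
    have hk1 : {x | Y s x ∧ x < v1}.ncard = k := by
      rw [hsplit, Set.ncard_insert_of_notMem (fun h => absurd h.2 (not_lt.2 hv1.le)) (hfl s v1)] at hk
      omega
    have g1 := ih v1 hvY hk1
    have g2 : Ev s (Emp Y w2 w) := gap_ev hY hs e2.le fun x hx hx' hYx => by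
      rcases lt_or_eq_of_le hx' with h | rfl
      · exact absurd (hmax x ⟨hYx, h⟩) (not_le.2 (hw2.trans_le hx))
      · exact hw hYx
    have g3 : Ev s (fun t => ¬ Emp Y v1 w2 t) := by
      by_contra hcon
      exact hs (Or.inr (Or.inr (Or.inr (Or.inl ⟨c, hc.1, v1, w2, hv1, hw2, hcon⟩))))
    refine ((g1.and g2).and (g3.and hEv)).mono fun t ⟨⟨q1, q2⟩, q3, q4⟩ => ?_
    obtain ⟨y, hy1, hy2, hy3⟩ : ∃ y, v1 ≤ y ∧ y ≤ w2 ∧ Y t y := by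
      by_contra hcon
      exact q3 fun x hx hx' hY => hcon ⟨x, hx, hx', hY⟩
    have : {x | Y t x ∧ x < w} = insert y {x | Y t x ∧ x < v1} := by
      ext x
      simp only [Set.mem_ofPred_eq, Set.mem_insert_iff]
      constructor
      · intro hx
        rcases lt_or_ge x v1 with h | h
        · exact Or.inr ⟨hx.1, h⟩
        · rcases lt_or_ge x w2 with h' | h'
          · exact Or.inl (q4 x y h (h'.le.trans e1.le) hy1 (hy2.trans e1.le) hx.1 hy3)
          · exact absurd hx.1 (q2 x h' hx.2.le)
      · rintro (rfl | hx)
        · exact ⟨hy3, hy2.trans_lt e2⟩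
        · exact ⟨hx.1, hx.2.trans (hv1.trans hc.2)⟩
    rw [this, Set.ncard_insert_of_notMem (fun h => absurd h.2 (not_lt.2 hy1)) (hfl t v1), q1]

theorem card_ev {Y : M → M → Prop} (hY : Dfn fun p : M × M => Y p.1 p.2)
    (hf : ∀ s, {x | Y s x}.Finite) {s : M} (hs : ¬ BadP Y s) :
    Ev s (fun t => {x | Y t x}.ncard = {x | Y s x}.ncard) := by
  have h2 : ∃ v, Ev s (fun t => ∀ x, v ≤ x → ¬ Y t x) := by
    by_contra hc
    exact hs (Or.inr (Or.inl fun v hv => hc ⟨v, hv⟩))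
  obtain ⟨v, hv⟩ := h2
  have hv' := hv.self
  have hk := card_ev_lt hY hf hs _ v (hv' v le_rfl) rfl
  have key : ∀ t, (∀ x, v ≤ x → ¬ Y t x) → {x | Y t x ∧ x < v} = {x | Y t x} := fun t ht => by
    ext x
    exact ⟨fun h => h.1, fun h => ⟨h, not_le.1 fun h' => ht x h' h⟩⟩
  refine (hv.and hk).mono fun t ht => ?_
  have := ht.2
  rwa [key t ht.1, key s hv'] at this

end

section
variable {M : Type u} [OM M] {T S R : Type u} [Enc M T] [Enc M S] [Enc M R]

abbrev AtL (P : M → Prop) (j : ℕ) : Prop :=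
  ∃ f : Fin j → M, (∀ i i' : Fin j, f i = f i' → i = i') ∧ ∀ i, P (f i)

theorem atL_iff {P : M → Prop} (h : {x | P x}.Finite) (j : ℕ) : AtL P j ↔ j ≤ {x | P x}.ncard := by
  constructor
  · rintro ⟨f, hf, hP⟩
    have : (Set.range f).ncard = j := by
      rw [Set.ncard_eq_toFinset_card', Set.toFinset_range, Finset.card_image_of_injective _ (fun a b => hf a b)]
      simp
    rw [← this]
    exact Set.ncard_le_ncard (by rintro _ ⟨i, rfl⟩; exact hP i) h
  · intro hj
    have := h.fintype
    have e : Fin j ↪ {x | P x} := (Fin.castLEEmb (by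
      rw [Set.ncard_eq_toFinset_card', Set.toFinset_card] at hj; exact hj)).trans
        (Fintype.equivFin {x | P x}).symm.toEmbedding
    exact ⟨fun i => (e i).1, fun i i' hi => e.injective (Subtype.ext hi), fun i => (e i).2⟩

theorem AtL.mono {P Q : M → Prop} {j : ℕ} (h : AtL P j) (hPQ : ∀ x, P x → Q x) : AtL Q j := by
  obtain ⟨f, h1, h2⟩ := h
  exact ⟨f, h1, fun i => hPQ _ (h2 i)⟩

def Tame (n : T → ℕ) : Prop :=
  (∀ k, Dfn fun t => n t = k) ∧ ∀ (S : Type u) [Enc M S] (F : S → M → T),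
    (DM fun p : S × M => F p.1 p.2) → ∃ B : S → M → Prop, (Dfn fun p : S × M => B p.1 p.2) ∧
      (∀ π, {s | B π s}.Finite) ∧ ∀ π s, ¬ B π s → Ev s (fun t => n (F π t) = n (F π s))

theorem Tame.comp {n : T → ℕ} (h : Tame n) {g : S → T} (hg : DM g) : Tame fun s => n (g s) :=
  ⟨fun k => (h.1 k).comp hg, fun S' _ F hF => h.2 S' (fun a b => g (F a b)) (DM.comp hg hF)⟩

theorem tame_card {Y : T → M → Prop} (hY : Dfn fun p : T × M => Y p.1 p.2)
    (hf : ∀ t, {x | Y t x}.Finite) : Tame fun t => {x | Y t x}.ncard := by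
  constructor
  · intro k
    have : Dfn fun t => AtL (Y t) k ∧ ¬ AtL (Y t) (k + 1) := dfn
    refine this.congr fun t => ?_
    rw [atL_iff (hf t), atL_iff (hf t)]
    show _ ↔ {x | Y t x}.ncard = k
    omega
  · intro S _ F hF
    refine ⟨fun π s => BadP (fun t x => Y (F π t) x) s, dfn, fun π => bad_finite (Y := fun t x => Y (F π t) x) ?_
      (fun s => hf _), fun π s hs => card_ev (Y := fun t x => Y (F π t) x) ?_ (fun s => hf _) hs⟩
    · have := DM.const (T := M × M) π
      exact dfn
    · exact dfn

def TB (T : Type u) [Enc M T] : Prop := ∀ n : T → ℕ, Tame n → ∃ N, ∀ t, n t ≤ N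

theorem TB.uf (h : TB T) {Y : T → M → Prop} (hY : Dfn fun p : T × M => Y p.1 p.2)
    (hf : ∀ t, {x | Y t x}.Finite) : ∃ K, ∀ t, {x | Y t x}.ncard ≤ K := h _ (tame_card hY hf)

theorem enum_of_bd {B : T → M → Prop} (hB : Dfn fun p : T × M => B p.1 p.2)
    (hf : ∀ t, {x | B t x}.Finite) {K : ℕ} (hK : ∀ t, {x | B t x}.ncard ≤ K) :
    ∃ a : Fin K → T → M, (∀ i, DM (a i)) ∧ ∀ t x, B t x → ∃ i, a i t = x := by
  classical
  obtain ⟨z⟩ := OM.nonemp (M := M)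
  let R : ℕ → T → M → Prop := fun j t x => B t x ∧ AtL (fun y => B t y ∧ y < x) j ∧
    ¬ AtL (fun y => B t y ∧ y < x) (j + 1)
  have hfl : ∀ t x, {y | B t y ∧ y < x}.Finite := fun t x => (hf t).subset fun y h => h.1
  have hR : ∀ j t x, R j t x ↔ B t x ∧ {y | B t y ∧ y < x}.ncard = j := fun j t x => by
    simp only [R]; rw [atL_iff (hfl t x), atL_iff (hfl t x)]
    constructor
    · rintro ⟨h, h1, h2⟩; exact ⟨h, by omega⟩
    · rintro ⟨h, h1⟩; exact ⟨h, by omega, by omega⟩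
  have uniq : ∀ j t x y, R j t x → R j t y → x ≤ y := by
    intro j t x y hx hy
    rw [hR] at hx hy
    by_contra hc
    rw [not_le] at hc
    have : {z | B t z ∧ z < y}.ncard < {z | B t z ∧ z < x}.ncard := Set.ncard_lt_ncard
      ⟨fun z hz => ⟨hz.1, hz.2.trans hc⟩, fun hh => lt_irrefl y (hh ⟨hy.1, hc⟩).2⟩ (hfl t x)
    omega
  refine ⟨fun j t => if h : ∃ x, R j t x then h.choose else z, fun j => ?_, fun t x hx => ?_⟩
  · have : Dfn fun p : T × M => R j p.1 p.2 ∨ ((¬ ∃ x, R j p.1 x) ∧ p.2 = z) := dfn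
    refine this.congr ?_
    rintro ⟨t, x⟩
    by_cases h : ∃ x, R j t x
    · simp only [h, dif_pos, not_true, false_and, or_false]
      constructor
      · exact fun h' => le_antisymm (uniq j t _ _ h.choose_spec h') (uniq j t _ _ h' h.choose_spec)
      · intro h'; rw [← h']; exact h.choose_spec
    · simp only [h, dif_neg, not_false_iff, true_and]
      constructor
      · rintro (h' | h')
        · exact absurd ⟨x, h'⟩ h
        · exact h'.symm
      · exact fun h' => Or.inr h'.symm
  · have hr : R ({y | B t y ∧ y < x}.ncard) t x := (hR _ _ _).2 ⟨hx, rfl⟩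
    have hlt : {y | B t y ∧ y < x}.ncard < K := lt_of_lt_of_le (Set.ncard_lt_ncard
      ⟨fun z hz => hz.1, fun hh => lt_irrefl x (hh hx).2⟩ (hf t)) (hK t)
    refine ⟨⟨_, hlt⟩, ?_⟩
    have h : ∃ z, R ({y | B t y ∧ y < x}.ncard) t z := ⟨x, hr⟩
    simp only [h, dif_pos]
    exact le_antisymm (uniq _ t _ _ h.choose_spec hr) (uniq _ t _ _ hr h.choose_spec)

/-- locally constant on a closed interval implies constant -/
theorem const_of_ev {n : M → ℕ} (hn : ∀ k, Dfn fun t => n t = k) {a b : M} (hab : a ≤ b)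
    (h : ∀ s, a ≤ s → s ≤ b → Ev s (fun t => n t = n s)) : n b = n a := by
  obtain ⟨Q, hk, hQ⟩ : ∃ Q : M → Prop, Dfn Q ∧ ∀ t, Q t ↔ n t = n a := ⟨_, hn (n a), fun t => Iff.rfl⟩
  obtain ⟨l, h1, h2⟩ := exists_lub (P := fun x => a ≤ x ∧ x ≤ b ∧ ∀ y, a ≤ y → y ≤ x → n y = n a) (by simp only [← hQ]; exact dfn)
    ⟨a, le_rfl, hab, fun y h h' => by rw [le_antisymm h' h]⟩ ⟨b, fun x hx => hx.2.1⟩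
  have hal : a ≤ l := h1 a ⟨le_rfl, hab, fun y h h' => by rw [le_antisymm h' h]⟩
  have hlb : l ≤ b := by
    by_contra hc
    obtain ⟨x, hx, hx'⟩ := h2 b (not_le.1 hc)
    exact absurd hx.2.1 (not_le.2 hx')
  obtain ⟨v, w, e1, e2, e3⟩ := h l hal hlb
  obtain ⟨x, hx, hx'⟩ := h2 v e1
  have hxl := h1 x hx
  have hl : n l = n a := (e3 x hx' (hxl.trans_lt e2)).symm.trans (hx.2.2 x hx.1 le_rfl)
  have key : ∀ y, a ≤ y → y < w → n y = n a := fun y hy hy' => by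
    rcases le_total y x with h | h
    · exact hx.2.2 y hy h
    · exact (e3 y (hx'.trans_le h) hy').trans hl
  rcases lt_or_ge b w with hbw | hbw
  · exact key b hab hbw
  · obtain ⟨y, hy, hy'⟩ := exists_between e2
    exact absurd (h1 y ⟨hal.trans hy.le, hy'.le.trans hbw, fun z hz hz' => key z hz (hz'.trans_lt hy')⟩)
      (not_le.2 hy)

theorem tame_place {n : T × M → ℕ} (hn : Tame n) {B : T → M → Prop}
    (hB : Dfn fun p : T × M => B p.1 p.2) (hf : ∀ t, {x | B t x}.Finite)
    (hE : ∀ t s, ¬ B t s → Ev s (fun x => n (t, x) = n (t, s)))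
    {H : T → M → Prop} (hH : Dfn fun p : T × M => H p.1 p.2) (hup : ∀ t, Ups (H t))
    (hne : ∀ t, ∃ x, H t x) (hnm : ∀ t x, H t x → ∃ y, y < x ∧ H t y) :
    ∃ N : T → ℕ, Tame N ∧ ∀ t x, H t x → (∀ z, H t z → z ≤ x → ¬ B t z) → n (t, x) = N t := by
  have cst : ∀ t x y, H t x → (∀ z, H t z → z ≤ x → ¬ B t z) → H t y →
      (∀ z, H t z → z ≤ y → ¬ B t z) → n (t, x) = n (t, y) := by
    have : ∀ t x y, x ≤ y → H t x → (∀ z, H t z → z ≤ y → ¬ B t z) → n (t, y) = n (t, x) := by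
      intro t x y hxy hx hb
      refine const_of_ev (n := fun x => n (t, x)) (fun k => ?_) hxy fun s h1 h2 =>
        hE t s (hb s (hup t _ _ h1 hx) h2)
      exact (hn.1 k).comp (f := fun x => (t, x)) dfn
    intro t x y h1 h2 h3 h4
    rcases le_total x y with h | h
    · exact (this t x y h h1 h4).symm
    · exact this t y x h h3 h2
  have ini : ∀ t, ∃ x, H t x ∧ ∀ z, H t z → z ≤ x → ¬ B t z := by
    intro t
    by_cases hc : ∃ b, B t b ∧ H t b
    · obtain ⟨b, hb, hb'⟩ := exists_min_of_finite (P := fun b => B t b ∧ H t b)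
        ((hf t).subset fun x hx => hx.1) hc
      obtain ⟨y, hy, hy'⟩ := hnm t b hb.2
      exact ⟨y, hy', fun z hz hz' hz'' => absurd (hb' z ⟨hz'', hz⟩) (not_le.2 (hz'.trans_lt hy))⟩
    · obtain ⟨x, hx⟩ := hne t
      exact ⟨x, hx, fun z hz _ hz' => hc ⟨z, hz', hz⟩⟩
  choose c hc1 hc2 using ini
  have main : ∀ t x, H t x → (∀ z, H t z → z ≤ x → ¬ B t z) → n (t, x) = n (t, c t) :=
    fun t x h1 h2 => cst t x (c t) h1 h2 (hc1 t) (hc2 t)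
  refine ⟨fun t => n (t, c t), ⟨fun k => ?_, fun S _ F hF => ?_⟩, main⟩
  · have := hn.1 k
    have h : Dfn fun t => ∃ x, H t x ∧ (∀ z, H t z → z ≤ x → ¬ B t z) ∧ n (t, x) = k := dfn
    refine h.congr fun t => ⟨?_, fun h => ⟨c t, hc1 t, hc2 t, h⟩⟩
    rintro ⟨x, h1, h2, rfl⟩
    exact (main t x h1 h2).symm
  · obtain ⟨B', hB', hf', hE'⟩ := hn.2 (S × M) (fun p s => (F p.1 s, p.2)) dfn
    let G : S → M → M → Prop := fun π t x => H (F π t) x ∧ ∀ z, H (F π t) z → z ≤ x → ¬ B (F π t) z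
    refine ⟨fun π s => ¬ ∃ x, ¬ B' (π, x) s ∧ Ev s (fun t => G π t x), dfn, fun π => ?_, fun π s hs => ?_⟩
    · by_contra hc
      obtain ⟨a, b, hab, h⟩ := big_of_inf dfn hc
      have hG : Dfn fun p : M × M => G π p.1 p.2 := dfn
      obtain ⟨p, q, c', d, h1, h2, h3, h4, h5⟩ := box1 hG hab (fun s _ _ => by
        refine inf_of_no_min ⟨c (F π s), hc1 _, hc2 _⟩ fun x hx => ?_
        obtain ⟨y, hy, hy'⟩ := hnm _ x hx.1
        exact ⟨y, ⟨hy', fun z hz hz' => hx.2 z hz (hz'.trans hy.le)⟩, hy⟩)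
      obtain ⟨s, hs, hs'⟩ := ((inf_Ioo h2).sdiff (hf' (π, c'))).nonempty
      exact h s (h1.le.trans hs.1.le) (hs.2.le.trans h3.le) ⟨c', hs', p, q, hs.1, hs.2, fun t e1 e2 =>
        h5 t c' e1.le e2.le le_rfl h4.le⟩
    · rw [not_not] at hs
      obtain ⟨x, h1, h2⟩ := hs
      refine (h2.and (hE' (π, x) s h1)).mono fun t ht => ?_
      have h3 := h2.self
      have e := ht.2
      simp only at e
      rw [main _ x ht.1.1 ht.1.2, main _ x h3.1 h3.2] at e
      exact e

theorem TB.prod (h : TB T) : TB (T × M) := by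
  intro n hn
  obtain ⟨B, hB, hf, hE⟩ := hn.2 T (fun t x => (t, x)) dfn
  obtain ⟨K, hK⟩ := h.uf hB hf
  obtain ⟨a, ha, ha'⟩ := enum_of_bd hB hf hK
  have b1 : ∀ i, ∃ N, ∀ t, n (t, a i t) ≤ N := fun i => by
    have := ha i
    exact h _ (hn.comp (g := fun t => (t, a i t)) dfn)
  have b2 : ∀ j : Fin (K + 1), ∃ N, ∀ t x, ¬ B t x → {y | B t y ∧ y < x}.ncard = j → n (t, x) ≤ N := by
    intro j
    have hfl : ∀ t x, {y | B t y ∧ y < x}.Finite := fun t x => (hf t).subset fun y h => h.1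
    let H : T → M → Prop := fun t x => AtL (fun y => B t y ∧ y < x) j ∨ ¬ AtL (B t) j
    obtain ⟨N, hN, hN'⟩ := tame_place hn hB hf hE (H := H) dfn (by
      rintro t x y hxy (h1 | h1)
      · exact Or.inl (h1.mono fun z hz => ⟨hz.1, hz.2.trans_le hxy⟩)
      · exact Or.inr h1) (by
      intro t
      by_cases h1 : AtL (B t) j
      · obtain ⟨f, h2, h3⟩ := h1
        obtain ⟨z, hz⟩ := (Set.finite_range f).bddAbove
        obtain ⟨w, hw⟩ := exists_gt z
        exact ⟨w, Or.inl ⟨f, h2, fun i => ⟨h3 i, (hz ⟨i, rfl⟩).trans_lt hw⟩⟩⟩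
      · obtain ⟨z⟩ := OM.nonemp (M := M)
        exact ⟨z, Or.inr h1⟩) (by
      rintro t x (⟨f, h2, h3⟩ | h1)
      · obtain ⟨y0, hy0⟩ := exists_lt x
        rcases Nat.eq_zero_or_pos j.1 with hj | hj
        · exact ⟨y0, hy0, Or.inl ⟨f, h2, fun i => absurd i.2 (by omega)⟩⟩
        · have : Nonempty (Fin j) := ⟨⟨0, hj⟩⟩
          obtain ⟨i, hi⟩ := Finite.exists_max f
          obtain ⟨y, hy, hy'⟩ := exists_between (h3 i).2
          exact ⟨y, hy', Or.inl ⟨f, h2, fun i' => ⟨(h3 i').1, (hi i').trans_lt hy⟩⟩⟩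
      · obtain ⟨y0, hy0⟩ := exists_lt x
        exact ⟨y0, hy0, Or.inr h1⟩)
    obtain ⟨k, hk⟩ := h N hN
    refine ⟨k, fun t x hx hj => ?_⟩
    rw [hN' t x (Or.inl ((atL_iff (hfl t x) _).2 hj.ge)) ?_]
    · exact hk t
    · rintro z (hz | hz) hzx hBz
      · rw [atL_iff (hfl t z)] at hz
        have hzx' : z < x := lt_of_le_of_ne hzx (fun e => hx (e ▸ hBz))
        have : {y | B t y ∧ y < z}.ncard < {y | B t y ∧ y < x}.ncard := Set.ncard_lt_ncard
          ⟨fun w hw => ⟨hw.1, hw.2.trans hzx'⟩, fun hh => lt_irrefl z (hh ⟨hBz, hzx'⟩).2⟩ (hfl t x)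
        omega
      · rw [atL_iff (hf t)] at hz
        have := Set.ncard_le_ncard (s := {y | B t y ∧ y < x}) (t := {y | B t y}) (fun y hy => hy.1) (hf t)
        omega
  choose N1 h1 using b1
  choose N2 h2 using b2
  refine ⟨(∑ i, N1 i) + ∑ j, N2 j, ?_⟩
  rintro ⟨t, x⟩
  by_cases hx : B t x
  · obtain ⟨i, hi⟩ := ha' t x hx
    have e1 := h1 i t
    rw [hi] at e1
    have e2 := Finset.single_le_sum (f := N1) (fun i _ => Nat.zero_le _) (Finset.mem_univ i)
    omega
  · have hj : {y | B t y ∧ y < x}.ncard < K + 1 := by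
      have := Set.ncard_le_ncard (s := {y | B t y ∧ y < x}) (t := {y | B t y}) (fun y hy => hy.1) (hf t)
      have := hK t
      omega
    have e1 := h2 ⟨_, hj⟩ t x hx rfl
    have e2 := Finset.single_le_sum (f := N2) (fun i _ => Nat.zero_le _) (Finset.mem_univ ⟨_, hj⟩)
    omega

theorem TB.surj (h : TB S) {g : S → T} (hg : DM g) (hs : Function.Surjective g) : TB T := by
  intro n hn
  obtain ⟨N, hN⟩ := h _ (hn.comp hg)
  exact ⟨N, fun t => by obtain ⟨s, rfl⟩ := hs t; exact hN s⟩

theorem DM.encsymm : DM fun v : Enc.Idx T → M => (Enc.e.symm v : T) :=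
  DM.of_coord fun i => by
    simp only [Equiv.apply_symm_apply]
    exact DM.apply0 i

theorem tb_fin (k : ℕ) : TB (Fin k → M) := by
  induction k with
  | zero => exact fun n _ => ⟨n Fin.elim0, fun t => by rw [Subsingleton.elim t Fin.elim0]⟩
  | succ k ih =>
    refine ih.prod.surj (g := fun p => Fin.snoc (α := fun _ => M) p.1 p.2) ?_ ?_
    · refine DM.pi fun i => ?_
      refine Fin.lastCases ?_ (fun i => ?_) i
      · simp only [Fin.snoc_last]; exact dfn
      · simp only [Fin.snoc_castSucc]; exact dfn
    · exact fun v => ⟨(fun i => v i.castSucc, v (Fin.last k)), by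
        ext i; refine Fin.lastCases ?_ (fun i => ?_) i <;> simp⟩

theorem tb (T : Type u) [Enc M T] : TB T := by
  have := Enc.fin (T := T)
  obtain ⟨k, ⟨e⟩⟩ := Finite.exists_equiv_fin (Enc.Idx T)
  have h1 : TB (Enc.Idx T → M) := (tb_fin k).surj (g := fun v i => v (e i)) dfn
    fun v => ⟨fun j => v (e.symm j), by simp⟩
  exact h1.surj DM.encsymm (fun t => ⟨Enc.e t, by simp⟩)

theorem uf {Y : T → M → Prop} (hY : Dfn fun p : T × M => Y p.1 p.2)
    (hf : ∀ t, {x | Y t x}.Finite) : ∃ K, ∀ t, {x | Y t x}.ncard ≤ K := (tb T).uf hY hf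

theorem enum {B : T → M → Prop} (hB : Dfn fun p : T × M => B p.1 p.2)
    (hf : ∀ t, {x | B t x}.Finite) :
    ∃ (K : ℕ) (a : Fin K → T → M), (∀ i, DM (a i)) ∧ ∀ t x, B t x → ∃ i, a i t = x := by
  obtain ⟨K, hK⟩ := uf hB hf
  obtain ⟨a, h⟩ := enum_of_bd hB hf hK
  exact ⟨K, a, h⟩

end

section
variable {M : Type u} [OM M] {T S R : Type u} [Enc M T] [Enc M S] [Enc M R]

abbrev Bdry (G : M → Prop) (x : M) : Prop := ¬ Ev x G ∧ ¬ Ev x (fun t => ¬ G t)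

theorem bdry_finite {G : M → Prop} (hG : Dfn G) : {x | Bdry G x}.Finite := by
  by_contra hc
  obtain ⟨a, b, hab, h⟩ := big_of_inf dfn hc
  have key : ∀ Q : M → Prop, Dfn Q → {x | (a ≤ x ∧ x ≤ b) ∧ Q x}.Infinite →
      ∃ x, a ≤ x ∧ x ≤ b ∧ Ev x Q := by
    intro Q hQ hi
    obtain ⟨c, d, hcd, h'⟩ := big_of_inf (P := fun x => (a ≤ x ∧ x ≤ b) ∧ Q x) dfn hi
    obtain ⟨s, h1, h2, h3⟩ := not_big_ev hcd (fun t e1 e2 => (h' t e1 e2).2)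
    exact ⟨s, (h' s h1.le h2.le).1.1, (h' s h1.le h2.le).1.2, h3⟩
  by_cases hi : {x | (a ≤ x ∧ x ≤ b) ∧ G x}.Infinite
  · obtain ⟨x, h1, h2, h3⟩ := key _ hG hi
    exact (h x h1 h2).1 h3
  · obtain ⟨x, h1, h2, h3⟩ := key _ hG.not (fun hi' => by
      refine inf_Icc hab (((not_infinite.1 hi).union hi').subset fun x hx => ?_)
      by_cases hg : G x
      · exact Or.inl ⟨hx, hg⟩
      · exact Or.inr ⟨hx, hg⟩)
    exact (h x h1 h2).2 h3

theorem conn {G : M → Prop} (hG : Dfn G) {a b : M} (hab : a ≤ b)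
    (h : ∀ x, a ≤ x → x ≤ b → ¬ Bdry G x) : G a ↔ G b := by
  classical
  have := const_of_ev (n := fun x => if G x then 1 else 0) (a := a) (b := b) (fun k => by
    have h : Dfn fun t => (G t ∧ 1 = k) ∨ (¬ G t ∧ 0 = k) := dfn
    refine h.congr fun t => ?_
    by_cases hg : G t <;> simp [hg]) hab (fun s h1 h2 => by
    by_cases h3 : Ev s G
    · have := h3.self
      exact h3.mono fun t ht => by simp [ht, this]
    · have h3 := not_not.1 (fun h4 => h s h1 h2 ⟨h3, h4⟩)
      have := h3.self
      exact h3.mono fun t ht => by simp [ht, this])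
  by_cases ha : G a <;> by_cases hb : G b <;> simp_all

abbrev Conv (P : M → Prop) : Prop := ∀ x y z, x ≤ y → y ≤ z → P x → P z → P y

theorem pieces {G : T → M → Prop} (hG : Dfn fun p : T × M => G p.1 p.2) :
    ∃ (J : Type) (_ : Fintype J) (D : J → T → M → Prop),
      (∀ j, Dfn fun p : T × M => D j p.1 p.2) ∧ (∀ j t, Conv (D j t)) ∧
      ∀ t x, G t x ↔ ∃ j, D j t x := by
  have hGt : ∀ t, Dfn (G t) := fun t => dfn
  obtain ⟨K, a, ha, ha'⟩ := enum (B := fun t => Bdry (G t)) dfn (fun t => bdry_finite (hGt t))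
  let D : (Fin K ⊕ Fin K ⊕ Unit) → T → M → Prop := fun j => match j with
    | Sum.inl i => fun t x => G t x ∧ x = a i t
    | Sum.inr (Sum.inl i) => fun t x => G t x ∧ a i t < x ∧ ∀ y, a i t < y → y ≤ x → ¬ Bdry (G t) y
    | Sum.inr (Sum.inr _) => fun t x => G t x ∧ ∀ y, y ≤ x → ¬ Bdry (G t) y
  refine ⟨_, inferInstance, D, ?_, ?_, ?_⟩
  · rintro (i | i | i)
    · have := ha i
      exact dfn
    · have := ha i
      exact dfn
    · exact dfn
  · rintro (i | i | i) t x y z hxy hyz hx hz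
    · have : y = x := le_antisymm (by rw [hx.2, ← hz.2]; exact hyz) hxy
      rwa [this]
    · refine ⟨(conn (hGt t) hxy fun w h1 h2 => hz.2.2 w (hx.2.1.trans_le h1) (h2.trans hyz)).1 hx.1,
        hx.2.1.trans_le hxy, fun w h1 h2 => hz.2.2 w h1 (h2.trans hyz)⟩
    · refine ⟨(conn (hGt t) hxy fun w h1 h2 => hz.2 w (h2.trans hyz)).1 hx.1,
        fun w h2 => hz.2 w (h2.trans hyz)⟩
  · intro t x
    constructor
    · intro hg
      by_cases h1 : ∃ y, y ≤ x ∧ Bdry (G t) y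
      · obtain ⟨y, hy, hmax⟩ := Set.exists_max_image {y | y ≤ x ∧ Bdry (G t) y} id
          ((bdry_finite (hGt t)).subset fun y hy => hy.2) h1
        obtain ⟨i, hi⟩ := ha' t y hy.2
        rcases hy.1.eq_or_lt with h | h
        · exact ⟨Sum.inl i, hg, by rw [hi, h]⟩
        · refine ⟨Sum.inr (Sum.inl i), hg, by rwa [hi], fun z h2 h3 h4 => ?_⟩
          have := hmax z ⟨h3, h4⟩
          rw [hi] at h2
          exact absurd this (not_le.2 h2)
      · exact ⟨Sum.inr (Sum.inr ()), hg, fun y h2 h3 => h1 ⟨y, h2, h3⟩⟩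
    · rintro ⟨i | i | i, h⟩ <;> exact h.1

theorem DM.snoc {k : ℕ} : DM fun p : (Fin k → M) × M => (Fin.snoc p.1 p.2 : Fin (k + 1) → M) := by
  refine DM.pi fun i => ?_
  refine Fin.lastCases ?_ (fun i => ?_) i
  · simp only [Fin.snoc_last]; exact dfn
  · simp only [Fin.snoc_castSucc]; exact dfn

theorem snoc_eta {k : ℕ} (v : Fin (k + 1) → M) :
    (Fin.snoc (fun i : Fin k => v i.castSucc) (v (Fin.last k)) : Fin (k + 1) → M) = v := by
  ext i; refine Fin.lastCases ?_ (fun i => ?_) i <;> simp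

abbrev bx {e : ℕ} (p q z : Fin e → M) : Prop := ∀ i, p i ≤ z i ∧ z i ≤ q i

theorem bx_snoc {e : ℕ} {p q z : Fin e → M} {a b x : M} :
    bx (Fin.snoc p a : Fin (e + 1) → M) (Fin.snoc q b : Fin (e + 1) → M) (Fin.snoc z x : Fin (e + 1) → M) ↔
      bx p q z ∧ a ≤ x ∧ x ≤ b := by
  constructor
  · intro h
    refine ⟨fun i => ?_, ?_⟩
    · simpa using h i.castSucc
    · simpa using h (Fin.last e)
  · rintro ⟨h1, h2⟩ i
    refine Fin.lastCases ?_ (fun i => ?_) i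
    · simpa using h2
    · simpa using h1 i

theorem lt_snoc {e : ℕ} {p q : Fin e → M} {a b : M} (h : ∀ i, p i < q i) (hab : a < b) (i : Fin (e + 1)) :
    (Fin.snoc p a : Fin (e + 1) → M) i < (Fin.snoc q b : Fin (e + 1) → M) i := by
  refine Fin.lastCases ?_ (fun i => ?_) i
  · simpa using hab
  · simpa using h i

theorem ibox (e : ℕ) : ∀ (A : (Fin e → M) → M → Prop), (Dfn fun p : (Fin e → M) × M => A p.1 p.2) →
    ∀ p q : Fin e → M, (∀ i, p i < q i) → (∀ z, bx p q z → {x | A z x}.Infinite) →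
    ∃ p' q' : Fin e → M, (∀ i, p' i < q' i) ∧ (∀ z, bx p' q' z → bx p q z) ∧ ∃ c d, c < d ∧
      ∀ z, bx p' q' z → ∀ x, c ≤ x → x ≤ d → A z x := by
  induction e with
  | zero =>
    intro A hA p q hpq h
    obtain ⟨c, d, hcd, h'⟩ := big_of_inf (P := A p) dfn (h p (fun i => i.elim0))
    exact ⟨p, q, hpq, fun z hz => hz, c, d, hcd, fun z _ => by
      rw [Subsingleton.elim z p]; exact h'⟩
  | succ e ih =>
    intro A hA p q hpq h
    have pick : ∀ (A : (Fin e → M) → M → Prop), (Dfn fun p : (Fin e → M) × M => A p.1 p.2) →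
      ∀ p q : Fin e → M, (∀ i, p i < q i) → (∀ z, bx p q z → {x | A z x}.Infinite) →
      ∃ p' q' : Fin e → M, (∀ i, p' i < q' i) ∧ (∀ z, bx p' q' z → bx p q z) ∧ ∃ c,
        ∀ z, bx p' q' z → A z c := by
      intro A hA p q hpq h
      obtain ⟨p', q', h1, h2, c, d, hcd, h3⟩ := ih A hA p q hpq h
      exact ⟨p', q', h1, h2, c, fun z hz => h3 z hz c le_rfl hcd.le⟩
    obtain ⟨p, a, rfl⟩ : ∃ p' a, p = (Fin.snoc p' a : Fin (e + 1) → M) := ⟨_, _, (snoc_eta p).symm⟩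
    obtain ⟨q, b, rfl⟩ : ∃ p' a, q = (Fin.snoc p' a : Fin (e + 1) → M) := ⟨_, _, (snoc_eta q).symm⟩
    have hab : a < b := by simpa using hpq (Fin.last e)
    have hpq' : ∀ i, p i < q i := fun i => by simpa using hpq i.castSucc
    have hsn := DM.snoc (M := M) (k := e)
    have hAs : Dfn fun r : (Fin e → M) × M × M => A (Fin.snoc r.1 r.2.1) r.2.2 := dfn
    obtain ⟨A', rfl⟩ : ∃ A' : (Fin e → M) → M → M → Prop, A' = fun z s x => A (Fin.snoc z s) x := ⟨_, rfl⟩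
    generalize hA' : (fun (z : Fin e → M) (s x : M) => A (Fin.snoc z s) x) = A' at hAs
    have hA'' : ∀ z s x, A (Fin.snoc z s) x ↔ A' z s x := fun z s x => by rw [← hA']
    replace hAs : Dfn fun r : (Fin e → M) × M × M => A' r.1 r.2.1 r.2.2 := by
      simpa only [hA''] using hAs
    have W : ∀ z, bx p q z → ∃ s1 s2 c d, (a < s1 ∧ s1 < s2 ∧ s2 < b ∧ c < d) ∧
        ∀ s x, s1 ≤ s → s ≤ s2 → c ≤ x → x ≤ d → A' z s x := by
      intro z hz
      obtain ⟨s1, s2, c, d, h1, h2, h3, h4, h5⟩ := box1 (G := A' z) dfn hab (fun s e1 e2 => by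
        simpa only [hA''] using h (Fin.snoc z s) (bx_snoc.2 ⟨hz, e1.le, e2.le⟩))
      exact ⟨s1, s2, c, d, ⟨h1, h2, h3, h4⟩, h5⟩
    obtain ⟨p1, q1, l1, m1, s1, g1⟩ := pick (fun z s1 => ∃ s2 c d, (a < s1 ∧ s1 < s2 ∧ s2 < b ∧ c < d) ∧
        ∀ s x, s1 ≤ s → s ≤ s2 → c ≤ x → x ≤ d → A' z s x) dfn p q hpq' (fun z hz => by
      obtain ⟨s1, s2, c, d, ⟨h1, h2, h3, h4⟩, h5⟩ := W z hz
      exact (inf_Ioo h2).mono fun s hs => ⟨s2, c, d, ⟨h1.trans hs.1, hs.2, h3, h4⟩,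
        fun s' x e1 => h5 s' x (hs.1.le.trans e1)⟩)
    obtain ⟨p2, q2, l2, m2, s2, g2⟩ := pick (fun z s2 => ∃ c d, (a < s1 ∧ s1 < s2 ∧ s2 < b ∧ c < d) ∧
        ∀ s x, s1 ≤ s → s ≤ s2 → c ≤ x → x ≤ d → A' z s x) dfn p1 q1 l1 (fun z hz => by
      obtain ⟨s2, c, d, ⟨h1, h2, h3, h4⟩, h5⟩ := g1 z hz
      exact (inf_Ioo h2).mono fun s hs => ⟨c, d, ⟨h1, hs.1, hs.2.trans h3, h4⟩,
        fun s' x e1 e2 => h5 s' x e1 (e2.trans hs.2.le)⟩)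
    obtain ⟨p3, q3, l3, m3, c, g3⟩ := pick (fun z c => ∃ d, (a < s1 ∧ s1 < s2 ∧ s2 < b ∧ c < d) ∧
        ∀ s x, s1 ≤ s → s ≤ s2 → c ≤ x → x ≤ d → A' z s x) dfn p2 q2 l2 (fun z hz => by
      obtain ⟨c, d, ⟨h1, h2, h3, h4⟩, h5⟩ := g2 z hz
      exact (inf_Ioo h4).mono fun s hs => ⟨d, ⟨h1, h2, h3, hs.2⟩,
        fun s' x e1 e2 e3 => h5 s' x e1 e2 (hs.1.le.trans e3)⟩)
    obtain ⟨p4, q4, l4, m4, d, g4⟩ := pick (fun z d => (a < s1 ∧ s1 < s2 ∧ s2 < b ∧ c < d) ∧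
        ∀ s x, s1 ≤ s → s ≤ s2 → c ≤ x → x ≤ d → A' z s x) dfn p3 q3 l3 (fun z hz => by
      obtain ⟨d, ⟨h1, h2, h3, h4⟩, h5⟩ := g3 z hz
      exact (inf_Ioo h4).mono fun s hs => ⟨⟨h1, h2, h3, hs.1⟩,
        fun s' x e1 e2 e3 e4 => h5 s' x e1 e2 e3 (e4.trans hs.2.le)⟩)
    have hlt := (g4 p4 (fun i => ⟨le_rfl, (l4 i).le⟩)).1
    refine ⟨Fin.snoc p4 s1, Fin.snoc q4 s2, lt_snoc l4 hlt.2.1, fun z hz => ?_, c, d, hlt.2.2.2,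
      fun z hz x h1 h2 => ?_⟩
    · rw [← snoc_eta z, bx_snoc] at hz ⊢
      exact ⟨m1 _ (m2 _ (m3 _ (m4 _ hz.1))), hlt.1.le.trans hz.2.1, hz.2.2.trans hlt.2.2.1.le⟩
    · rw [← snoc_eta z] at hz ⊢
      rw [bx_snoc] at hz
      rw [hA'']
      exact (g4 _ hz.1).2 _ _ hz.2.1 hz.2.2 h1 h2

end

section
variable {M : Type u} [OM M] {T S R Ω : Type u} [Enc M T] [Enc M S] [Enc M R] [Enc M Ω]

/-- set of traces -/
def Traces {α β : Type*} (D : β → Prop) (P : α → β → Prop) {N : ℕ} (a : Fin N → α) : Set (Set (Fin N)) :=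
  {I | ∃ x, D x ∧ I = {i | P (a i) x}}

def Cod (D : T → Prop) (d : ℕ) : Prop :=
  ∀ (Ω : Type u) [Enc M Ω] (P : Ω → T → Prop), (Dfn fun p : Ω × T => P p.1 p.2) →
    ∃ A : ℕ, ∀ N, 1 ≤ N → ∀ a : Fin N → Ω, (Traces D P a).ncard ≤ A * N ^ d

theorem Cod.mono {D D' : T → Prop} {d : ℕ} (h : Cod D d) (h' : ∀ x, D' x → D x) : Cod D' d := by
  intro Ω _ P hP
  obtain ⟨A, hA⟩ := h Ω P hP
  refine ⟨A, fun N hN a => (Set.ncard_le_ncard ?_ (Set.toFinite _)).trans (hA N hN a)⟩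
  rintro _ ⟨x, hx, rfl⟩
  exact ⟨x, h' x hx, rfl⟩

theorem Cod.iUnion {ι : Type} [Fintype ι] {D : ι → T → Prop} {d : ℕ} (h : ∀ i, Cod (D i) d) :
    Cod (fun x => ∃ i, D i x) d := by
  intro Ω _ P hP
  choose A hA using fun i => h i Ω P hP
  refine ⟨∑ i, A i, fun N hN a => ?_⟩
  have : Traces (fun x => ∃ i, D i x) P a ⊆ ⋃ i, Traces (D i) P a := by
    rintro _ ⟨x, ⟨i, hx⟩, rfl⟩
    exact Set.mem_iUnion.2 ⟨i, x, hx, rfl⟩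
  refine (Set.ncard_le_ncard this (Set.toFinite _)).trans ((Set.ncard_iUnion_le_of_fintype _).trans ?_)
  rw [Finset.sum_mul]
  exact Finset.sum_le_sum fun i _ => hA i N hN a

theorem Cod.union {D D' : T → Prop} {d : ℕ} (h : Cod D d) (h' : Cod D' d) :
    Cod (fun x => D x ∨ D' x) d := by
  refine (Cod.iUnion (ι := Bool) (D := fun b => match b with | true => D | false => D') (d := d) (by
      rintro (_ | _)
      · exact h'
      · exact h)).mono ?_
  rintro x (hx | hx)
  · exact ⟨true, hx⟩
  · exact ⟨false, hx⟩

theorem Cod.graph {B : T → Prop} {d : ℕ} (h : Cod B d) {f : T → S} (hf : DM f) :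
    Cod (fun y => ∃ t, B t ∧ y = f t) d := by
  intro Ω _ P hP
  obtain ⟨A, hA⟩ := h Ω (fun o t => P o (f t)) dfn
  refine ⟨A, fun N hN a => (Set.ncard_le_ncard ?_ (Set.toFinite _)).trans (hA N hN a)⟩
  rintro _ ⟨_, ⟨x, hx, rfl⟩, rfl⟩
  exact ⟨x, hx, rfl⟩

theorem Cod.fib {B : T → Prop} {d : ℕ} (h : Cod B d) : Cod (fun p : T × M => B p.1) (d + 1) := by
  classical
  intro Ω _ P hP
  obtain ⟨J, _, D, hD, hc, hPD⟩ := pieces (G := fun (p : Ω × T) (x : M) => P p.1 (p.2, x)) dfn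
  let H : Option (J × Bool) → Ω → T → M → Prop := fun τ => match τ with
    | none => fun _ _ _ => True
    | some (j, true) => fun o t x => ∃ y, y ≤ x ∧ D j (o, t) y
    | some (j, false) => fun o t x => ∀ y, D j (o, t) y → y < x
  have hup : ∀ τ o t, Ups (H τ o t) := by
    rintro (_ | ⟨j, _ | _⟩) o t x y hxy h
    · trivial
    · exact fun z hz => (h z hz).trans_le hxy
    · obtain ⟨z, h1, h2⟩ := h
      exact ⟨z, h1.trans hxy, h2⟩
  have hH : ∀ τ, Dfn fun p : Ω × T × M => H τ p.1 p.2.1 p.2.2 := by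
    rintro (_ | ⟨j, _ | _⟩)
    · exact dfn
    · have := hD j
      exact dfn
    · have := hD j
      exact dfn
  let Q : Option (J × Bool) → Ω × Ω → T → Prop := fun τ o t => ∃ j,
    (∀ x, H τ o.1 t x → H (some (j, true)) o.2 t x) ∧
    ¬ (∀ x, H τ o.1 t x → H (some (j, false)) o.2 t x)
  have hQ : ∀ τ, Dfn fun p : (Ω × Ω) × T => Q τ p.1 p.2 := fun τ => by
    have h0 := hH τ
    have h1 := fun j => hH (some (j, true))
    have h2 := fun j => hH (some (j, false))
    refine Dfn.exFin fun j => ?_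
    have h1 := h1 j
    have h2 := h2 j
    generalize H τ = H0 at *
    generalize H (some (j, true)) = H1 at *
    generalize H (some (j, false)) = H2 at *
    exact dfn
  choose A hA using fun τ => h (Ω × Ω) (Q τ) (hQ τ)
  refine ⟨∑ τ, A τ, fun N hN a => ?_⟩
  have : Traces (fun p : T × M => B p.1) P a ⊆
      ⋃ r : Option (J × Bool) × Fin N, Traces B (Q r.1) (fun i => (a r.2, a i)) := by
    rintro _ ⟨⟨t, x⟩, hx, rfl⟩
    let i0 : Fin N := ⟨0, hN⟩
    -- the smallest upset containing x
    obtain ⟨r, hr, hmin⟩ := WellFounded.has_min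
      (r := fun r r' : Option (J × Bool) × Fin N => (∀ x, H r.1 (a r.2) t x → H r'.1 (a r'.2) t x) ∧
        ¬ ∀ x, H r'.1 (a r'.2) t x → H r.1 (a r.2) t x) (by
        have : IsTrans _ (fun r r' : Option (J × Bool) × Fin N => (∀ x, H r.1 (a r.2) t x → H r'.1 (a r'.2) t x) ∧
          ¬ ∀ x, H r'.1 (a r'.2) t x → H r.1 (a r.2) t x) := ⟨fun p q r h1 h2 =>
            ⟨fun x hx => h2.1 x (h1.1 x hx), fun h3 => h1.2 fun x hx => h3 x (h2.1 x hx)⟩⟩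
        have : Std.Irrefl (fun r r' : Option (J × Bool) × Fin N => (∀ x, H r.1 (a r.2) t x → H r'.1 (a r'.2) t x) ∧
          ¬ ∀ x, H r'.1 (a r'.2) t x → H r.1 (a r.2) t x) := ⟨fun p h => h.2 h.1⟩
        exact Finite.wellFounded_of_trans_of_irrefl _) {r | H r.1 (a r.2) t x} ⟨(none, i0), trivial⟩
    have key : ∀ r' : Option (J × Bool) × Fin N, H r'.1 (a r'.2) t x ↔ ∀ y, H r.1 (a r.2) t y → H r'.1 (a r'.2) t y := by
      intro r'
      refine ⟨fun h1 => ?_, fun h1 => h1 x hr⟩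
      by_contra h2
      refine hmin r' h1 ⟨fun y hy => ?_, h2⟩
      by_contra h3
      exact h2 fun z hz => by
        rcases le_total y z with h4 | h4
        · exact hup _ _ _ _ _ h4 hy
        · exact absurd (hup _ _ _ _ _ h4 hz) h3
    refine Set.mem_iUnion.2 ⟨r, t, hx, ?_⟩
    ext i
    show P (a i) (t, x) ↔ ∃ j, (∀ y, H r.1 (a r.2) t y → H (some (j, true)) (a i) t y) ∧
      ¬ (∀ y, H r.1 (a r.2) t y → H (some (j, false)) (a i) t y)
    rw [hPD (a i, t) x]
    refine exists_congr fun j => ?_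
    rw [← key (some (j, true), i), ← key (some (j, false), i)]
    constructor
    · exact fun h => ⟨⟨x, le_rfl, h⟩, fun h' => lt_irrefl x (h' x h)⟩
    · rintro ⟨⟨y, hy, hy'⟩, h2⟩
      have : ∃ z, D j (a i, t) z ∧ x ≤ z := by
        by_contra h3
        exact h2 fun z hz => not_le.1 fun h4 => h3 ⟨z, hz, h4⟩
      obtain ⟨z, hz, hz'⟩ := this
      exact hc j _ _ _ _ hy hz' hy' hz
  refine (Set.ncard_le_ncard this (Set.toFinite _)).trans ((Set.ncard_iUnion_le_of_fintype _).trans ?_)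
  rw [Fintype.sum_prod_type, Finset.sum_mul]
  refine Finset.sum_le_sum fun τ _ => (Finset.sum_le_sum fun i _ => hA τ N hN _).trans ?_
  simp only [Finset.sum_const, Finset.card_univ, Fintype.card_fin, smul_eq_mul]
  apply le_of_eq
  ring

theorem cod_main (k : ℕ) : ∀ (D : (Fin k → M) → Prop), Dfn D → ∀ d, Cod D d ∨
    ∃ ι : Fin (d + 1) → Fin k, Function.Injective ι ∧ ∃ p q : Fin (d + 1) → M, (∀ i, p i < q i) ∧
      ∀ z, bx p q z → ∃ v, D v ∧ (fun i => v (ι i)) = z := by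
  induction k with
  | zero =>
    intro D hD d
    left
    intro Ω _ P hP
    refine ⟨1, fun N hN a => ?_⟩
    have : (Traces D P a).Subsingleton := by
      rintro _ ⟨x, hx, rfl⟩ _ ⟨y, hy, rfl⟩
      rw [Subsingleton.elim x y]
    refine (Set.ncard_le_one_iff_subsingleton.2 this).trans ?_
    rw [one_mul]
    exact Nat.one_le_pow _ _ hN
  | succ k ih =>
    intro D hD d
    by_contra hcon
    push Not at hcon
    obtain ⟨hcod, hbox⟩ := hcon
    have hsn := DM.snoc (M := M) (k := k)
    have hbox : ¬ ∃ ι : Fin (d + 1) → Fin (k + 1), Function.Injective ι ∧ ∃ p q : Fin (d + 1) → M,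
      (∀ i, p i < q i) ∧ ∀ z, bx p q z → ∃ v, D v ∧ (fun i => v (ι i)) = z := by
      rintro ⟨ι, h1, p, q, h2, h3⟩
      obtain ⟨z, h4, h5⟩ := hbox ι h1 p q h2
      obtain ⟨v, h6, h7⟩ := h3 z h4
      exact h5 v h6 h7
    obtain ⟨D', hD'⟩ : ∃ D' : (Fin k → M) → M → Prop, ∀ y x, D' y x ↔ D (Fin.snoc y x) := ⟨_, fun _ _ => Iff.rfl⟩
    have hD'd : Dfn fun p : (Fin k → M) × M => D' p.1 p.2 := by
      simp only [hD']
      exact dfn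
    have hbig : Dfn fun y => Big (D' y) := dfn
    have hsing : ∀ y, Dfn (D' y) := fun y => dfn
    obtain ⟨n, a, ha, ha'⟩ := enum (B := fun y x => ¬ Big (D' y) ∧ D' y x) dfn (fun y => by
      by_cases hy : Big (D' y)
      · simp [hy]
      · have := mt (big_iff (hsing y)).1 hy
        exact (not_infinite.1 this).subset fun x hx => hx.2)
    have c0 : Cod (fun y => ∃ x, ¬ Big (D' y) ∧ D' y x) d := by
      refine (ih _ dfn d).resolve_right ?_
      rintro ⟨ι, h1, p, q, h2, h3⟩
      refine hbox ⟨fun i => (ι i).castSucc, fun i j h => h1 (Fin.castSucc_injective _ h), p, q, h2, fun z hz => ?_⟩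
      obtain ⟨y, ⟨x, _, hx⟩, rfl⟩ := h3 z hz
      exact ⟨Fin.snoc y x, (hD' _ _).1 hx, by ext i; simp⟩
    have c1 : Cod (fun v => ∃ i : Fin n, ∃ y, (∃ x, ¬ Big (D' y) ∧ D' y x) ∧
        v = (Fin.snoc y (a i y) : Fin (k + 1) → M)) d := by
      refine Cod.iUnion fun i => ?_
      have := ha i
      exact c0.graph (f := fun y => (Fin.snoc y (a i y) : Fin (k + 1) → M)) dfn
    have c2 : Cod (fun v => ∃ p : (Fin k → M) × M, Big (D' p.1) ∧ v = (Fin.snoc p.1 p.2 : Fin (k + 1) → M)) d := by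
      cases d with
      | zero =>
        have : ∀ y, ¬ Big (D' y) := by
          rintro y ⟨p, q, hpq, h⟩
          refine hbox ⟨fun _ => Fin.last k, fun i j _ => Fin.ext (by omega), fun _ => p, fun _ => q,
            fun _ => hpq, fun z hz => ⟨Fin.snoc y (z 0), (hD' _ _).1 (h _ (hz 0).1 (hz 0).2), ?_⟩⟩
          ext i
          obtain rfl : i = 0 := Fin.ext (by omega)
          simp
        intro Ω _ P hP
        refine ⟨0, fun N hN a => ?_⟩
        have : Traces (fun v => ∃ p : (Fin k → M) × M, Big (D' p.1) ∧
          v = (Fin.snoc p.1 p.2 : Fin (k + 1) → M)) P a = ∅ := by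
          rw [Set.eq_empty_iff_forall_notMem]
          rintro _ ⟨_, ⟨p, hp, _⟩, _⟩
          exact this _ hp
        rw [this, Set.ncard_empty]
        exact Nat.zero_le _
      | succ d =>
        refine Cod.graph (T := (Fin k → M) × M) (Cod.fib (B := fun y => Big (D' y)) ?_) hsn
        refine (ih _ hbig d).resolve_right ?_
        rintro ⟨ι, h1, p, q, h2, h3⟩
        have hL : Dfn fun r : (Fin (d + 1) → M) × M => ∃ y : Fin k → M, Big (D' y) ∧ (∀ i, y (ι i) = r.1 i) ∧
          D' y r.2 := dfn
        obtain ⟨p', q', h4, h5, c, e, hce, h6⟩ := ibox (d + 1) (fun z x => ∃ y : Fin k → M, Big (D' y) ∧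
          (∀ i, y (ι i) = z i) ∧ D' y x) hL p q h2 (fun z hz => by
            obtain ⟨y, hy, rfl⟩ := h3 z hz
            exact hy.inf.mono fun x hx => ⟨y, hy, fun i => rfl, hx⟩)
        refine hbox ⟨Fin.snoc (α := fun _ => Fin (k + 1)) (fun i => (ι i).castSucc) (Fin.last k), ?_,
          Fin.snoc p' c, Fin.snoc q' e, lt_snoc h4 hce, fun z hz => ?_⟩
        · intro i j
          refine Fin.lastCases ?_ (fun i => ?_) i
          · refine Fin.lastCases ?_ (fun j => ?_) j
            · simp
            · intro h
              simp only [Fin.snoc_last, Fin.snoc_castSucc] at h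
              exact absurd h.symm (Fin.castSucc_ne_last _)
          · refine Fin.lastCases ?_ (fun j => ?_) j
            · intro h
              simp only [Fin.snoc_last, Fin.snoc_castSucc] at h
              exact absurd h (Fin.castSucc_ne_last _)
            · intro h
              simp only [Fin.snoc_castSucc] at h
              rw [h1 (Fin.castSucc_injective _ h)]
        · rw [← snoc_eta z, bx_snoc] at hz
          obtain ⟨y, _, h7, h8⟩ := h6 _ hz.1 _ hz.2.1 hz.2.2
          refine ⟨Fin.snoc y (z (Fin.last _)), (hD' _ _).1 h8, ?_⟩
          ext i
          refine Fin.lastCases ?_ (fun i => ?_) i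
          · simp
          · simp [h7]
    refine hcod ((c1.union c2).mono ?_)
    intro v hv
    rw [← snoc_eta v] at hv ⊢
    generalize (fun i : Fin k => v i.castSucc) = y at *
    generalize v (Fin.last k) = x at *
    rw [← hD'] at hv
    by_cases hy : Big (D' y)
    · exact Or.inr ⟨(y, x), hy, rfl⟩
    · obtain ⟨i, hi⟩ := ha' y x ⟨hy, hv⟩
      exact Or.inl ⟨i, y, ⟨x, hy, hv⟩, by rw [hi]⟩

end

section
open Classical in
noncomputable def cnt {γ : Type*} [Fintype γ] (P : γ → Prop) : ℝ := ∑ x, if P x then 1 else 0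

section
variable {γ δ : Type*} [Fintype γ] [Fintype δ]

theorem cnt_mono {P Q : γ → Prop} (h : ∀ x, P x → Q x) : cnt P ≤ cnt Q := by
  classical
  unfold cnt
  refine Finset.sum_le_sum fun x _ => ?_
  by_cases hp : P x
  · simp [hp, h x hp]
  · by_cases hq : Q x <;> simp [hp, hq]

theorem cnt_nonneg (P : γ → Prop) : 0 ≤ cnt P := by
  classical
  unfold cnt
  exact Finset.sum_nonneg fun x _ => by split_ifs <;> norm_num

theorem cnt_true : cnt (fun _ : γ => True) = Fintype.card γ := by
  simp [cnt]

theorem cnt_eq_ncard (P : γ → Prop) : cnt P = ({x | P x}.ncard : ℝ) := by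
  classical
  unfold cnt
  rw [Finset.sum_boole, Set.ncard_eq_toFinset_card']
  congr 2
  ext x
  simp

theorem cnt_le_card (P : γ → Prop) : cnt P ≤ Fintype.card γ :=
  (cnt_mono (Q := fun _ => True) fun _ _ => trivial).trans cnt_true.le

theorem cnt_or (P Q : γ → Prop) : cnt (fun x => P x ∨ Q x) ≤ cnt P + cnt Q := by
  classical
  unfold cnt
  rw [← Finset.sum_add_distrib]
  refine Finset.sum_le_sum fun x _ => ?_
  by_cases hp : P x <;> by_cases hq : Q x <;> simp [hp, hq]

theorem cnt_ex {ι : Type*} [Fintype ι] (P : ι → γ → Prop) : cnt (fun x => ∃ i, P i x) ≤ ∑ i, cnt (P i) := by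
  classical
  unfold cnt
  rw [Finset.sum_comm]
  refine Finset.sum_le_sum fun x _ => ?_
  by_cases hp : ∃ i, P i x
  · obtain ⟨i, hi⟩ := hp
    have h1 : (if P i x then (1 : ℝ) else 0) ≤ ∑ i, if P i x then (1 : ℝ) else 0 :=
      Finset.single_le_sum (f := fun i => if P i x then (1 : ℝ) else 0)
        (fun i _ => by split_ifs <;> norm_num) (Finset.mem_univ i)
    have h2 : ∃ i, P i x := ⟨i, hi⟩
    simp only [hi, if_true] at h1
    simpa only [h2, if_true] using h1
  · simp only [hp, if_false]
    exact Finset.sum_nonneg fun i _ => by split_ifs <;> norm_num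

theorem cnt_prod (P : γ × δ → Prop) : cnt P = ∑ x, cnt fun y => P (x, y) := by
  classical
  unfold cnt
  rw [Fintype.sum_prod_type]

theorem cnt_equiv (e : γ ≃ δ) (P : δ → Prop) : cnt (fun x => P (e x)) = cnt P := by
  classical
  unfold cnt
  exact Fintype.sum_equiv e _ _ fun x => rfl

end

theorem sum_comp_inj {I A X : Type*} [Fintype I] [Fintype A] [Fintype X] [DecidableEq I] [DecidableEq A] (j : A → I)
    (hj : Function.Injective j) :
    ∃ c : ℝ, 0 ≤ c ∧ ∀ f : (A → X) → ℝ, ∑ τ : I → X, f (fun a => τ (j a)) = c * ∑ σ, f σ := by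
  classical
  let e : (I → X) ≃ (A → X) × ({i // ¬ i ∈ Set.range j} → X) :=
    (Equiv.piEquivPiSubtypeProd (fun i => i ∈ Set.range j) (fun _ => X)).trans
      (Equiv.prodCongr (Equiv.arrowCongr (Equiv.ofInjective j hj).symm (Equiv.refl _)) (Equiv.refl _))
  refine ⟨Fintype.card ({i // ¬ i ∈ Set.range j} → X), by positivity, fun f => ?_⟩
  rw [Fintype.sum_equiv e (fun τ => f (fun a => τ (j a))) (fun p => f p.1) (fun τ => ?_)]
  · rw [Fintype.sum_prod_type_right]
    simp
  · congr 1

theorem cnt_comp_inj {I A X : Type*} [Fintype I] [Fintype A] [Fintype X] [DecidableEq I] [DecidableEq A]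
    (j : A → I) (hj : Function.Injective j) (P : (A → X) → Prop) :
    cnt (fun τ : I → X => P (fun a => τ (j a))) * (Fintype.card X : ℝ) ^ Fintype.card A =
      (Fintype.card X : ℝ) ^ Fintype.card I * cnt P := by
  classical
  obtain ⟨c, _, h⟩ := sum_comp_inj (X := X) j hj
  have h1 := h (fun _ => 1)
  have h2 := h (fun σ => if P σ then 1 else 0)
  simp only [Finset.sum_const, Finset.card_univ, Fintype.card_fun, nsmul_eq_mul, mul_one, Nat.cast_pow] at h1
  unfold cnt
  rw [h2, h1]
  ring

theorem avg {α : Type*} {n m : ℕ} {Good : (Fin n → α) → Prop}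
    (h : ∀ a : Fin m → α, ∃ f : Fin n → Fin m, Function.Injective f ∧ Good (fun i => a (f i)))
    {L : ℕ} (hL : 1 ≤ L) (a : Fin L → α) :
    (L : ℝ) ^ n ≤ (m : ℝ) ^ n * cnt (fun σ : Fin n → Fin L => Good fun i => a (σ i)) := by
  have hLpos : (0 : ℝ) < L := by exact_mod_cast hL
  have h1 : (L : ℝ) ^ m ≤ ∑ f : Fin n → Fin m, cnt (fun τ : Fin m → Fin L =>
      Function.Injective f ∧ Good fun i => a (τ (f i))) := by
    refine le_trans ?_ (cnt_ex _)
    have : (L : ℝ) ^ m = cnt (fun _ : Fin m → Fin L => True) := by rw [cnt_true]; simp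
    rw [this]
    exact cnt_mono fun τ _ => h fun i => a (τ i)
  have h2 : ∀ f : Fin n → Fin m, cnt (fun τ : Fin m → Fin L =>
      Function.Injective f ∧ Good fun i => a (τ (f i))) * (L : ℝ) ^ n ≤
      (L : ℝ) ^ m * cnt (fun σ : Fin n → Fin L => Good fun i => a (σ i)) := by
    intro f
    by_cases hf : Function.Injective f
    · have := cnt_comp_inj (X := Fin L) f hf (fun σ => Good fun i => a (σ i))
      simp only [Fintype.card_fin] at this
      rw [← this]
      exact mul_le_mul_of_nonneg_right (cnt_mono fun τ h => h.2) (by positivity)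
    · have : cnt (fun τ : Fin m → Fin L => Function.Injective f ∧ Good fun i => a (τ (f i))) = 0 := by
        simp [cnt, hf]
      rw [this, zero_mul]
      exact mul_nonneg (by positivity) (cnt_nonneg _)
  have h3 := mul_le_mul_of_nonneg_right h1 (by positivity : (0 : ℝ) ≤ (L : ℝ) ^ n)
  rw [Finset.sum_mul] at h3
  have h4 := h3.trans (Finset.sum_le_sum fun f _ => h2 f)
  simp only [Finset.sum_const, Finset.card_univ, Fintype.card_fun, Fintype.card_fin, nsmul_eq_mul,
    Nat.cast_pow] at h4
  have h5 : (L : ℝ) ^ m * (L : ℝ) ^ n ≤ (L : ℝ) ^ m *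
    ((m : ℝ) ^ n * cnt (fun σ : Fin n → Fin L => Good fun i => a (σ i))) := by linarith
  exact le_of_mul_le_mul_left h5 (by positivity)

/-- fractional Helly -/
theorem frac_helly {α β : Type*} {C : α → β → Prop} {n b : ℕ} {P γ : ℝ} (hn : 1 ≤ n) (hb : 1 ≤ b)
    (hP : ∀ a : Fin n × Fin b → α, ({I : Set (Fin n × Fin b) | ∃ z, I = {i | C (a i) z}}.ncard : ℝ) ≤ P)
    (hPg : P < γ / 2 * b ^ n) (hγ : 0 < γ) {L : ℕ} (hL : 1 ≤ L) (a : Fin L → α)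
    (hgood : γ * (L : ℝ) ^ n ≤ cnt (fun σ : Fin n → Fin L => ∃ z, ∀ j, C (a (σ j)) z)) :
    ∃ z, γ / (2 * (n * b)) * L ≤ cnt (fun l : Fin L => C (a l) z) := by
  by_contra hcon
  push Not at hcon
  have hLpos : (0 : ℝ) < L := by exact_mod_cast hL
  have hnpos : (0 : ℝ) < n := by exact_mod_cast hn
  have hbpos : (0 : ℝ) < b := by exact_mod_cast hb
  set bt : ℝ := γ / (2 * (n * b)) with hbt
  have hex : ∃ z : β, True := by
    by_contra hne
    have : cnt (fun σ : Fin n → Fin L => ∃ z, ∀ j, C (a (σ j)) z) ≤ 0 := by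
      unfold cnt
      refine Finset.sum_nonpos fun σ _ => ?_
      rw [if_neg]
      rintro ⟨z, _⟩
      exact hne ⟨z, trivial⟩
    have h2 : 0 < γ * (L : ℝ) ^ n := by positivity
    linarith
  obtain ⟨z0, _⟩ := hex
  have hW : ∀ σ : Fin n → Fin L, ∃ z, (∃ z, ∀ j, C (a (σ j)) z) → ∀ j, C (a (σ j)) z := by
    intro σ
    by_cases h : ∃ z, ∀ j, C (a (σ j)) z
    · exact ⟨h.choose, fun _ => h.choose_spec⟩
    · exact ⟨z0, fun h' => absurd h' h⟩
  choose W hW using hW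
  let J : (Fin n → Fin b) → Fin n → Fin n × Fin b := fun g i => (i, g i)
  have hJ : ∀ g, Function.Injective (J g) := fun g i i' h => (Prod.ext_iff.1 h).1
  let Gd : (Fin n → Fin L) → Prop := fun σ => ∃ z, ∀ j, C (a (σ j)) z
  -- exact pairs
  let Ex : (Fin n × Fin b → Fin L) → (Fin n → Fin b) → Prop := fun τ g =>
    Gd (fun i => τ (J g i)) ∧ ∀ i, C (a (τ i)) (W fun i => τ (J g i)) → i ∈ Set.range (J g)
  have hEx : ∀ τ, cnt (Ex τ) ≤ P := by
    intro τ
    refine le_trans ?_ (hP fun i => a (τ i))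
    rw [cnt_eq_ncard]
    norm_cast
    refine Set.ncard_le_ncard_of_injOn (fun g => Set.range (J g)) ?_ ?_ (Set.toFinite _)
    · intro g hg
      refine ⟨W fun i => τ (J g i), ?_⟩
      ext i
      constructor
      · rintro ⟨j, rfl⟩
        exact hW _ hg.1 j
      · exact hg.2 i
    · intro g _ g' _ h
      ext i : 1
      have : J g i ∈ Set.range (J g') := by
        have h : Set.range (J g) = Set.range (J g') := h
        rw [← h]; exact ⟨i, rfl⟩
      obtain ⟨i', hi'⟩ := this
      have e := Prod.ext_iff.1 hi'
      have e1 : i' = i := e.1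
      have e2 : g' i' = g i := e.2
      rw [← e2, e1]
  let Bd : (Fin n → Fin b) → Fin n × Fin b → (Fin n × Fin b → Fin L) → Prop := fun g i τ =>
    i ∉ Set.range (J g) ∧ C (a (τ i)) (W fun i => τ (J g i))
  have hBd : ∀ g i, cnt (Bd g i) ≤ bt * (L : ℝ) ^ (n * b) := by
    intro g i
    by_cases hi : i ∈ Set.range (J g)
    · have : cnt (Bd g i) = 0 := by simp [cnt, Bd, hi]
      rw [this]; positivity
    · have hinj : Function.Injective (Sum.elim (J g) (fun _ : Unit => i)) := by
        refine Function.Injective.sumElim (hJ g) (fun _ _ _ => rfl) ?_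
        intro x _ h
        exact hi ⟨x, h⟩
      have h1 := cnt_comp_inj (X := Fin L) _ hinj (fun σ => C (a (σ (Sum.inr ()))) (W fun i => σ (Sum.inl i)))
      have h2 : cnt (fun σ : Fin n ⊕ Unit → Fin L => C (a (σ (Sum.inr ()))) (W fun i => σ (Sum.inl i))) ≤
          (L : ℝ) ^ n * (bt * L) := by
        rw [← cnt_equiv (Equiv.sumArrowEquivProdArrow (Fin n) Unit (Fin L)).symm, cnt_prod]
        have : ∀ σ : Fin n → Fin L, cnt (fun y : Unit → Fin L => C (a (y ())) (W σ)) ≤ bt * L := by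
          intro σ
          rw [← cnt_equiv (Equiv.funUnique Unit (Fin L)).symm]
          exact (hcon (W σ)).le
        refine (Finset.sum_le_sum fun σ _ => this σ).trans ?_
        simp
      simp only [Fintype.card_sum, Fintype.card_fin, Fintype.card_unit, Fintype.card_prod] at h1
      have h3 : cnt (Bd g i) * (L : ℝ) ^ (n + 1) ≤ (bt * (L : ℝ) ^ (n * b)) * (L : ℝ) ^ (n + 1) := by
        calc _ ≤ _ := mul_le_mul_of_nonneg_right (cnt_mono fun τ h => h.2) (by positivity)
          _ = _ := h1
          _ ≤ (L : ℝ) ^ (n * b) * ((L : ℝ) ^ n * (bt * L)) := mul_le_mul_of_nonneg_left h2 (by positivity)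
          _ = _ := by ring
      exact le_of_mul_le_mul_right h3 (by positivity)
  have hG : ∀ g, γ * (L : ℝ) ^ (n * b) ≤ cnt (fun τ : Fin n × Fin b → Fin L => Gd fun i => τ (J g i)) := by
    intro g
    have h1 := cnt_comp_inj (X := Fin L) _ (hJ g) Gd
    simp only [Fintype.card_fin, Fintype.card_prod] at h1
    have h3 : (γ * (L : ℝ) ^ (n * b)) * (L : ℝ) ^ n ≤
        cnt (fun τ : Fin n × Fin b → Fin L => Gd fun i => τ (J g i)) * (L : ℝ) ^ n := by
      rw [h1]
      calc _ = (L : ℝ) ^ (n * b) * (γ * (L : ℝ) ^ n) := by ring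
        _ ≤ _ := mul_le_mul_of_nonneg_left hgood (by positivity)
    exact le_of_mul_le_mul_right h3 (by positivity)
  have hGE : ∀ g, γ / 2 * (L : ℝ) ^ (n * b) ≤ cnt (fun τ => Ex τ g) := by
    intro g
    have h1 : cnt (fun τ : Fin n × Fin b → Fin L => Gd fun i => τ (J g i)) ≤
        cnt (fun τ => Ex τ g) + ∑ i, cnt (Bd g i) := by
      refine le_trans ?_ (add_le_add le_rfl (cnt_ex _))
      refine le_trans (cnt_mono fun τ h => ?_) (cnt_or _ _)
      by_cases h2 : ∃ i, Bd g i τ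
      · exact Or.inr h2
      · exact Or.inl ⟨h, fun i hi => by_contra fun h3 => h2 ⟨i, h3, hi⟩⟩
    have h2 : ∑ i, cnt (Bd g i) ≤ γ / 2 * (L : ℝ) ^ (n * b) := by
      refine (Finset.sum_le_sum fun i _ => hBd g i).trans ?_
      simp only [Finset.sum_const, Finset.card_univ, Fintype.card_prod, Fintype.card_fin, nsmul_eq_mul,
        Nat.cast_mul]
      apply le_of_eq
      rw [hbt]
      field_simp
    have := hG g
    linarith
  have hsum : ∑ g, cnt (fun τ => Ex τ g) = ∑ τ, cnt (Ex τ) := by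
    unfold cnt
    exact Finset.sum_comm
  have e1 : (b : ℝ) ^ n * (γ / 2 * (L : ℝ) ^ (n * b)) ≤ ∑ g, cnt (fun τ => Ex τ g) := by
    refine le_trans ?_ (Finset.sum_le_sum fun g _ => hGE g)
    simp
  have e2 : ∑ τ, cnt (Ex τ) ≤ (L : ℝ) ^ (n * b) * P := by
    refine (Finset.sum_le_sum fun τ _ => hEx τ).trans ?_
    simp
  have e3 : 0 < (L : ℝ) ^ (n * b) := by positivity
  have e4 : (L : ℝ) ^ (n * b) * P < (L : ℝ) ^ (n * b) * (γ / 2 * b ^ n) := mul_lt_mul_of_pos_left hPg e3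
  rw [hsum] at e1
  linarith

end

/-- definable ultrafilters -/
def IsDU {M : Type u} [OM M] {Y : Type u} [Enc M Y] (q : Ultrafilter Y) : Prop :=
  ∀ (U : Type u) [Enc M U] (Q : U → Y → Prop), Dfn (fun p : U × Y => Q p.1 p.2) →
    Dfn fun u => ∀ᶠ y in (q : Filter Y), Q u y

theorem IsDU.dfn {M : Type u} [OM M] {Y : Type u} [Enc M Y] {q : Ultrafilter Y} (hq : IsDU q)
    {U : Type u} [Enc M U] {Q : U → Y → Prop} (h : Dfn (fun p : U × Y => Q p.1 p.2)) :
    Dfn fun u => ∀ᶠ y in (q : Filter Y), Q u y := hq U Q h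

/-- automation for definability goals with definable ultrafilter quantifiers -/
theorem dfn' {P : Prop} (h : P := by
  repeat' (intros; first
    | assumption
    | with_reducible exact DM.id
    | with_reducible apply DM.const
    | with_reducible apply Dfn.const
    | with_reducible apply DM.fst
    | with_reducible apply DM.snd
    | with_reducible apply DM.pair
    | with_reducible refine IsDU.dfn (by assumption) ?_
    | with_reducible apply Dfn.and
    | with_reducible apply Dfn.or
    | with_reducible apply Dfn.not
    | with_reducible apply Dfn.imp
    | with_reducible apply Dfn.iff
    | with_reducible apply Dfn.ex
    | with_reducible apply Dfn.all
    | with_reducible apply Dfn.exFin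
    | with_reducible apply Dfn.allFin
    | with_reducible apply Dfn.lt
    | with_reducible apply Dfn.le
    | with_reducible apply Dfn.eq
    | with_reducible apply Dfn.ne
    | with_reducible refine Dfn.comp3 (by assumption) ?_ ?_ ?_
    | with_reducible refine Dfn.comp2 (by assumption) ?_ ?_
    | with_reducible refine Dfn.comp1 (by assumption) ?_
    | with_reducible refine Dfn.comp1' (by assumption) ?_
    | with_reducible refine DM.comp2 (by assumption) ?_ ?_
    | with_reducible refine DM.comp (by assumption) ?_
    | with_reducible apply DM.lam
    | with_reducible apply DM.app)) : P := h

section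
variable {M : Type u} [OM M]

theorem IsDU.map {Y Y' : Type u} [Enc M Y] [Enc M Y'] {q : Ultrafilter Y} (hq : IsDU q)
    {f : Y → Y'} (hf : DM f) : IsDU (q.map f) := by
  intro U _ Q hQ
  have : Dfn fun u : U => ∀ᶠ y in (q : Filter Y), Q u (f y) := dfn'
  exact this

theorem IsDU.pure {Y : Type u} [Enc M Y] (y : Y) : IsDU (Pure.pure y : Ultrafilter Y) := by
  intro U _ Q hQ
  have : Dfn fun u : U => Q u y := dfn'
  exact this.congr fun u => by simp

/-- separation lemma -/
theorem sepa {Y W : Type u} [Enc M Y] [Enc M W] {ι : Type} [Finite ι]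
    (q : Ultrafilter Y) (hq : IsDU q) (I : W → Y → M → Prop)
    (hI : Dfn fun p : W × Y × M => I p.1 p.2.1 p.2.2) (hc : ∀ w y, Conv (I w y))
    (UU : Ultrafilter W)
    (hU : ∀ q' : Ultrafilter (Y × M), IsDU q' → ∀ᶠ w in (UU : Filter W),
      ¬ ∀ᶠ p in (q' : Filter (Y × M)), I w p.1 p.2)
    (WW : Ultrafilter (ι → W))
    (hW : ∀ A : W → Prop, Dfn A → (∀ᶠ w in (UU : Filter W), A w) → ∀ i,
      ∀ᶠ v in (WW : Filter (ι → W)), A (v i))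
    (Z : (ι → W) → Prop) (hZ : Dfn Z) (hZW : ∀ᶠ v in (WW : Filter (ι → W)), Z v) :
    ∃ v v', Z v ∧ Z v' ∧ ∀ i i', ∀ᶠ y in (q : Filter Y), ∀ x x', I (v i) y x → I (v' i') y x' →
      x < x' := by
  by_contra hno
  simp only [not_exists, not_and, not_forall] at hno
  let H : (ι → W) → Y → M → Prop := fun v y x => ∃ i x', x' ≤ x ∧ I (v i) y x'
  have hH : Dfn fun p : (ι → W) × Y × M => H p.1 p.2.1 p.2.2 := dfn'
  have hup : ∀ v y, Ups (H v y) := by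
    rintro v y x x' hxx ⟨i, z, hz, hi⟩
    exact ⟨i, z, hz.trans hxx, hi⟩
  have hIH : ∀ v i y x, I (v i) y x → H v y x := fun v i y x h => ⟨i, x, le_rfl, h⟩
  have hne : ∀ v, Z v → ∀ᶠ y in (q : Filter Y), ∃ x, H v y x := by
    intro v hv
    by_contra hcon
    rw [← Ultrafilter.eventually_not] at hcon
    obtain ⟨i, i', h⟩ := hno v v hv hv
    exact h (hcon.mono fun y hy x x' hx _ => (hy ⟨x, hIH v i y x hx⟩).elim)
  let LE : (ι → W) → (ι → W) → Prop := fun v v' => ∀ᶠ y in (q : Filter Y), ∀ x, H v y x → H v' y x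
  have hLEd : Dfn fun p : (ι → W) × (ι → W) => LE p.1 p.2 := dfn'
  have hrefl : ∀ v, LE v v := fun v => Filter.Eventually.of_forall fun y x h => h
  have htrans : ∀ v v' v'', LE v v' → LE v' v'' → LE v v'' := by
    intro v v' v'' h1 h2
    filter_upwards [h1, h2] with y h1 h2 x hx using h2 x (h1 x hx)
  have htot : ∀ v v', LE v v' ∨ LE v' v := by
    intro v v'
    rw [← Ultrafilter.eventually_or]
    refine Filter.Eventually.of_forall fun y => ?_
    by_contra hcon
    push Not at hcon
    obtain ⟨⟨x, h1, h2⟩, ⟨x', h3, h4⟩⟩ := hcon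
    rcases le_total x x' with h | h
    · exact h4 (hup v y x x' h h1)
    · exact h2 (hup v' y x' x h h3)
  obtain ⟨z0, hz0⟩ := hZW.exists
  let Dp : Filter (ι → W) :=
    { sets := {Φ | ∃ v0, Z v0 ∧ ∀ v, Z v → LE v v0 → v ∈ Φ}
      univ_sets := ⟨z0, hz0, fun _ _ _ => trivial⟩
      sets_of_superset := by
        rintro A B ⟨v0, h0, h⟩ hAB
        exact ⟨v0, h0, fun v hv hl => hAB (h v hv hl)⟩
      inter_sets := by
        rintro A B ⟨v0, h0, h⟩ ⟨v1, h1, h'⟩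
        rcases htot v0 v1 with hl | hl
        · exact ⟨v0, h0, fun v hv hv0 => ⟨h v hv hv0, h' v hv (htrans _ _ _ hv0 hl)⟩⟩
        · exact ⟨v1, h1, fun v hv hv0 => ⟨h v hv (htrans _ _ _ hv0 hl), h' v hv hv0⟩⟩ }
  have hDp : ∀ Φ : (ι → W) → Prop, (∀ᶠ v in Dp, Φ v) ↔
    ∃ v0, Z v0 ∧ ∀ v, Z v → LE v v0 → Φ v := fun Φ => Iff.rfl
  have hDZ : ∀ᶠ v in Dp, Z v := (hDp _).2 ⟨z0, hz0, fun v hv _ => hv⟩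
  have hDL : ∀ v0, Z v0 → ∀ᶠ v in Dp, LE v v0 := fun v0 h => (hDp _).2 ⟨v0, h, fun v _ hv => hv⟩
  have hDex : ∀ Φ : (ι → W) → Prop, (∀ᶠ v in Dp, Φ v) → ∃ v, Φ v := by
    intro Φ h
    obtain ⟨v0, h0, h⟩ := (hDp _).1 h
    exact ⟨v0, h v0 h0 (hrefl _)⟩
  let F : Filter (Y × M) :=
    { sets := {G | ∀ᶠ v in Dp, ∀ᶠ y in (q : Filter Y), Start (H v y) (fun x => (y, x) ∈ G)}
      univ_sets := by
        filter_upwards [hDZ] with v hv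
        filter_upwards [hne v hv] with y ⟨x, hx⟩
        exact ⟨x, hx, fun _ _ _ => trivial⟩
      sets_of_superset := by
        intro A B h hAB
        rw [Set.mem_ofPred_eq] at h ⊢
        refine Filter.Eventually.mono h fun v h => h.mono fun y h => h.mono fun x _ h => hAB h
      inter_sets := by
        intro A B h1 h2
        rw [Set.mem_ofPred_eq] at h1 h2 ⊢
        refine (Filter.Eventually.and h1 h2).mono fun v h => (h.1.and h.2).mono fun y h => ?_
        exact h.1.and h.2 }
  have hF : ∀ G : Y × M → Prop, (∀ᶠ p in F, G p) ↔
    ∀ᶠ v in Dp, ∀ᶠ y in (q : Filter Y), Start (H v y) (fun x => G (y, x)) := fun G => Iff.rfl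
  have hFne : F.NeBot := by
    rw [← Filter.empty_mem_iff_bot.not.trans Filter.neBot_iff.symm]
    intro h
    obtain ⟨v, hv⟩ := hDex _ h
    obtain ⟨y, hy⟩ := hv.exists
    obtain ⟨x, _, hx⟩ := hy.exists
    exact hx
  have hconv : ∀ D : Y → M → Prop, (Dfn fun p : Y × M => D p.1 p.2) → (∀ y, Conv (D y)) →
      (∀ᶠ p in F, D p.1 p.2) ∨ ∀ᶠ p in F, ¬ D p.1 p.2 := by
    intro D hD hDc
    have hdec : ∀ v, Z v → (∀ᶠ y in (q : Filter Y), Start (H v y) (D y)) ∨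
        ∀ᶠ y in (q : Filter Y), Start (H v y) (fun x => ¬ D y x) := by
      intro v hv
      rw [← Ultrafilter.eventually_or]
      filter_upwards [hne v hv] with y hy
      have : Dfn (D y) := dfn'
      exact start_dec (hup v y) hy this
    by_cases h1 : ∃ v0, Z v0 ∧ ∀ v, Z v → LE v v0 →
      ∀ᶠ y in (q : Filter Y), Start (H v y) (fun x => ¬ D y x)
    · exact Or.inr h1
    · simp only [not_exists, not_and, not_forall] at h1
      left
      rw [hF, hDp]
      obtain ⟨v1, hv1, hl1, h⟩ := h1 z0 hz0
      have hs1 := (hdec v1 hv1).resolve_right h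
      refine ⟨v1, hv1, fun v hv hl => ?_⟩
      obtain ⟨v2, hv2, hl2, h⟩ := h1 v hv
      have hs2 := (hdec v2 hv2).resolve_right h
      filter_upwards [hs1, hs2, hl, hl2] with y ⟨c1, hc1, hs1⟩ ⟨c2, hc2, hs2⟩ hl hl2
      by_cases h1 : H v y c1
      · exact ⟨c1, h1, fun x hx hxc => hs1 x (hl x hx) hxc⟩
      · refine ⟨c2, hl2 _ hc2, fun x hx hxc => ?_⟩
        have : c1 ≤ x := by
          by_contra hcon
          exact h1 (hup v y x c1 (not_le.1 hcon).le hx)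
        exact hDc y c1 x c2 this hxc (hs1 c1 hc1 le_rfl) (hs2 c2 hc2 le_rfl)
  have hcomp : ∀ G : Y → M → Prop, (Dfn fun p : Y × M => G p.1 p.2) →
      (∀ᶠ p in F, G p.1 p.2) ∨ ∀ᶠ p in F, ¬ G p.1 p.2 := by
    intro G hG
    obtain ⟨J, _, D, hD, hDc, hGD⟩ := pieces hG
    by_cases h : ∃ j, ∀ᶠ p in F, D j p.1 p.2
    · obtain ⟨j, hj⟩ := h
      exact Or.inl (hj.mono fun p hp => (hGD _ _).2 ⟨j, hp⟩)
    · rw [not_exists] at h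
      right
      have : ∀ j, ∀ᶠ p in F, ¬ D j p.1 p.2 := fun j =>
        (hconv (D j) (hD j) (hDc j)).resolve_left (h j)
      filter_upwards [Filter.eventually_all.2 this] with p hp hg
      obtain ⟨j, hj⟩ := (hGD _ _).1 hg
      exact hp j hj
  let q' : Ultrafilter (Y × M) := Ultrafilter.of F
  have hq'F : (q' : Filter (Y × M)) ≤ F := Ultrafilter.of_le F
  have hiff : ∀ G : Y → M → Prop, (Dfn fun p : Y × M => G p.1 p.2) →
      ((∀ᶠ p in (q' : Filter (Y × M)), G p.1 p.2) ↔ ∀ᶠ p in F, G p.1 p.2) := by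
    intro G hG
    refine ⟨fun h => ?_, fun h => hq'F h⟩
    refine (hcomp G hG).resolve_right fun h2 => ?_
    obtain ⟨p, hp⟩ := (h.and (hq'F h2)).exists
    exact hp.2 hp.1
  have hq' : IsDU q' := by
    intro U _ Q hQ
    have : Dfn fun u : U => ∃ v0, Z v0 ∧ ∀ v, Z v → LE v v0 → ∀ᶠ y in (q : Filter Y),
      Start (H v y) (fun x => Q u (y, x)) := dfn'
    refine this.congr fun u => ?_
    have hQu : Dfn fun p : Y × M => Q u (p.1, p.2) := dfn'
    exact (hiff (fun y x => Q u (y, x)) hQu).symm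
  have hA := hU q' hq'
  have hAd : Dfn fun w => ¬ ∀ᶠ p in (q' : Filter (Y × M)), I w p.1 p.2 := dfn'
  let Ab : W → Prop := fun w => ∃ v0, Z v0 ∧ ∀ᶠ y in (q : Filter Y),
    ∀ x x', I w y x → H v0 y x' → x < x'
  have hAb : Dfn Ab := dfn'
  by_cases hcase : ∀ᶠ w in (UU : Filter W), Ab w
  · have h1 := Filter.eventually_all.2 (hW Ab hAb hcase)
    obtain ⟨v, hv, hvZ⟩ := (h1.and hZW).exists
    choose v0 hv0 hv0s using hv
    have h2 := Filter.eventually_all.2 fun i => hDL (v0 i) (hv0 i)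
    obtain ⟨v', hv', hv'Z⟩ := hDex _ (h2.and hDZ)
    obtain ⟨i, i', h⟩ := hno v v' hvZ hv'Z
    apply h
    filter_upwards [hv0s i, hv' i] with y hy hy' x x' hx hx'
    exact hy x x' hx (hy' _ (hIH _ _ _ _ hx'))
  · rw [← Ultrafilter.eventually_not] at hcase
    have h1 := Filter.eventually_all.2 (hW _ (hAd.and hAb.not) (hA.and hcase))
    obtain ⟨v, hv, hvZ⟩ := (h1.and hZW).exists
    have h2 : ∀ i, ∀ᶠ v' in Dp, ∀ᶠ y in (q : Filter Y), Start (H v' y) fun x => ¬ I (v i) y x := by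
      intro i
      have hId : Dfn fun p : Y × M => I (v i) p.1 p.2 := dfn'
      have := (hv i).1
      rw [hiff _ hId] at this
      exact (hcomp _ hId).resolve_left this
    obtain ⟨v', ⟨h3, hv'Z⟩, hl⟩ := hDex _ (((Filter.eventually_all.2 h2).and hDZ).and (hDL v hvZ))
    have h4 : ∀ i, ∀ᶠ y in (q : Filter Y), ∃ x x', I (v i) y x ∧ H v' y x' ∧ x' ≤ x := by
      intro i
      have := (hv i).2
      by_contra hcon
      rw [← Ultrafilter.eventually_not] at hcon
      apply this
      refine ⟨v', hv'Z, hcon.mono fun y hy x x' hx hx' => ?_⟩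
      by_contra hle
      exact hy ⟨x, x', hx, hx', not_lt.1 hle⟩
    obtain ⟨y, ⟨⟨⟨h3, h4⟩, hl⟩, ⟨x0, hx0⟩⟩⟩ := ((((Filter.eventually_all.2 h3).and
      (Filter.eventually_all.2 h4)).and hl).and (hne v' hv'Z)).exists
    choose c hcH hcI using h3
    have hlt : ∀ i z, I (v i) y z → c i < z := by
      intro i z hz
      by_contra hle
      obtain ⟨x, x', hx, hx', hxx⟩ := h4 i
      have hxH : H v' y x := hup _ _ _ _ hxx hx'
      have : c i < x := by
        by_contra hh
        exact hcI i x hxH (not_lt.1 hh) hx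
      exact hcI i (c i) (hcH i) le_rfl (hc _ _ z (c i) x (not_lt.1 hle) this.le hz hx)
    obtain ⟨i1, _⟩ := hl x0 hx0
    have : Nonempty ι := ⟨i1⟩
    obtain ⟨i0, hi0⟩ := Finite.exists_min c
    obtain ⟨i, x', hx', hi⟩ := hl (c i0) (hcH i0)
    exact absurd (hlt i x' hi) (not_lt.2 (hx'.trans (hi0 i)))

end

section
variable {M : Type u} [OM M]

theorem Dfn.cntle {T : Type u} [Enc M T] {ι : Type} [Fintype ι] {P : T → ι → Prop}
    (hP : ∀ i, Dfn fun t => P t i) (c : ℝ) : Dfn fun t => cnt (P t) ≤ c := by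
  have : Dfn fun t => ∃ S : Set ι, (∀ i, (P t i ↔ i ∈ S)) ∧ cnt (fun i => i ∈ S) ≤ c := by
    refine Dfn.exFin fun S => Dfn.and (Dfn.allFin fun i => ?_) (Dfn.const _)
    exact (hP i).iff (Dfn.const _)
  refine this.congr fun t => ⟨?_, fun h => ⟨{i | P t i}, fun i => Iff.rfl, h⟩⟩
  rintro ⟨S, hS, h⟩
  have : P t = fun i => i ∈ S := funext fun i => propext (hS i)
  rw [this]; exact h

/-- compatibility of an ultrafilter on tuples with `UU` -/
def Cpl {W : Type u} [Enc M W] {ι : Type} (UU : Ultrafilter W) (WW : Ultrafilter (ι → W)) : Prop :=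
  ∀ A : W → Prop, Dfn A → (∀ᶠ w in (UU : Filter W), A w) → ∀ i,
      ∀ᶠ v in (WW : Filter (ι → W)), A (v i)

theorem double {Y W : Type u} [Enc M Y] [Enc M W] {ι : Type} [Finite ι]
    (q : Ultrafilter Y) (hq : IsDU q) (I : W → Y → M → Prop)
    (hI : Dfn fun p : W × Y × M => I p.1 p.2.1 p.2.2) (hc : ∀ w y, Conv (I w y))
    (UU : Ultrafilter W)
    (hU : ∀ q' : Ultrafilter (Y × M), IsDU q' → ∀ᶠ w in (UU : Filter W),
      ¬ ∀ᶠ p in (q' : Filter (Y × M)), I w p.1 p.2)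
    (WW : Ultrafilter (ι → W)) (hW : Cpl UU WW) :
    ∃ WW' : Ultrafilter (ι × Bool → W),
      (∀ Z : (ι → W) → Prop, Dfn Z → (∀ᶠ v in (WW : Filter (ι → W)), Z v) →
        ∀ b, ∀ᶠ v in (WW' : Filter (ι × Bool → W)), Z fun i => v (i, b)) ∧
      ∀ᶠ v in (WW' : Filter (ι × Bool → W)), ∀ i i', ∀ᶠ y in (q : Filter Y), ∀ x x',
        I (v (i, false)) y x → I (v (i', true)) y x' → x < x' := by
  let Sep : (ι × Bool → W) → Prop := fun v => ∀ i i', ∀ᶠ y in (q : Filter Y), ∀ x x',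
        I (v (i, false)) y x → I (v (i', true)) y x' → x < x'
  let F : Filter (ι × Bool → W) :=
    { sets := {G | ∃ Z : (ι → W) → Prop, Dfn Z ∧ (∀ᶠ v in (WW : Filter (ι → W)), Z v) ∧
        ∀ v : ι × Bool → W, (∀ b, Z fun i => v (i, b)) → Sep v → v ∈ G}
      univ_sets := ⟨fun _ => True, Dfn.tru, by simp, fun _ _ _ => trivial⟩
      sets_of_superset := by
        rintro A B ⟨Z, h1, h2, h3⟩ hAB
        exact ⟨Z, h1, h2, fun v h h' => hAB (h3 v h h')⟩
      inter_sets := by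
        rintro A B ⟨Z, h1, h2, h3⟩ ⟨Z', h1', h2', h3'⟩
        exact ⟨fun v => Z v ∧ Z' v, h1.and h1', h2.and h2', fun v h h' =>
          ⟨h3 v (fun b => (h b).1) h', h3' v (fun b => (h b).2) h'⟩⟩ }
  have hne : F.NeBot := by
    rw [← Filter.empty_mem_iff_bot.not.trans Filter.neBot_iff.symm]
    rintro ⟨Z, hZ, hZW, h⟩
    obtain ⟨v, v', hv, hv', hs⟩ := sepa q hq I hI hc UU hU WW hW Z hZ hZW
    refine h (fun p => if p.2 then v' p.1 else v p.1) ?_ ?_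
    · rintro (b | b)
      · simpa using hv
      · simpa using hv'
    · intro i i'
      simpa using hs i i'
  refine ⟨Ultrafilter.of F, fun Z hZ hZW b => ?_, ?_⟩
  · apply Ultrafilter.of_le F
    exact ⟨Z, hZ, hZW, fun v h _ => h b⟩
  · apply Ultrafilter.of_le F
    exact ⟨fun _ => True, Dfn.tru, by simp, fun v _ h => h⟩

theorem cnt_bool {ι : Type} [Fintype ι] (P : ι × Bool → Prop) :
    cnt P = cnt (fun i => P (i, false)) + cnt fun i => P (i, true) := by
  rw [cnt_prod]
  simp only [cnt, Fintype.sum_bool]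
  rw [Finset.sum_add_distrib, add_comm]

theorem tracks {Y W : Type u} [Enc M Y] [Enc M W] {K : Type} [Fintype K] [DecidableEq K]
    (q : K → Ultrafilter Y) (hq : ∀ κ, IsDU (q κ)) (I : K → W → Y → M → Prop)
    (hI : ∀ κ, Dfn fun p : W × Y × M => I κ p.1 p.2.1 p.2.2) (hc : ∀ κ w y, Conv (I κ w y))
    (UU : Ultrafilter W)
    (hU : ∀ κ, ∀ q' : Ultrafilter (Y × M), IsDU q' → ∀ᶠ w in (UU : Filter W),
      ¬ ∀ᶠ p in (q' : Filter (Y × M)), I κ w p.1 p.2) (m : Multiset K) :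
    ∃ (ι : Type) (_ : Fintype ι) (_ : Nonempty ι) (WW : Ultrafilter (ι → W)), Cpl UU WW ∧
      ∀ κ, ∀ᶠ v in (WW : Filter (ι → W)), ∀ᶠ y in (q κ : Filter Y), ∀ x,
        cnt (fun i => I κ (v i) y x) ≤ (1/2) ^ (m.count κ) * Fintype.card ι := by
  induction m using Multiset.induction_on with
  | empty =>
    refine ⟨Unit, inferInstance, inferInstance, UU.map fun w _ => w, ?_, ?_⟩
    · intro A hA h i
      exact h
    · intro κ
      refine Filter.Eventually.of_forall fun v => Filter.Eventually.of_forall fun y x => ?_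
      simpa using cnt_le_card (fun i : Unit => I κ (v i) y x)
  | cons κ₀ m ih =>
    obtain ⟨ι, _, _, WW, hW, hb⟩ := ih
    obtain ⟨WW', h1, h2⟩ := double (q κ₀) (hq κ₀) (I κ₀) (hI κ₀) (hc κ₀) UU (hU κ₀) WW hW
    refine ⟨ι × Bool, inferInstance, inferInstance, WW', ?_, ?_⟩
    · rintro A hA h ⟨i, b⟩
      refine h1 (fun v => A (v i)) ?_ (hW A hA h i) b
      exact hA.comp (DM.apply0 i)
    · intro κ
      have hd : Dfn fun v : ι → W => ∀ᶠ y in (q κ : Filter Y), ∀ x,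
          cnt (fun i => I κ (v i) y x) ≤ (1/2) ^ (m.count κ) * Fintype.card ι := by
        have := hq κ
        have hIκ := hI κ
        refine IsDU.dfn this (Dfn.all (Dfn.cntle (fun i => ?_) _))
        exact dfn
      have h3 := Filter.eventually_all.2 (h1 _ hd (hb κ))
      filter_upwards [h3, h2] with v h3 h2
      have hcard : (Fintype.card (ι × Bool) : ℝ) = 2 * Fintype.card ι := by
        simp; ring
      rw [hcard]
      by_cases hκ : κ = κ₀
      · subst hκ
        have h4 := Filter.eventually_all.2 fun i => Filter.eventually_all.2 fun i' => h2 i i'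
        filter_upwards [h3 true, h3 false, h4] with y ht hf h4 x
        rw [cnt_bool, Multiset.count_cons_self, pow_succ]
        have hz : cnt (fun i => I κ (v (i, false)) y x) = 0 ∨ cnt (fun i => I κ (v (i, true)) y x) = 0 := by
          by_contra hcon
          rw [not_or] at hcon
          have hex : ∀ b, cnt (fun i => I κ (v (i, b)) y x) ≠ 0 → ∃ i, I κ (v (i, b)) y x := by
            intro b hb
            by_contra hn
            rw [not_exists] at hn
            exact hb (by simp [cnt, hn])
          obtain ⟨i, hi⟩ := hex _ hcon.1
          obtain ⟨i', hi'⟩ := hex _ hcon.2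
          exact lt_irrefl _ (h4 i i' x x hi hi')
        have h5 := ht x
        have h6 := hf x
        rcases hz with hz | hz <;> rw [hz] <;> nlinarith
      · filter_upwards [h3 true, h3 false] with y ht hf x
        rw [cnt_bool, Multiset.count_cons_of_ne hκ]
        have h5 := ht x
        have h6 := hf x
        linarith

/-- Theorem 1 : an unpierceable family is ε-thin over finitely many definable ultrafilters -/
theorem thin {Y W : Type u} [Enc M Y] [Enc M W] {K : Type} [Fintype K]
    (q : K → Ultrafilter Y) (hq : ∀ κ, IsDU (q κ)) (B : W → Y → M → Prop)
    (hB : Dfn fun p : W × Y × M => B p.1 p.2.1 p.2.2)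
    (hun : ∀ Q : Set (Ultrafilter (Y × M)), Q.Finite → (∀ q' ∈ Q, IsDU q') →
      ∃ w, ∀ q' ∈ Q, ¬ ∀ᶠ p in (q' : Filter (Y × M)), B w p.1 p.2)
    (ε : ℝ) (hε : 0 < ε) :
    ∃ L : ℕ, 1 ≤ L ∧ ∃ w : Fin L → W, ∀ κ, ∀ᶠ y in (q κ : Filter Y), ∀ x,
      cnt (fun j => B (w j) y x) ≤ ε * L := by
  classical
  let F : Filter W :=
    { sets := {G | ∃ Q : Set (Ultrafilter (Y × M)), Q.Finite ∧ (∀ q' ∈ Q, IsDU q') ∧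
        ∀ w, (∀ q' ∈ Q, ¬ ∀ᶠ p in (q' : Filter (Y × M)), B w p.1 p.2) → w ∈ G}
      univ_sets := ⟨∅, by simp, by simp, fun _ _ => trivial⟩
      sets_of_superset := by
        rintro A B ⟨Z, h1, h2, h3⟩ hAB
        exact ⟨Z, h1, h2, fun v h => hAB (h3 v h)⟩
      inter_sets := by
        rintro A B ⟨Z, h1, h2, h3⟩ ⟨Z', h1', h2', h3'⟩
        refine ⟨Z ∪ Z', h1.union h1', ?_, ?_⟩
        · rintro q' (h | h)
          exacts [h2 _ h, h2' _ h]
        · intro w h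
          exact ⟨h3 _ fun q' hq' => h _ (Or.inl hq'), h3' _ fun q' hq' => h _ (Or.inr hq')⟩ }
  have hne : F.NeBot := by
    rw [← Filter.empty_mem_iff_bot.not.trans Filter.neBot_iff.symm]
    rintro ⟨Q, h1, h2, h3⟩
    obtain ⟨w, hw⟩ := hun Q h1 h2
    exact h3 w hw
  have hG : Dfn fun p : (W × Y) × M => B p.1.1 p.1.2 p.2 := dfn
  obtain ⟨J, _, D, hD, hDc, hGD⟩ := pieces (G := fun (t : W × Y) x => B t.1 t.2 x) hG
  obtain ⟨s, hs⟩ := exists_pow_lt_of_lt_one (show 0 < ε / (Fintype.card J + 1) by positivity)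
    (show (1/2 : ℝ) < 1 by norm_num)
  obtain ⟨ι, _, _, WW, _, h⟩ := tracks (K := K × J) (fun κ => q κ.1) (fun κ => hq κ.1)
    (fun κ w y x => D κ.2 (w, y) x) (fun κ => by have := hD κ.2; exact dfn)
    (fun κ w y => hDc κ.2 (w, y)) (Ultrafilter.of F) (by
      intro κ q' hq'
      apply Ultrafilter.of_le F
      refine ⟨{q'}, by simp, by simpa using hq', fun w hw hw' => ?_⟩
      refine hw q' rfl (hw'.mono fun p hp => ?_)
      exact (hGD (w, p.1) p.2).2 ⟨κ.2, hp⟩) (s • Finset.univ.val)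
  obtain ⟨v, hv⟩ := (Filter.eventually_all.2 h).exists
  refine ⟨Fintype.card ι, Fintype.card_pos, fun j => v ((Fintype.equivFin ι).symm j), fun κ => ?_⟩
  have hv' : ∀ᶠ y in (q κ : Filter Y), ∀ j x, cnt (fun i => D j (v i, y) x) ≤
      (1/2) ^ (Multiset.count (κ, j) (s • Finset.univ.val)) * Fintype.card ι :=
    Filter.eventually_all.2 fun j => hv (κ, j)
  refine hv'.mono fun y hy x => ?_
  rw [cnt_equiv (Fintype.equivFin ι).symm (fun i => B (v i) y x)]
  calc cnt (fun i => B (v i) y x) ≤ cnt (fun i => ∃ j, D j (v i, y) x) :=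
        cnt_mono fun i hi => (hGD (v i, y) x).1 hi
    _ ≤ ∑ j, cnt (fun i => D j (v i, y) x) := cnt_ex _
    _ ≤ ∑ j : J, (1/2) ^ s * (Fintype.card ι : ℝ) := by
        refine Finset.sum_le_sum fun j _ => ?_
        have := hy j x
        rw [Multiset.count_nsmul, Multiset.count_univ, mul_one] at this
        exact this
    _ = (Fintype.card J * (1/2) ^ s) * (Fintype.card ι : ℝ) := by
        simp [Finset.sum_const]; ring
    _ ≤ ε * Fintype.card ι := by
        gcongr
        rw [lt_div_iff₀ (by positivity)] at hs
        have : (0:ℝ) ≤ (1/2)^s := by positivity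
        nlinarith

end

section
variable {M : Type u} [OM M]

theorem ultra_ex {α : Type*} {ι : Type*} [Finite ι] (q : Ultrafilter α) {P : ι → α → Prop}
    (h : ∀ᶠ a in (q : Filter α), ∃ i, P i a) : ∃ i, ∀ᶠ a in (q : Filter α), P i a := by
  by_contra hcon
  rw [not_exists] at hcon
  have : ∀ i, ∀ᶠ a in (q : Filter α), ¬ P i a := fun i => Ultrafilter.eventually_not.2 (hcon i)
  obtain ⟨a, ⟨i, hi⟩, hn⟩ := (h.and (Filter.eventually_all.2 this)).exists
  exact hn i hi

/-- trace bound -/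
def TrB {Ω Y Z : Type*} (n : ℕ) (C : Ω → Y → Z → Prop) : Prop :=
  ∀ γ : ℝ, 0 < γ → ∃ b : ℕ, 1 ≤ b ∧ ∃ P : ℝ, P < γ / 2 * b ^ n ∧ ∀ a : Fin n × Fin b → Ω,
    ({I : Set (Fin n × Fin b) | ∃ y z, I = {i | C (a i) y z}}.ncard : ℝ) ≤ P

/-- relative (m,n)-property -/
def MNp {Ω Y Z K : Type*} (n m : ℕ) (q : K → Ultrafilter Y) (C : Ω → Y → Z → Prop) : Prop :=
  ∀ u : Fin m → Ω, ∃ f : Fin n → Fin m, Function.Injective f ∧ ∃ κ,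
    ∀ᶠ y in (q κ : Filter Y), ∃ z, ∀ j, C (u (f j)) y z

theorem rich {Ω Y Z K : Type*} [Fintype K] {n m : ℕ} (hn : 1 ≤ n) (q : K → Ultrafilter Y)
    (C : Ω → Y → Z → Prop) (hT : TrB n C) (h : MNp n m q C) :
    ∃ δ : ℝ, 0 < δ ∧ ∀ L : ℕ, 1 ≤ L → ∀ u : Fin L → Ω, ∃ κ, ∀ᶠ y in (q κ : Filter Y), ∃ z,
      δ * L ≤ cnt fun l => C (u l) y z := by
  set γ : ℝ := 1 / ((m + 1) ^ n * (Fintype.card K + 1)) with hγd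
  have hγ : 0 < γ := by positivity
  obtain ⟨b, hb, P, hP, hPa⟩ := hT γ hγ
  refine ⟨γ / (2 * (n * b)), by positivity, fun L hL u => ?_⟩
  have h1 := avg (Good := fun v => ∃ κ, ∀ᶠ y in (q κ : Filter Y), ∃ z, ∀ j, C (v j) y z) h hL u
  have h2 : ∃ κ, γ * (L : ℝ) ^ n ≤ cnt (fun σ : Fin n → Fin L => ∀ᶠ y in (q κ : Filter Y),
      ∃ z, ∀ j, C (u (σ j)) y z) := by
    by_contra hcon
    simp only [not_exists, not_le] at hcon
    have h3 := cnt_ex (fun (κ : K) (σ : Fin n → Fin L) => ∀ᶠ y in (q κ : Filter Y),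
      ∃ z, ∀ j, C (u (σ j)) y z)
    have h4 : ∑ κ : K, cnt (fun σ : Fin n → Fin L => ∀ᶠ y in (q κ : Filter Y),
      ∃ z, ∀ j, C (u (σ j)) y z) ≤ ∑ κ : K, γ * (L : ℝ) ^ n :=
      Finset.sum_le_sum fun κ _ => (hcon κ).le
    rw [Finset.sum_const, Finset.card_univ, nsmul_eq_mul] at h4
    have hLp : (0 : ℝ) < (L : ℝ) ^ n := by positivity
    have h5 : (L : ℝ) ^ n ≤ (m : ℝ) ^ n * (Fintype.card K * (γ * L ^ n)) :=
      h1.trans (by gcongr; exact h3.trans h4)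
    have h6 : (m : ℝ) ^ n * (Fintype.card K * γ) < 1 := by
      rw [hγd, mul_one_div, mul_div_assoc', div_lt_one (by positivity)]
      have : (m : ℝ) ^ n ≤ (m + 1) ^ n := by gcongr; linarith
      have h0 : (0 : ℝ) < (m + 1) ^ n := by positivity
      have : (m : ℝ) ^ n * Fintype.card K ≤ (m + 1) ^ n * Fintype.card K := by gcongr
      nlinarith
    nlinarith
  obtain ⟨κ, hκ⟩ := h2
  refine ⟨κ, ?_⟩
  have h3 : ∀ σ : Fin n → Fin L, ∀ᶠ y in (q κ : Filter Y),
      (∀ᶠ y in (q κ : Filter Y), ∃ z, ∀ j, C (u (σ j)) y z) → ∃ z, ∀ j, C (u (σ j)) y z := by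
    intro σ
    by_cases hs : ∀ᶠ y in (q κ : Filter Y), ∃ z, ∀ j, C (u (σ j)) y z
    · exact hs.mono fun y hy _ => hy
    · exact Filter.Eventually.of_forall fun y hy => (hs hy).elim
  refine (Filter.eventually_all.2 h3).mono fun y hy => ?_
  refine frac_helly (C := fun w z => C w y z) hn hb (fun a => ?_) hP hγ hL u
    (hκ.trans (cnt_mono hy))
  refine le_trans ?_ (hPa a)
  norm_cast
  refine Set.ncard_le_ncard ?_ (Set.toFinite _)
  rintro I ⟨z, rfl⟩
  exact ⟨y, z, rfl⟩

theorem mnstep {Ω Y : Type u} {K : Type} [Fintype K] [Enc M Ω] [Enc M Y] {n r : ℕ}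
    (q : K → Ultrafilter Y) (hq : ∀ κ, IsDU (q κ))
    (C : Ω → Y → (Fin (r+1) → M) → Prop)
    (hC : Dfn fun p : Ω × Y × (Fin (r+1) → M) => C p.1 p.2.1 p.2.2)
    (δ : ℝ) (hδ : 0 < δ)
    (hR : ∀ L : ℕ, 1 ≤ L → ∀ u : Fin L → Ω, ∃ κ, ∀ᶠ y in (q κ : Filter Y), ∃ z,
      δ * L ≤ cnt fun l => C (u l) y z) :
    ∃ (m N : ℕ) (q' : Fin N → Ultrafilter (Y × M)), (∀ i, IsDU (q' i)) ∧
      MNp n m q' (fun w (p : Y × M) (z : Fin r → M) => C w p.1 (Fin.snoc z p.2)) := by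
  classical
  obtain ⟨m, hm⟩ := exists_nat_gt (2 * n / δ)
  by_contra hcon
  let B : (Fin m → Ω) → Y → M → Prop := fun u y x =>
    ∃ f : Fin n → Fin m, Function.Injective f ∧ ∃ z : Fin r → M, ∀ j, C (u (f j)) y (Fin.snoc z x)
  have hsn : DM fun p : (Fin r → M) × M => (Fin.snoc p.1 p.2 : Fin (r+1) → M) := DM.snoc
  have hB : Dfn fun p : (Fin m → Ω) × Y × M => B p.1 p.2.1 p.2.2 := dfn'
  obtain ⟨L, hL, w, hw⟩ := thin q hq B hB (by
    intro Q hQ hQd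
    by_contra hn
    simp only [not_exists, not_forall, not_not] at hn
    obtain ⟨N, q', _, rfl⟩ := hQ.fin_param
    refine hcon ⟨m, N, q', fun i => hQd _ ⟨i, rfl⟩, fun u => ?_⟩
    obtain ⟨_, ⟨i, rfl⟩, hi⟩ := hn u
    obtain ⟨f, hf⟩ := ultra_ex _ hi
    obtain ⟨p, hp⟩ := hf.exists
    exact ⟨f, hp.1, i, hf.mono fun p hp => hp.2⟩) (δ / 2) (by positivity)
  have hm0 : 0 < m := by
    have : (0 : ℝ) ≤ 2 * n / δ := by positivity
    have := lt_of_le_of_lt this hm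
    exact_mod_cast this
  obtain ⟨κ, hκ⟩ := hR (L * m) (Nat.mul_pos hL hm0)
    fun l => w (finProdFinEquiv.symm l).1 (finProdFinEquiv.symm l).2
  obtain ⟨y, ⟨z, hz⟩, hy⟩ := (hκ.and (hw κ)).exists
  rw [cnt_equiv finProdFinEquiv.symm (fun p : Fin L × Fin m => C (w p.1 p.2) y z), cnt_prod] at hz
  have hsz : (Fin.snoc (Fin.init z) (z (Fin.last r)) : Fin (r+1) → M) = z := Fin.snoc_init_self z
  have h1 : ∀ j : Fin L, cnt (fun i => C (w j i) y z) ≤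
      n + m * (if B (w j) y (z (Fin.last r)) then 1 else 0) := by
    intro j
    by_cases hb : B (w j) y (z (Fin.last r))
    · rw [if_pos hb]
      have := cnt_le_card (fun i => C (w j i) y z)
      rw [Fintype.card_fin] at this
      have : (0 : ℝ) ≤ n := by positivity
      linarith
    · rw [if_neg hb, mul_zero, add_zero]
      by_contra hlt
      rw [not_le, cnt_eq_ncard] at hlt
      apply hb
      have hlt' : n ≤ {i | C (w j i) y z}.ncard := by exact_mod_cast hlt.le
      obtain ⟨t, ht, htc⟩ := Set.exists_subset_card_eq hlt'
      have : Fintype.card t = n := by rw [← htc, Set.ncard_eq_toFinset_card']; simp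
      let e := (Fintype.equivFinOfCardEq this).symm
      refine ⟨fun i => (e i : Fin m), Subtype.val_injective.comp e.injective, Fin.init z, fun i => ?_⟩
      rw [hsz]
      exact ht (e i).2
  have h2 : ∑ j, cnt (fun i => C (w j i) y z) ≤ n * L + m * (δ / 2 * L) := by
    refine (Finset.sum_le_sum fun j _ => h1 j).trans ?_
    rw [Finset.sum_add_distrib, ← Finset.mul_sum, Finset.sum_const, Finset.card_univ,
      Fintype.card_fin, nsmul_eq_mul, mul_comm (L : ℝ)]
    gcongr
    have := hy (z (Fin.last r))
    unfold cnt at this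
    refine le_trans (le_of_eq ?_) this
    refine Finset.sum_congr rfl fun j _ => ?_
    by_cases hb : B (w j) y (z (Fin.last r)) <;> simp [hb]
  have hLr : (1 : ℝ) ≤ L := by exact_mod_cast hL
  rw [div_lt_iff₀ hδ] at hm
  push_cast at hz
  nlinarith

theorem pierce {n : ℕ} (hn : 1 ≤ n) (r : ℕ) : ∀ {Ω Y : Type u} {K : Type} [Fintype K] [Enc M Ω]
    [Enc M Y] {m : ℕ} (q : K → Ultrafilter Y) (hq : ∀ κ, IsDU (q κ))
    (C : Ω → Y → (Fin r → M) → Prop)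
    (hC : Dfn fun p : Ω × Y × (Fin r → M) => C p.1 p.2.1 p.2.2)
    (hT : TrB n C) (h : MNp n m q C),
    ∃ (N : ℕ) (q' : Fin N → Ultrafilter (Y × (Fin r → M))), (∀ i, IsDU (q' i)) ∧
      ∀ u, ∃ i, ∀ᶠ p in (q' i : Filter (Y × (Fin r → M))), C u p.1 p.2 := by
  induction r with
  | zero =>
    intro Ω Y K _ _ _ m q hq C hC hT h
    obtain ⟨δ, hδ, hR⟩ := rich hn q C hT h
    let g : Y → Y × (Fin 0 → M) := fun y => (y, fun i => i.elim0)
    have hg : DM g := DM.pair DM.id (DM.const _)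
    refine ⟨Fintype.card K, fun i => (q ((Fintype.equivFin K).symm i)).map g,
      fun i => (hq _).map hg, fun u => ?_⟩
    obtain ⟨κ, hκ⟩ := hR 1 le_rfl fun _ => u
    refine ⟨Fintype.equivFin K κ, ?_⟩
    rw [Ultrafilter.coe_map, Filter.eventually_map, Equiv.symm_apply_apply]
    refine hκ.mono fun y ⟨z, hz⟩ => ?_
    by_contra hno
    have hz' : z = fun i => i.elim0 := Subsingleton.elim _ _
    rw [hz'] at hz
    have : cnt (fun _ : Fin 1 => C u y (fun i => i.elim0)) = 0 := by
      have hno' : ¬ C u y (fun i => i.elim0) := hno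
      simp [cnt, hno']
    rw [this] at hz
    norm_num at hz
    linarith
  | succ r ih =>
    intro Ω Y K _ _ _ m q hq C hC hT h
    obtain ⟨δ, hδ, hR⟩ := rich hn q C hT h
    obtain ⟨m', N', q', hq', hMN⟩ := mnstep (n := n) q hq C hC δ hδ hR
    have hsn : DM fun p : (Fin r → M) × M => (Fin.snoc p.1 p.2 : Fin (r+1) → M) := DM.snoc
    obtain ⟨N, q'', hq'', hfin⟩ := ih q' hq' _ (by exact dfn) (by
      intro γ hγ
      obtain ⟨b, hb, P, hP, hPa⟩ := hT γ hγ
      refine ⟨b, hb, P, hP, fun a => le_trans ?_ (hPa a)⟩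
      norm_cast
      refine Set.ncard_le_ncard ?_ (Set.toFinite _)
      rintro I ⟨y, z, rfl⟩
      exact ⟨y.1, Fin.snoc z y.2, rfl⟩) hMN
    let g : (Y × M) × (Fin r → M) → Y × (Fin (r+1) → M) := fun p => (p.1.1, Fin.snoc p.2 p.1.2)
    have hg : DM g := dfn
    exact ⟨N, fun i => (q'' i).map g, fun i => (hq'' i).map hg, fun u => hfin u⟩

end

section
variable {M : Type u} [OM M]

/-- local definable directed bases -/
def LDat {Y : Type u} [Enc M Y] (q : Ultrafilter Y) : Prop :=
  ∀ (Ω : Type u) [Enc M Ω] (C : Ω → Y → Prop), (Dfn fun p : Ω × Y => C p.1 p.2) →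
    ∃ (T : Type u) (_ : Enc M T) (S : T → Prop) (F : T → Y → Prop), Dfn S ∧
      (Dfn fun p : T × Y => F p.1 p.2) ∧ (∃ t, S t) ∧
      (∀ t, S t → ∀ᶠ y in (q : Filter Y), F t y) ∧
      (∀ t t', S t → S t' → ∃ t'', S t'' ∧ ∀ y, F t'' y → F t y ∧ F t' y) ∧
      ∀ u, (∀ᶠ y in (q : Filter Y), C u y) → ∃ t, S t ∧ ∀ y, F t y → C u y

theorem ldat_step {Y : Type u} [Enc M Y] (q : Ultrafilter (Y × M)) (hq : IsDU q)
    (hL : LDat (q.map Prod.fst)) : LDat q := by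
  intro Ω _ C hC
  have hG : Dfn fun p : (Ω × Y) × M => C p.1.1 (p.1.2, p.2) := dfn
  obtain ⟨J, _, D0, hD0, hDc0, hGD⟩ := pieces (G := fun (t : Ω × Y) x => C t.1 (t.2, x)) hG
  have hinf : Infinite M := inferInstance
  let c : Option J → M := fun j => Infinite.natEmbedding M (Fintype.equivFin (Option J) j)
  have hcinj : Function.Injective c := (Infinite.natEmbedding M).injective.comp
    (Fin.val_injective.comp (Fintype.equivFin (Option J)).injective)
  let D : M × Ω → Y → M → Prop := fun v y x => v.1 = c none ∨
    ∃ j : J, v.1 = c (some j) ∧ D0 j (v.2, y) x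
  have hD : Dfn fun p : (M × Ω) × Y × M => D p.1 p.2.1 p.2.2 := by
    refine Dfn.or dfn (Dfn.exFin fun j => ?_)
    have := hD0 j
    exact dfn
  have hDc : ∀ v y, Conv (D v y) := by
    rintro v y x1 x2 x3 h12 h23 (h1 | ⟨j, hj, h1⟩) h3
    · exact Or.inl h1
    · rcases h3 with h3 | ⟨j', hj', h3⟩
      · exact Or.inl h3
      · have : j = j' := Option.some_injective _ (hcinj (hj.symm.trans hj'))
        subst this
        exact Or.inr ⟨j, hj, hDc0 j _ x1 x2 x3 h12 h23 h1 h3⟩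
  let Lo : M × Ω → Y → M → Prop := fun v y x => ∃ x', x' ≤ x ∧ D v y x'
  let Up : M × Ω → Y → M → Prop := fun v y x => ∃ x', x ≤ x' ∧ D v y x'
  have hLo : Dfn fun p : (M × Ω) × Y × M => Lo p.1 p.2.1 p.2.2 := by
    clear_value D; exact dfn
  have hUp : Dfn fun p : (M × Ω) × Y × M => Up p.1 p.2.1 p.2.2 := by
    clear_value D; exact dfn
  have hLoUp : ∀ v y x, Lo v y x → Up v y x → D v y x := by
    rintro v y x ⟨a, ha, hda⟩ ⟨b, hb, hdb⟩
    exact hDc v y a x b ha hb hda hdb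
  have hDLo : ∀ v y x, D v y x → Lo v y x := fun v y x h => ⟨x, le_rfl, h⟩
  have hDUp : ∀ v y x, D v y x → Up v y x := fun v y x h => ⟨x, le_rfl, h⟩
  have hLou : ∀ v y x x', x ≤ x' → Lo v y x → Lo v y x' :=
    fun v y x x' h ⟨a, ha, hda⟩ => ⟨a, ha.trans h, hda⟩
  have hUpd : ∀ v y x x', x' ≤ x → Up v y x → Up v y x' :=
    fun v y x x' h ⟨a, ha, hda⟩ => ⟨a, h.trans ha, hda⟩
  let Vq : M × Ω → Prop := fun v => ∀ᶠ p in (q : Filter (Y × M)), D v p.1 p.2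
  have hVq : Dfn Vq := by clear_value D; exact dfn'
  have hCD : ∀ u, (∀ᶠ p in (q : Filter (Y × M)), C u p) → ∃ v, Vq v ∧ ∀ y x, D v y x → C u (y, x) := by
    intro u hu
    have : ∀ᶠ p in (q : Filter (Y × M)), ∃ j, D0 j (u, p.1) p.2 :=
      hu.mono fun p hp => (hGD (u, p.1) p.2).1 hp
    obtain ⟨j, hj⟩ := ultra_ex q this
    refine ⟨(c (some j), u), hj.mono fun p hp => Or.inr ⟨j, rfl, hp⟩, ?_⟩
    rintro y x (h | ⟨j', hj', h⟩)
    · cases hcinj h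
    · exact (hGD (u, y) x).2 ⟨j', h⟩
  have hVne : ∃ v, Vq v ∨ IsEmpty Ω := by
    by_cases hΩ : Nonempty Ω
    · obtain ⟨u⟩ := hΩ
      exact ⟨(c none, u), Or.inl (Filter.Eventually.of_forall fun p => Or.inl rfl)⟩
    · exact ⟨(Classical.choice inferInstance, Enc.e.symm fun _ => Classical.choice inferInstance),
        Or.inr (not_nonempty_iff.1 hΩ)⟩
  clear_value D
  let E : ((M × Ω) × (M × Ω)) × ((M × Ω) × (M × Ω)) → Y → Prop := fun v y =>
    (∀ x, Lo v.1.1 y x → Lo v.1.2 y x) ∧ (∀ x, Up v.2.1 y x → Up v.2.2 y x)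
  have hE : Dfn fun p : (((M × Ω) × (M × Ω)) × ((M × Ω) × (M × Ω))) × Y => E p.1 p.2 := by
    clear_value Lo Up; exact dfn
  obtain ⟨T, _, S, F, hS, hF, ⟨t0, ht0⟩, hFq, hdir, href⟩ := hL _ E hE
  have hFq' : ∀ t, S t → ∀ᶠ p in (q : Filter (Y × M)), F t p.1 := hFq
  refine ⟨T × (M × Ω) × (M × Ω), inferInstance, fun t => S t.1 ∧ Vq t.2.1 ∧ Vq t.2.2,
    fun t p => F t.1 p.1 ∧ Lo t.2.1 p.1 p.2 ∧ Up t.2.2 p.1 p.2, ?_, ?_, ?_, ?_, ?_, ?_⟩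
  · clear_value Vq; exact dfn
  · clear_value Lo Up; exact dfn
  · obtain ⟨v, hv | hv⟩ := hVne
    · exact ⟨(t0, v, v), ht0, hv, hv⟩
    · exact (hv.false v.2).elim
  · rintro ⟨t, v, v'⟩ ⟨ht, hv, hv'⟩
    exact (((hFq' t ht).and hv).and hv').mono fun p ⟨⟨h1, h2⟩, h3⟩ =>
      ⟨h1, hDLo _ _ _ h2, hDUp _ _ _ h3⟩
  · rintro ⟨t, v, v'⟩ ⟨t1, v1, v1'⟩ ⟨ht, hv, hv'⟩ ⟨ht1, hv1, hv1'⟩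
    have hlo : ∃ a b, ((a = v ∧ b = v1) ∨ (a = v1 ∧ b = v)) ∧
        ∀ᶠ y in (q.map Prod.fst : Filter Y), ∀ x, Lo a y x → Lo b y x := by
      have : (∀ᶠ y in (q.map Prod.fst : Filter Y), ∀ x, Lo v y x → Lo v1 y x) ∨
          ∀ᶠ y in (q.map Prod.fst : Filter Y), ∀ x, Lo v1 y x → Lo v y x := by
        rw [← Ultrafilter.eventually_or]
        refine Filter.Eventually.of_forall fun y => ?_
        by_contra hcon
        push Not at hcon
        obtain ⟨⟨x, h1, h2⟩, ⟨x', h3, h4⟩⟩ := hcon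
        rcases le_total x x' with h | h
        · exact h4 (hLou v y x x' h h1)
        · exact h2 (hLou v1 y x' x h h3)
      rcases this with h | h
      · exact ⟨v, v1, Or.inl ⟨rfl, rfl⟩, h⟩
      · exact ⟨v1, v, Or.inr ⟨rfl, rfl⟩, h⟩
    have hupp : ∃ a b, ((a = v' ∧ b = v1') ∨ (a = v1' ∧ b = v')) ∧
        ∀ᶠ y in (q.map Prod.fst : Filter Y), ∀ x, Up a y x → Up b y x := by
      have : (∀ᶠ y in (q.map Prod.fst : Filter Y), ∀ x, Up v' y x → Up v1' y x) ∨
          ∀ᶠ y in (q.map Prod.fst : Filter Y), ∀ x, Up v1' y x → Up v' y x := by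
        rw [← Ultrafilter.eventually_or]
        refine Filter.Eventually.of_forall fun y => ?_
        by_contra hcon
        push Not at hcon
        obtain ⟨⟨x, h1, h2⟩, ⟨x', h3, h4⟩⟩ := hcon
        rcases le_total x x' with h | h
        · exact h2 (hUpd v1' y x' x h h3)
        · exact h4 (hUpd v' y x x' h h1)
      rcases this with h | h
      · exact ⟨v', v1', Or.inl ⟨rfl, rfl⟩, h⟩
      · exact ⟨v1', v', Or.inr ⟨rfl, rfl⟩, h⟩
    obtain ⟨a, b, hab, hle⟩ := hlo
    obtain ⟨a', b', hab', hle'⟩ := hupp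
    obtain ⟨t2, ht2, h2⟩ := href ((a, b), (a', b')) (hle.and hle')
    obtain ⟨t3, ht3, h3⟩ := hdir t t1 ht ht1
    obtain ⟨t4, ht4, h4⟩ := hdir t2 t3 ht2 ht3
    have ha : Vq a := by rcases hab with ⟨rfl, _⟩ | ⟨rfl, _⟩ <;> assumption
    have ha' : Vq a' := by rcases hab' with ⟨rfl, _⟩ | ⟨rfl, _⟩ <;> assumption
    refine ⟨(t4, a, a'), ⟨ht4, ha, ha'⟩, ?_⟩
    rintro ⟨y, x⟩ ⟨hy, hxl, hxu⟩
    have hy4 := h4 y hy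
    have hy3 := h3 y hy4.2
    have hE2 := h2 y hy4.1
    have hb := hE2.1 x hxl
    have hb' := hE2.2 x hxu
    have e1 : Lo v y x ∧ Lo v1 y x := by
      rcases hab with ⟨rfl, rfl⟩ | ⟨rfl, rfl⟩
      exacts [⟨hxl, hb⟩, ⟨hb, hxl⟩]
    have e2 : Up v' y x ∧ Up v1' y x := by
      rcases hab' with ⟨rfl, rfl⟩ | ⟨rfl, rfl⟩
      exacts [⟨hxu, hb'⟩, ⟨hb', hxu⟩]
    exact ⟨⟨hy3.1, e1.1, e2.1⟩, ⟨hy3.2, e1.2, e2.2⟩⟩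
  · intro u hu
    obtain ⟨v, hv, hvC⟩ := hCD u hu
    exact ⟨(t0, v, v), ⟨ht0, hv, hv⟩, fun p ⟨_, h1, h2⟩ => hvC _ _ (hLoUp _ _ _ h1 h2)⟩

theorem ldat (k : ℕ) : ∀ q : Ultrafilter (Fin k → M), IsDU q → LDat q := by
  induction k with
  | zero =>
    intro q hq Ω _ C hC
    refine ⟨M, inferInstance, fun _ => True, fun _ _ => True, Dfn.tru, Dfn.tru,
      ⟨Classical.choice inferInstance, trivial⟩, by simp, fun t _ _ _ => ⟨t, trivial, by simp⟩, ?_⟩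
    intro u hu
    obtain ⟨y, hy⟩ := hu.exists
    exact ⟨Classical.choice inferInstance, trivial, fun y' _ => by
      rwa [Subsingleton.elim y' y]⟩
  | succ k ih =>
    intro q hq Ω _ C hC
    let g : (Fin (k+1) → M) → (Fin k → M) × M := fun v => (fun i => v i.castSucc, v (Fin.last k))
    have hg : DM g := dfn
    have hq' : IsDU (q.map g) := hq.map hg
    have hst := ldat_step (q.map g) hq' (ih _ (hq'.map DM.fst0))
    have hsn : DM fun p : (Fin k → M) × M => (Fin.snoc p.1 p.2 : Fin (k+1) → M) := DM.snoc
    obtain ⟨T, _, S, F, hS, hF, hne, hFq, hdir, href⟩ := hst Ω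
      (fun u p => C u (Fin.snoc p.1 p.2)) dfn
    refine ⟨T, inferInstance, S, fun t v => F t (g v), hS, dfn, hne, hFq, ?_, ?_⟩
    · intro t t' ht ht'
      obtain ⟨t2, h2, h⟩ := hdir t t' ht ht'
      exact ⟨t2, h2, fun y hy => h _ hy⟩
    · intro u hu
      have hsg : ∀ v, (Fin.snoc (g v).1 (g v).2 : Fin (k+1) → M) = v := snoc_eta
      obtain ⟨t, ht, h⟩ := href u (by
        change ∀ᶠ v in (q : Filter (Fin (k+1) → M)), C u (Fin.snoc (g v).1 (g v).2)
        exact hu.mono fun v hv => by rw [hsg]; exact hv)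
      refine ⟨t, ht, fun v hv => ?_⟩
      have := h _ hv
      rwa [hsg] at this

end

section
variable {M : Type u}

/-- the abstract o-minimal structure of an o-minimal first-order structure -/
@[reducible] noncomputable def omOf (L : FirstOrder.Language.{v, w}) [L.Structure M] [inst : LinearOrder M]
    (hM : IsOMinimal L M) : OM M where
  toLinearOrder := inst
  nonemp := hM.1
  dense := hM.2.1
  nomin := hM.2.2.1
  nomax := hM.2.2.2.1
  Def := fun A => Set.Definable (Set.univ : Set M) L A
  def_univ := Set.definable_univ
  def_inter := fun h h' => h.inter h'
  def_compl := fun h => h.compl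
  def_pre := fun f _ h => h.preimage_comp f
  def_img := fun f _ h => h.image_comp f
  def_lt := hM.2.2.2.2.1.mono (Set.empty_subset _)
  def_sing := fun a => by
    refine ⟨FirstOrder.Language.Term.equal (FirstOrder.Language.Term.var ())
      (FirstOrder.Language.Constants.term (L.con (⟨a, Set.mem_univ a⟩ : (Set.univ : Set M)))), ?_⟩
    ext v
    simp
  omin := fun s hs => hM.2.2.2.2.2 s (by
    have := hs.preimage_comp (fun _ : Unit => (0 : Fin 1))
    exact this)

end

section
variable {M : Type u} [OM M] {L : FirstOrder.Language.{v, w}} [L.Structure M]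

/-- definable sets of the abstract structure agree with those of the language -/
def Agree (M : Type u) [OM M] (L : FirstOrder.Language.{v, w}) [L.Structure M] : Prop :=
  ∀ {ι : Type} (A : Set (ι → M)), OM.Def A ↔ Set.Definable (Set.univ : Set M) L A

theorem Agree.set (hL : Agree M L) {m : ℕ} {A : Set (Fin m → M)}
    (h : Set.Definable (Set.univ : Set M) L A) : Dfn fun u : Fin m → M => u ∈ A :=
  (hL _).2 (h.preimage_comp (fun i : Fin m => (i, ())))

theorem Agree.fam (hL : Agree M L) {m k : ℕ} {D : Set (Fin m ⊕ Fin k → M)}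
    (h : Set.Definable (Set.univ : Set M) L D) :
    Dfn fun p : (Fin m → M) × (Fin k → M) => p.2 ∈ famFiber D p.1 := by
  have := (hL _).2 (h.preimage_comp
    (Sum.map (fun i : Fin m => (i, ())) (fun i : Fin k => (i, ()))))
  refine Eq.mp (congrArg OM.Def (Set.ext fun w => ?_)) this
  refine iff_of_eq (congrArg (· ∈ D) ?_)
  ext i
  rcases i with i | i <;> rfl

theorem Agree.mk (hL : Agree M L) {T : Type u} [Enc M T] {k : ℕ} {S : T → Prop} (hS : Dfn S)
    {F : T → (Fin k → M) → Prop} (hF : Dfn fun p : T × (Fin k → M) => F p.1 p.2) :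
    IsDefFamily L (Set.univ : Set M) k ((fun t => {x | F t x}) '' {t | S t}) := by
  let n := Nat.card (Enc.Idx (M := M) T)
  let ε : Enc.Idx (M := M) T ≃ Fin n := Finite.equivFin _
  refine ⟨n, {u : Fin n → M | S (Enc.e.symm (u ∘ ε))},
    {w : Fin n ⊕ Fin k → M | F (Enc.e.symm (w ∘ Sum.inl ∘ ε)) (w ∘ Sum.inr)}, ?_, ?_, ?_⟩
  · exact ((hL _).1 hS).preimage_comp ε
  · exact ((hL _).1 hF).preimage_comp (Sum.map ε (fun p : Fin k × Unit => p.1))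
  · ext Y
    constructor
    · rintro ⟨t, ht, rfl⟩
      have e : Enc.e.symm ((Enc.e t ∘ ε.symm) ∘ ε) = t := by
        rw [Function.comp_assoc, Equiv.symm_comp_self, Function.comp_id]; simp
      refine ⟨Enc.e t ∘ ε.symm, ?_, ?_⟩
      · simp only [Set.mem_ofPred_eq]; rw [e]; exact ht
      · ext x
        change F (Enc.e.symm ((Enc.e t ∘ ε.symm) ∘ ε)) x ↔ F t x
        rw [e]
    · rintro ⟨u, hu, rfl⟩
      exact ⟨Enc.e.symm (u ∘ ε), hu, rfl⟩

end

section
variable {M : Type u} [OM M] {L : FirstOrder.Language.{v, w}} [L.Structure M]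

theorem limit_ex (hL : Agree M L) {k : ℕ} {X : Set (Fin k → M)} [TopologicalSpace ↥X]
    (hX : IsDefTopSpace L X) (hc : DefinablyCompact L X) {Ω : Type u} [Enc M Ω]
    (C : Ω → (Fin k → M) → Prop) (hC : Dfn fun p : Ω × (Fin k → M) => C p.1 p.2)
    (q : Ultrafilter (Fin k → M)) (hq : IsDU q) (hqX : ∀ᶠ x in (q : Filter (Fin k → M)), x ∈ X) :
    ∃ x ∈ X, ∀ u, (∀ᶠ y in (q : Filter (Fin k → M)), C u y) → TauClosed X {y | C u y} → C u x := by
  obtain ⟨hXd, B, ⟨mB, ΘB, DB, hΘ, hDB, rfl⟩, hBX, hB⟩ := hX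
  obtain ⟨T, _, S, F, hS, hF, ⟨t0, ht0⟩, hFq, hdir, hFC⟩ := ldat k q hq Ω C hC
  have hXd' := hL.set hXd
  have hΘ' := hL.set hΘ
  have hDB' := hL.fam hDB
  let XX : (Fin k → M) → Prop := fun x => x ∈ X
  have hXX : ∀ x, XX x ↔ x ∈ X := fun _ => Iff.rfl
  let TT : (Fin mB → M) → Prop := fun x => x ∈ ΘB
  have hTT : ∀ x, TT x ↔ x ∈ ΘB := fun _ => Iff.rfl
  let BB : (Fin mB → M) → (Fin k → M) → Prop := fun θ x => x ∈ famFiber DB θ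
  have hBB : ∀ θ x, BB θ x ↔ x ∈ famFiber DB θ := fun _ _ => Iff.rfl
  have h1 : Dfn XX := hXd'
  have h2 : Dfn TT := hΘ'
  have h3 : Dfn fun p : (Fin mB → M) × (Fin k → M) => BB p.1 p.2 := hDB'
  clear_value XX TT BB
  have hcl : Dfn fun p : T × (Fin k → M) => XX p.2 ∧ ∀ θ, TT θ → BB θ p.2 →
      ∃ x', XX x' ∧ F p.1 x' ∧ BB θ x' := dfn
  let G : T → (Fin k → M) → Prop := fun t x => XX x ∧ ∀ θ, TT θ → BB θ x →
      ∃ x', XX x' ∧ F t x' ∧ BB θ x'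
  have hGne : ∀ t, S t → ∃ x, G t x := by
    intro t ht
    obtain ⟨x, hxF, hxX⟩ := ((hFq t ht).and hqX).exists
    exact ⟨x, (hXX x).2 hxX, fun θ hθ hx => ⟨x, (hXX x).2 hxX, hxF, hx⟩⟩
  obtain ⟨x, hx⟩ := hc _ (hL.mk hS (F := G) hcl) ⟨by
      rintro ⟨t, ht, he⟩
      obtain ⟨x, hx⟩ := hGne t ht
      have : x ∈ (∅ : Set (Fin k → M)) := he ▸ hx
      exact this, by
      rintro _ ⟨t, ht, rfl⟩ _ ⟨t', ht', rfl⟩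
      obtain ⟨t'', ht'', h⟩ := hdir t t' ht ht'
      refine ⟨_, ⟨t'', ht'', rfl⟩, ?_⟩
      rintro x ⟨hxX, hx⟩
      refine ⟨⟨hxX, fun θ hθ hxθ => ?_⟩, ⟨hxX, fun θ hθ hxθ => ?_⟩⟩
      · obtain ⟨x', a, b, c⟩ := hx θ hθ hxθ
        exact ⟨x', a, (h x' b).1, c⟩
      · obtain ⟨x', a, b, c⟩ := hx θ hθ hxθ
        exact ⟨x', a, (h x' b).2, c⟩⟩ (by
      rintro _ ⟨t, ht, rfl⟩
      refine ⟨hGne t ht, fun x hx => (hXX x).1 hx.1, ?_⟩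
      rw [← isOpen_compl_iff, hB.isOpen_iff]
      rintro ⟨x, hxX⟩ hx
      have hx' : ¬ G t x := hx
      simp only [G, not_and, not_forall, not_exists] at hx'
      obtain ⟨θ, hθ, hxθ, hno⟩ := hx' ((hXX x).2 hxX)
      refine ⟨_, ⟨_, ⟨θ, (hTT θ).1 hθ, rfl⟩, rfl⟩, (hBB θ x).1 hxθ, ?_⟩
      rintro ⟨y, hyX⟩ hy hyG
      obtain ⟨x', a, b, c⟩ := (hyG : G t y).2 θ hθ ((hBB θ y).2 hy)
      exact hno x' a b c)
  have hxG : ∀ t, S t → G t x := fun t ht => hx _ ⟨t, ht, rfl⟩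
  have hxX : x ∈ X := (hXX x).1 (hxG t0 ht0).1
  refine ⟨x, hxX, fun u hu hcu => ?_⟩
  obtain ⟨t, ht, hFt⟩ := hFC u hu
  by_contra hno
  have ho := hcu.2
  rw [← isOpen_compl_iff, hB.isOpen_iff] at ho
  obtain ⟨_, ⟨_, ⟨θ, hθ, rfl⟩, rfl⟩, hxθ, hsub⟩ := ho ⟨x, hxX⟩ hno
  obtain ⟨x', a, b, c⟩ := (hxG t ht).2 θ ((hTT θ).2 hθ) ((hBB θ x).2 hxθ)
  exact hsub (a := ⟨x', (hXX x').1 a⟩) ((hBB θ x').1 c) (hFt x' b)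

theorem mnp_of {α Ω : Type*} (s : Ω → Set α) (hne : ∀ u, (s u).Nonempty) {m n : ℕ} (hn : 1 ≤ n)
    (h : HasMNProperty (Set.range s) m n) (u : Fin (m * n) → Ω) :
    ∃ f : Fin n → Fin (m * n), Function.Injective f ∧ ∃ x, ∀ j, x ∈ s (u (f j)) := by
  classical
  by_cases hm : m ≤ (Finset.univ.image fun i => s (u i)).card
  · obtain ⟨F, hF, hFm⟩ := Finset.exists_subset_card_eq hm
    obtain ⟨G, hGF, hGn, x, hx⟩ := h F (fun Y hY => by
      obtain ⟨i, -, rfl⟩ := Finset.mem_image.1 (hF hY)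
      exact ⟨_, rfl⟩) hFm
    have hG : ∀ Y : G, ∃ i, s (u i) = Y := fun Y => by
      obtain ⟨i, -, hi⟩ := Finset.mem_image.1 (hF (hGF Y.2))
      exact ⟨i, hi⟩
    choose g hg using hG
    let e : Fin n ≃ G := (finCongr hGn.symm).trans G.equivFin.symm
    refine ⟨fun j => g (e j), fun i j hij => ?_, x, fun j => ?_⟩
    · apply e.injective
      apply Subtype.ext
      rw [← hg, ← hg]
      exact congrArg (fun i => s (u i)) hij
    · rw [hg]
      exact hx _ (e j).2
  · have : ∃ a ∈ Finset.univ.image fun i => s (u i),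
        n ≤ (Finset.univ.filter fun i => s (u i) = a).card := by
      by_contra hcon
      push Not at hcon
      have := Finset.card_le_mul_card_image (f := fun i => s (u i)) Finset.univ n
        (fun a ha => (hcon a ha).le)
      rw [Finset.card_univ, Fintype.card_fin] at this
      push Not at hm
      nlinarith
    obtain ⟨a, ha, hcard⟩ := this
    obtain ⟨F, hF, hFm⟩ := Finset.exists_subset_card_eq hcard
    obtain ⟨i, -, rfl⟩ := Finset.mem_image.1 ha
    obtain ⟨x, hx⟩ := hne (u i)
    refine ⟨F.orderEmbOfFin hFm, (F.orderEmbOfFin hFm).injective, x, fun j => ?_⟩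
    have := (Finset.mem_filter.1 (hF (F.orderEmbOfFin_mem hFm j))).2
    rw [this]
    exact hx

/-- bound on traces of a family of sets -/
def TrC {α : Type*} (n : ℕ) (C : Set (Set α)) : Prop :=
  ∀ γ : ℝ, 0 < γ → ∃ b : ℕ, 1 ≤ b ∧ ∃ P : ℝ, P < γ / 2 * b ^ n ∧
    ∀ f : Fin n × Fin b → Set α, (∀ i, f i ∈ C) →
      ({I : Set (Fin n × Fin b) | ∃ x, I = {i | x ∈ f i}}.ncard : ℝ) ≤ P

theorem trans_ex (hL : Agree M L) {k : ℕ} {X : Set (Fin k → M)} [TopologicalSpace ↥X]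
    (hX : IsDefTopSpace L X) (hc : DefinablyCompact L X) (C : Set (Set (Fin k → M)))
    (hC : IsDefFamily L (Set.univ : Set M) k C)
    (hcl : ∀ Y ∈ C, Y.Nonempty ∧ TauClosed X Y) {m n : ℕ} (hn : 1 ≤ n) (hmn : n ≤ m)
    (hMN : HasMNProperty C m n) (hT : TrC n C) :
    ∃ T : Finset (Fin k → M), ↑T ⊆ X ∧ ∀ Y ∈ C, ∃ x ∈ T, x ∈ Y := by
  classical
  obtain ⟨mm, Ω, D, hΩ, hD, rfl⟩ := hC
  by_cases hΩe : ∃ u0, u0 ∈ Ω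
  swap
  · refine ⟨∅, by simp, ?_⟩
    rintro Y ⟨u, hu, rfl⟩
    exact absurd ⟨u, hu⟩ hΩe
  obtain ⟨u0, hu0⟩ := hΩe
  let C' : (Fin mm → M) → (Fin k → M) → Prop := fun u x =>
    (u ∈ Ω ∧ x ∈ famFiber D u) ∨ (¬ u ∈ Ω ∧ x ∈ famFiber D u0)
  have hC' : Dfn fun p : (Fin mm → M) × (Fin k → M) => C' p.1 p.2 := by
    have h1 := hL.set hΩ
    have h2 := hL.fam hD
    exact Dfn.or (Dfn.and (Dfn.pre_fst h1) h2) (Dfn.and (Dfn.not (Dfn.pre_fst h1))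
      (h2.comp (f := fun p : (Fin mm → M) × (Fin k → M) => (u0, p.2)) dfn))
  have hC'1 : ∀ u, u ∈ Ω → {x | C' u x} = famFiber D u := fun u hu => by
    ext x; simp [C', hu]
  have hC'0 : ∀ u, u ∉ Ω → {x | C' u x} = famFiber D u0 := fun u hu => by
    ext x; simp [C', hu]
  have hC'm : ∀ u, {x | C' u x} ∈ famFiber D '' Ω := fun u => by
    by_cases hu : u ∈ Ω
    · rw [hC'1 u hu]; exact ⟨u, hu, rfl⟩
    · rw [hC'0 u hu]; exact ⟨u0, hu0, rfl⟩
  have hrange : Set.range (fun u => {x | C' u x}) = famFiber D '' Ω := by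
    ext Y
    constructor
    · rintro ⟨u, rfl⟩; exact hC'm u
    · rintro ⟨u, hu, rfl⟩; exact ⟨u, hC'1 u hu⟩
  clear_value C'
  have hC3 : Dfn fun p : (Fin mm → M) × (Fin 0 → M) × (Fin k → M) => C' p.1 p.2.2 := dfn
  obtain ⟨N, q', hq', hfin⟩ := pierce hn k (K := Unit) (m := m * n) (Y := Fin 0 → M)
    (fun _ => (pure (fun i => i.elim0) : Ultrafilter (Fin 0 → M)))
    (fun _ => IsDU.pure _) (fun u _ z => C' u z) hC3
    (by
      intro γ hγ
      obtain ⟨b, hb, P, hP, hPa⟩ := hT γ hγ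
      refine ⟨b, hb, P, hP, fun a => le_trans ?_ (hPa (fun i => {x | C' (a i) x})
        (fun i => hC'm _))⟩
      norm_cast
      refine Set.ncard_le_ncard ?_ (Set.toFinite _)
      rintro I ⟨y, z, rfl⟩
      exact ⟨z, rfl⟩)
    (by
      intro u
      obtain ⟨f, hf, x, hx⟩ := mnp_of (fun u => {x | C' u x}) (fun u => (hcl _ (hC'm u)).1) hn
        (hrange ▸ hMN) u
      exact ⟨f, hf, (), Filter.Eventually.of_forall fun y => ⟨x, hx⟩⟩)
  have hsnd : DM (fun p : (Fin 0 → M) × (Fin k → M) => p.2) := dfn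
  have key : ∀ i, ∃ x : Fin k → M, (∀ᶠ x in ((q' i).map Prod.snd : Filter (Fin k → M)), x ∈ X) →
      x ∈ X ∧ ∀ u, (∀ᶠ y in ((q' i).map Prod.snd : Filter (Fin k → M)), C' u y) →
        TauClosed X {y | C' u y} → C' u x := by
    intro i
    by_cases h : ∀ᶠ x in ((q' i).map Prod.snd : Filter (Fin k → M)), x ∈ X
    · obtain ⟨x, hx, hxu⟩ := limit_ex hL hX hc C' hC' ((q' i).map Prod.snd) ((hq' i).map hsnd) h
      exact ⟨x, fun _ => ⟨hx, hxu⟩⟩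
    · exact ⟨fun _ => Classical.choice OM.nonemp, fun h' => absurd h' h⟩
  choose x hx using key
  refine ⟨(Finset.univ.filter fun i =>
    ∀ᶠ x in ((q' i).map Prod.snd : Filter (Fin k → M)), x ∈ X).image x, ?_, ?_⟩
  · intro y hy
    obtain ⟨i, hi, rfl⟩ := Finset.mem_image.1 (Finset.mem_coe.1 hy)
    exact (hx i (Finset.mem_filter.1 hi).2).1
  · rintro Y ⟨u, hu, rfl⟩
    obtain ⟨i, hi⟩ := hfin u
    have hYc := (hcl _ (hC'm u)).2
    have hi' : ∀ᶠ y in ((q' i).map Prod.snd : Filter (Fin k → M)), C' u y := hi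
    have hiX : ∀ᶠ x in ((q' i).map Prod.snd : Filter (Fin k → M)), x ∈ X :=
      hi'.mono fun y hy => hYc.1 hy
    refine ⟨x i, Finset.mem_image.2 ⟨i, Finset.mem_filter.2 ⟨Finset.mem_univ _, hiX⟩, rfl⟩, ?_⟩
    rw [← hC'1 u hu]
    exact (hx i hiX).2 u hi' hYc

end

/-- the traces of finitely many sets -/
def trs {α : Type*} {ι : Type*} (f : ι → Set α) : Set (Set ι) := {I | ∃ x, I = {i | x ∈ f i}}

theorem trc_of_poly {α : Type*} {n : ℕ} (hn : 1 ≤ n) (C : Set (Set α)) {r A : ℝ} (hr : r < n)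
    (h : ∀ N : ℕ, 1 ≤ N → ∀ f : Fin N → Set α, (∀ i, f i ∈ C) →
      ((trs f).ncard : ℝ) ≤ A * (N : ℝ) ^ r) : TrC n C := by
  intro γ hγ
  have hlim : Filter.Tendsto (fun b : ℕ => A * (n : ℝ) ^ r * (b : ℝ) ^ (-((n : ℝ) - r)))
      Filter.atTop (nhds (A * (n : ℝ) ^ r * 0)) :=
    ((tendsto_rpow_neg_atTop (sub_pos.2 hr)).comp tendsto_natCast_atTop_atTop).const_mul _
  rw [mul_zero] at hlim
  have hev := hlim.eventually_lt_const (half_pos hγ)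
  obtain ⟨b, hb, hb1⟩ := (hev.and (Filter.eventually_ge_atTop 1)).exists
  have hb0 : (0 : ℝ) < b := by exact_mod_cast hb1
  refine ⟨b, hb1, A * ((n * b : ℕ) : ℝ) ^ r, ?_, fun f hf => ?_⟩
  · have e : A * ((n * b : ℕ) : ℝ) ^ r =
        A * (n : ℝ) ^ r * (b : ℝ) ^ (-((n : ℝ) - r)) * (b : ℝ) ^ n := by
      rw [Nat.cast_mul, Real.mul_rpow (by positivity) (by positivity), neg_sub,
        Real.rpow_sub hb0, Real.rpow_natCast]
      field_simp
    rw [e]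
    exact mul_lt_mul_of_pos_right hb (by positivity)
  · refine le_trans ?_ (h (n * b) (Nat.mul_pos hn hb1) (fun i => f (finProdFinEquiv.symm i))
      (fun i => hf _))
    norm_cast
    refine Set.ncard_le_ncard_of_injOn (fun I => finProdFinEquiv.symm ⁻¹' I) ?_ ?_ (Set.toFinite _)
    · rintro I ⟨x, rfl⟩
      exact ⟨x, rfl⟩
    · intro I _ J _ hIJ
      exact Set.preimage_injective.2 finProdFinEquiv.symm.surjective hIJ

theorem card_atoms {α : Type*} {N : ℕ} (f : Fin N → Set α) :
    Nat.card {I : Finset (Fin N) // (vennAtom f I).Nonempty} = (trs f).ncard := by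
  classical
  rw [← Nat.card_coe_set_eq]
  refine Nat.card_congr (Equiv.ofBijective
    (fun I => ⟨(I.1 : Set (Fin N)), ?_⟩) ⟨?_, ?_⟩)
  · obtain ⟨x, hx⟩ := I.2
    exact ⟨x, by ext i; exact (hx i).symm⟩
  · intro I J h
    apply Subtype.ext
    exact Finset.coe_injective (congrArg Subtype.val h)
  · rintro ⟨_, x, rfl⟩
    refine ⟨⟨Finset.univ.filter fun i => x ∈ f i, x, fun i => by simp⟩, ?_⟩
    apply Subtype.ext
    ext i
    simp

theorem trs_le {α : Type*} {N : ℕ} (C : Set (Set α)) (f : Fin N → Set α) (hf : ∀ i, f i ∈ C) :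
    (trs f).ncard ≤ dualShatter C N := by
  refine le_csSup ⟨Nat.card (Set (Fin N)), ?_⟩ ⟨f, hf, (card_atoms f).symm⟩
  rintro c ⟨g, -, rfl⟩
  rw [card_atoms, ← Set.ncard_univ]
  exact Set.ncard_le_ncard (Set.subset_univ _) (Set.toFinite _)

section
variable {M : Type u} [OM M] {L : FirstOrder.Language.{v, w}} [L.Structure M]

theorem fam_cod (hL : Agree M L) {k : ℕ} {C : Set (Set (Fin k → M))}
    (hC : IsDefFamily L (Set.univ : Set M) k C) (D : (Fin k → M) → Prop) {d : ℕ} (hD : Cod D d)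
    (hCD : ∀ Y ∈ C, ∀ x ∈ Y, D x) : ∃ A : ℕ, ∀ N : ℕ, 1 ≤ N → ∀ f : Fin N → Set (Fin k → M),
      (∀ i, f i ∈ C) → (trs f).ncard ≤ A * N ^ d := by
  obtain ⟨m, Ω, E, hΩ, hE, rfl⟩ := hC
  obtain ⟨A, hA⟩ := hD (Fin m → M) (fun u x => x ∈ famFiber E u) (hL.fam hE)
  refine ⟨A + 1, fun N hN f hf => ?_⟩
  have hf' := hf
  choose a ha haf using hf'
  have h1 : trs f ⊆ insert ∅ (Traces D (fun u x => x ∈ famFiber E u) a) := by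
    rintro I ⟨x, rfl⟩
    by_cases hx : D x
    · right
      exact ⟨x, hx, by ext i; simp [haf]⟩
    · left
      ext i
      simp only [Set.mem_ofPred_eq, Set.mem_empty_iff_false, iff_false]
      exact fun hi => hx (hCD _ (hf i) x hi)
  calc (trs f).ncard ≤ _ := Set.ncard_le_ncard h1 (Set.toFinite _)
    _ ≤ (Traces D (fun u x => x ∈ famFiber E u) a).ncard + 1 := Set.ncard_insert_le _ _
    _ ≤ A * N ^ d + 1 := by gcongr; exact hA N hN a
    _ ≤ A * N ^ d + N ^ d := by gcongr; exact Nat.one_le_pow _ _ hN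
    _ = _ := by ring

theorem dim_bdd {k : ℕ} (Y : Set (Fin k → M)) : letI : TopologicalSpace M := Preorder.topology M
    BddAbove {d : ℕ | ∃ ι : Fin d → Fin k, Function.Injective ι ∧
    (interior ((fun v : Fin k → M => v ∘ ι) '' Y)).Nonempty} := by
  refine ⟨k, ?_⟩
  rintro d ⟨ι, hι, -⟩
  simpa using Fintype.card_le_of_injective ι hι

theorem trc_dim (hL : Agree M L) {k n : ℕ} {C : Set (Set (Fin k → M))}
    (hC : IsDefFamily L (Set.univ : Set M) k C) (hn : oDim (⋃₀ C) < n) : TrC n C := by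
  obtain ⟨d, rfl⟩ : ∃ d, n = d + 1 := ⟨n - 1, by omega⟩
  have hD : Dfn fun x : Fin k → M => x ∈ ⋃₀ C := by
    obtain ⟨m, Ω, E, hΩ, hE, rfl⟩ := hC
    have h1 := hL.set hΩ
    have h2 := hL.fam hE
    have h3 : Dfn fun p : (Fin k → M) × (Fin m → M) => p.2 ∈ Ω ∧ p.1 ∈ famFiber E p.2 :=
      Dfn.and (Dfn.pre_snd h1) (h2.comp (f := fun p : (Fin k → M) × (Fin m → M) => (p.2, p.1)) dfn)
    exact (Dfn.ex (P := fun x u => u ∈ Ω ∧ x ∈ famFiber E u) h3).congr fun x => by simp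
  rcases cod_main k _ hD d with h | ⟨ι, hι, p, q, hpq, hbox⟩
  · obtain ⟨A, hA⟩ := fam_cod hL hC _ h (fun Y hY x hx => ⟨Y, hY, hx⟩)
    refine trc_of_poly (r := (d : ℝ)) (A := A) (by omega) C (by push_cast; linarith) ?_
    intro N hN f hf
    rw [Real.rpow_natCast]
    exact_mod_cast hA N hN f hf
  · exfalso
    refine absurd (le_csSup (dim_bdd (⋃₀ C)) ⟨ι, hι, ?_⟩) (not_le.2 hn)
    letI : TopologicalSpace M := Preorder.topology M
    haveI : OrderTopology M := ⟨rfl⟩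
    choose z hz using fun i => exists_between (hpq i)
    refine ⟨z, mem_interior.2 ⟨Set.pi Set.univ fun i => Set.Ioo (p i) (q i), ?_,
      isOpen_set_pi Set.finite_univ fun i _ => isOpen_Ioo, fun i _ => hz i⟩⟩
    intro y hy
    obtain ⟨v, hv, he⟩ := hbox y fun i => ⟨(hy i trivial).1.le, (hy i trivial).2.le⟩
    exact ⟨v, hv, he⟩

theorem vc_nonempty (hL : Agree M L) {k : ℕ} {C : Set (Set (Fin k → M))}
    (hC : IsDefFamily L (Set.univ : Set M) k C) :
    {r : ℝ | 0 ≤ r ∧ ∃ A : ℝ, ∀ N : ℕ, 1 ≤ N →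
      (dualShatter C N : ℝ) ≤ A * (N : ℝ) ^ r}.Nonempty := by
  rcases cod_main (M := M) k (fun _ => True) Dfn.tru k with h | ⟨ι, hι, -⟩
  · obtain ⟨A, hA⟩ := fam_cod hL hC _ h (fun Y hY x hx => trivial)
    refine ⟨k, Nat.cast_nonneg _, A, fun N hN => ?_⟩
    rw [Real.rpow_natCast]
    norm_cast
    refine csSup_le' ?_
    rintro c ⟨f, hf, rfl⟩
    rw [card_atoms]
    exact hA N hN f hf
  · exfalso
    have := Fintype.card_le_of_injective ι hι
    simp at this

theorem vc_nonneg {α : Type*} (C : Set (Set α)) : 0 ≤ vcCodensity C :=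
  Real.sInf_nonneg fun _ hr => hr.1

theorem trc_vc (hL : Agree M L) {k n : ℕ} {C : Set (Set (Fin k → M))}
    (hC : IsDefFamily L (Set.univ : Set M) k C) (hn : vcCodensity C < n) : TrC n C := by
  obtain ⟨r, ⟨hr0, A, hA⟩, hrn⟩ := exists_lt_of_csInf_lt (vc_nonempty hL hC) hn
  have h1 : 1 ≤ n := by
    have : (0 : ℝ) < n := lt_of_le_of_lt hr0 hrn
    exact_mod_cast this
  refine trc_of_poly h1 C hrn (A := A) fun N hN f hf => ?_
  exact le_trans (by exact_mod_cast trs_le C f hf) (hA N hN)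

theorem dir_mn {α : Type*} [Nonempty α] {C : Set (Set α)} (h : DirectedFam C) (n : ℕ) :
    HasMNProperty C n n := by
  classical
  intro F hF hFn
  refine ⟨F, subset_rfl, hFn, ?_⟩
  by_cases hC : C.Nonempty
  · have : ∃ Z ∈ C, ∀ Y ∈ F, Z ⊆ Y := by
      clear hFn
      induction F using Finset.induction_on with
      | empty => obtain ⟨Z, hZ⟩ := hC; exact ⟨Z, hZ, by simp⟩
      | insert a F _ ih =>
        obtain ⟨Z, hZ, hZF⟩ := ih (fun Y hY => hF (Finset.mem_insert_of_mem hY))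
        obtain ⟨W, hW, hWZ⟩ := h.2 a (hF (Finset.mem_insert_self _ _)) Z hZ
        refine ⟨W, hW, fun Y hY => ?_⟩
        rcases Finset.mem_insert.1 hY with rfl | hY
        · exact fun x hx => (hWZ hx).1
        · exact fun x hx => hZF Y hY (hWZ hx).2
    obtain ⟨Z, hZ, hZF⟩ := this
    obtain ⟨x, hx⟩ : Z.Nonempty := Set.nonempty_iff_ne_empty.2 fun he => h.1 (he ▸ hZ)
    exact ⟨x, fun Y hY => hZF Y hY hx⟩
  · have : F = ∅ := Finset.eq_empty_of_forall_notMem fun Y hY => hC ⟨Y, hF hY⟩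
    subst this
    simp

theorem dir_tr {α : Type*} [Nonempty α] {C : Set (Set α)} (h : DirectedFam C) (T : Finset α)
    (hT : ∀ Y ∈ C, ∃ x ∈ T, x ∈ Y) : (⋂₀ C).Nonempty := by
  classical
  by_cases hC : C.Nonempty
  · by_contra hno
    have hno' : ∀ x, ∃ Y ∈ C, x ∉ Y := by
      intro x
      by_contra hx
      simp only [not_exists, not_and, not_not] at hx
      exact hno ⟨x, hx⟩
    have : ∃ Z ∈ C, ∀ x ∈ T, x ∉ Z := by
      clear hT
      induction T using Finset.induction_on with
      | empty => obtain ⟨Z, hZ⟩ := hC; exact ⟨Z, hZ, by simp⟩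
      | insert a F _ ih =>
        obtain ⟨Z, hZ, hZF⟩ := ih
        obtain ⟨Y, hY, haY⟩ := hno' a
        obtain ⟨W, hW, hWZ⟩ := h.2 Y hY Z hZ
        refine ⟨W, hW, fun x hx hxW => ?_⟩
        rcases Finset.mem_insert.1 hx with rfl | hx
        · exact haY (hWZ hxW).1
        · exact hZF x hx (hWZ hxW).2
    obtain ⟨Z, hZ, hZT⟩ := this
    obtain ⟨x, hx, hxZ⟩ := hT Z hZ
    exact hZT x hx hxZ
  · rw [Set.not_nonempty_iff_eq_empty.1 hC]
    simp

theorem main_abs (hL : Agree M L) (k : ℕ) (X : Set (Fin k → M)) [TopologicalSpace ↥X]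
    (hX : IsDefTopSpace L X) :
    (DefinablyCompact L X ↔
      ∀ C : Set (Set (Fin k → M)), IsDefFamily L (Set.univ : Set M) k C →
        (∀ Y ∈ C, Y.Nonempty ∧ TauClosed X Y) →
        (∃ m n : ℕ, n ≤ m ∧ oDim (⋃₀ C) < n ∧ HasMNProperty C m n) →
        ∃ T : Finset (Fin k → M), ↑T ⊆ X ∧ ∀ Y ∈ C, ∃ x ∈ T, x ∈ Y) ∧
    (DefinablyCompact L X ↔
      ∀ C : Set (Set (Fin k → M)), IsDefFamily L (Set.univ : Set M) k C →
        (∀ Y ∈ C, Y.Nonempty ∧ TauClosed X Y) →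
        (∃ m n : ℕ, n ≤ m ∧ vcCodensity C < (n : ℝ) ∧ HasMNProperty C m n) →
        ∃ T : Finset (Fin k → M), ↑T ⊆ X ∧ ∀ Y ∈ C, ∃ x ∈ T, x ∈ Y) := by
  refine ⟨⟨fun hc C hC hcl => ?_, fun h C hC hd hcl => ?_⟩,
    ⟨fun hc C hC hcl => ?_, fun h C hC hd hcl => ?_⟩⟩
  · rintro ⟨m, n, hmn, hn, hMN⟩
    exact trans_ex hL hX hc C hC hcl (by omega) hmn hMN (trc_dim hL hC hn)
  · obtain ⟨T, -, hT⟩ := h C hC hcl ⟨_, _, le_rfl, Nat.lt_succ_self _, dir_mn hd _⟩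
    exact dir_tr hd T hT
  · rintro ⟨m, n, hmn, hn, hMN⟩
    have h1 : 1 ≤ n := by
      have : (0 : ℝ) < n := lt_of_le_of_lt (vc_nonneg C) hn
      exact_mod_cast this
    exact trans_ex hL hX hc C hC hcl h1 hmn hMN (trc_vc hL hC hn)
  · obtain ⟨n, hn⟩ := exists_nat_gt (vcCodensity C)
    obtain ⟨T, -, hT⟩ := h C hC hcl ⟨_, n, le_rfl, hn, dir_mn hd _⟩
    exact dir_tr hd T hT

end

/-- a definable topological space `(X,τ)` is definably compact iff every
definable family of nonempty `τ`-closed subsets of `X` with the `(m,n)`-property for some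
`m ≥ n > dim(∪C)` has a finite transversal in `X`, iff the same holds with `n` greater than
the VC-codensity of the family. -/
theorem statement15 (L : FirstOrder.Language) (M : Type*) [L.Structure M] [LinearOrder M]
    (hM : IsOMinimal L M) (k : ℕ) (X : Set (Fin k → M)) [TopologicalSpace ↥X]
    (hX : IsDefTopSpace L X) :
    (DefinablyCompact L X ↔
      ∀ C : Set (Set (Fin k → M)), IsDefFamily L (Set.univ : Set M) k C →
        (∀ Y ∈ C, Y.Nonempty ∧ TauClosed X Y) →
        (∃ m n : ℕ, n ≤ m ∧ oDim (⋃₀ C) < n ∧ HasMNProperty C m n) →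
        ∃ T : Finset (Fin k → M), ↑T ⊆ X ∧ ∀ Y ∈ C, ∃ x ∈ T, x ∈ Y) ∧
    (DefinablyCompact L X ↔
      ∀ C : Set (Set (Fin k → M)), IsDefFamily L (Set.univ : Set M) k C →
        (∀ Y ∈ C, Y.Nonempty ∧ TauClosed X Y) →
        (∃ m n : ℕ, n ≤ m ∧ vcCodensity C < (n : ℝ) ∧ HasMNProperty C m n) →
        ∃ T : Finset (Fin k → M), ↑T ⊆ X ∧ ∀ Y ∈ C, ∃ x ∈ T, x ∈ Y) := by
  exact @main_abs M (omOf L hM) L _ (fun _ => Iff.rfl) k X _ hX
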